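/- Let T = X + iY satisfy assumption (A). For almost all fixed t, λ ∈ [a,b], the positive measures Δ ↦ ξ(t; Δ) and Ω ↦ η(Ω; λ) on the Borel sets of [a,b] are absolutely continuous with respect to Lebesgue measure, and their Radon–Nikodym derivatives coincide: ξ(t; dλ)/dλ = η(dt; λ)/dt ≡ r(t, λ) ≥ 0 for almost all t, λ ∈ [a,b], with ‖r‖_{L¹([a,b]²)} = Tr(D²). -/

import Mathlib

open scoped InnerProductSpace
open MeasureTheory Polynomial

namespace HHCP

variable {H : Type*} [NormedAddCommGroup H] [InnerProductSpace ℂ H] [CompleteSpace H]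
  [TopologicalSpace.SeparableSpace H]

/-- `f(A)` for a function `f` of a real variable, applied to the (selfadjoint, hence
star-normal) bounded operator `A` via the continuous functional calculus. -/
noncomputable def fc (f : ℝ → ℂ) (A : H →L[ℂ] H) : H →L[ℂ] H :=
  cfc (fun z : ℂ => f z.re) A

/-- `|A| = √(A⋆A)`. -/
noncomputable def absOp (A : H →L[ℂ] H) : H →L[ℂ] H :=
  cfc Real.sqrt (ContinuousLinearMap.adjoint A * A)

/-- `A` is of trace class, i.e. `∑ ⟪eᵢ, |A| eᵢ⟫ < ∞` (this is independent of the
choice of the Hilbert basis `e`). -/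
def IsTraceClass {ι : Type*} (e : HilbertBasis ι ℂ H) (A : H →L[ℂ] H) : Prop :=
  Summable fun i => (⟪e i, absOp A (e i)⟫_ℂ).re

/-- The trace norm `‖A‖₁ = Tr |A|`. -/
noncomputable def traceNorm {ι : Type*} (e : HilbertBasis ι ℂ H) (A : H →L[ℂ] H) : ℝ :=
  ∑' i, (⟪e i, absOp A (e i)⟫_ℂ).re

/-- The trace `Tr A = ∑ᵢ ⟪eᵢ, A eᵢ⟫`. -/
noncomputable def trace {ι : Type*} (e : HilbertBasis ι ℂ H) (A : H →L[ℂ] H) : ℂ :=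
  ∑' i, ⟪e i, A (e i)⟫_ℂ

/-- `T` is hyponormal (`‖T⋆x‖ ≤ ‖Tx‖`, i.e. `[T⋆,T] ≥ 0`) and *purely* so: there is no
nonzero closed subspace, invariant under `T` and `T⋆`, on which `T` is normal. -/
def PurelyHyponormal (T : H →L[ℂ] H) : Prop :=
  (∀ x : H, ‖ContinuousLinearMap.adjoint T x‖ ≤ ‖T x‖) ∧
  ∀ S : Submodule ℂ H, IsClosed (S : Set H) →
    (∀ x ∈ S, T x ∈ S) → (∀ x ∈ S, ContinuousLinearMap.adjoint T x ∈ S) →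
    (∀ x ∈ S, ‖T x‖ = ‖ContinuousLinearMap.adjoint T x‖) → S = ⊥

/-- Assumption (A): `T = X + iY` is purely hyponormal with `X, Y` selfadjoint,
`[T⋆,T] = −2i[Y,X] = 2D²` is a positive trace-class operator, and
`σ(X) ∪ σ(Y) ⊆ [a,b]`. -/
structure AssumptionA {ι : Type*} (e : HilbertBasis ι ℂ H)
    (X Y D2 : H →L[ℂ] H) (a b : ℝ) : Prop where
  hab : a ≤ b
  hX : IsSelfAdjoint X
  hY : IsSelfAdjoint Y
  hpure : PurelyHyponormal (X + Complex.I • Y)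
  hD2 : (2 : ℂ) • D2 = (-(2 : ℂ) * Complex.I) • (Y * X - X * Y)
  hpos : D2.IsPositive
  htc : IsTraceClass e D2
  hspecX : spectrum ℝ X ⊆ Set.Icc a b
  hspecY : spectrum ℝ Y ⊆ Set.Icc a b

/-- `ψ ∈ C¹₁`: `ψ(β) = (2π)^{-1/2} ∫ ψ̂(α) e^{iαβ} dα` for some `ψ̂` with
`∫ |ψ̂(α)|(1+|α|) dα < ∞`. -/
def MemC11 (ψ : ℝ → ℂ) : Prop :=
  ∃ g : ℝ → ℂ, Integrable g ∧ Integrable (fun α : ℝ => α • g α) ∧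
    ∀ β : ℝ, ψ β = (Real.sqrt (2 * Real.pi))⁻¹ •
      ∫ α : ℝ, Complex.exp (Complex.I * (α : ℂ) * (β : ℂ)) • g α

/-- `ψ` is (the function given by) a polynomial with complex coefficients. -/
def IsPolyFun (ψ : ℝ → ℂ) : Prop :=
  ∃ p : Polynomial ℂ, ∀ t : ℝ, ψ t = Polynomial.eval (t : ℂ) p

/-- `ψ` is either in `C¹₁([a,b])` or a polynomial. -/
def GoodFun (ψ : ℝ → ℂ) : Prop := MemC11 ψ ∨ IsPolyFun ψ

/-- `E` is the spectral measure of the selfadjoint operator `A`: a projection-valued,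
countably additive measure on `ℝ` such that `⟪x, f(A) x⟫ = ∫ f dμ_x`, where `μ_x` is the
finite positive measure `μ_x(Δ) = ⟪x, E(Δ) x⟫`. -/
def IsSpectralMeasureOf (A : H →L[ℂ] H) (E : Set ℝ → H →L[ℂ] H) : Prop :=
  (∀ Δ : Set ℝ, IsSelfAdjoint (E Δ)) ∧
  (∀ Δ Ω : Set ℝ, E (Δ ∩ Ω) = E Δ * E Ω) ∧
  E Set.univ = 1 ∧
  (∀ Δ : ℕ → Set ℝ, (∀ n, MeasurableSet (Δ n)) → Pairwise (Function.onFun Disjoint Δ) →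
    ∀ x : H, HasSum (fun n => E (Δ n) x) (E (⋃ n, Δ n) x)) ∧
  ∀ x : H, ∃ μ : Measure ℝ, IsFiniteMeasure μ ∧
    (∀ Δ : Set ℝ, MeasurableSet Δ → (μ Δ).toReal = (⟪x, E Δ x⟫_ℂ).re) ∧
    ∀ f : ℝ → ℝ, Continuous f → (⟪x, cfc f A x⟫_ℂ).re = ∫ t, f t ∂μ

/-- An indefinite integral `𝒥(χ_Δ)` of the characteristic function of `Δ`. -/
noncomputable def Jind (a : ℝ) (Δ : Set ℝ) (t : ℝ) : ℝ :=
  ∫ s in a..t, Set.indicator Δ (fun _ => (1 : ℝ)) s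

/-- `𝒥(χ_Δ)(A)`. -/
noncomputable def JindOp (a : ℝ) (Δ : Set ℝ) (A : H →L[ℂ] H) : H →L[ℂ] H :=
  fc (fun t => (Jind a Δ t : ℂ)) A

/-- `ψ ∈ C¹([a,b])` with derivative `ψd` on `[a,b]`. -/
def HasDerivOnIcc (ψ ψd : ℝ → ℂ) (a b : ℝ) : Prop :=
  (∀ t ∈ Set.Icc a b, HasDerivWithinAt ψ (ψd t) (Set.Icc a b) t) ∧
  ContinuousOn ψd (Set.Icc a b)

/-- `r` is a Carey–Pincus principal function for the pair `X, Y`: a nonnegative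
`L¹([a,b]²)` function with `Tr(−i[ψ(Y), φ(X)]) = ∫∫ φ′(t) ψ′(λ) r(t,λ) dt dλ`
for all `ψ, φ ∈ C¹([a,b])`. -/
def IsPrincipalFunction {ι : Type*} (e : HilbertBasis ι ℂ H) (X Y : H →L[ℂ] H)
    (a b : ℝ) (r : ℝ → ℝ → ℝ) : Prop :=
  IntegrableOn (fun q : ℝ × ℝ => r q.1 q.2) (Set.Icc a b ×ˢ Set.Icc a b) ∧
  (∀ᵐ q : ℝ × ℝ ∂(volume : Measure (ℝ × ℝ)),
    q ∈ Set.Icc a b ×ˢ Set.Icc a b → 0 ≤ r q.1 q.2) ∧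
  ∀ ψ ψd φ φd : ℝ → ℂ, HasDerivOnIcc ψ ψd a b → HasDerivOnIcc φ φd a b →
    trace e ((-Complex.I) • (fc ψ Y * fc φ X - fc φ X * fc ψ Y)) =
      ∫ t in Set.Icc a b, ∫ l in Set.Icc a b, φd t * ψd l * (r t l : ℂ)

/-- The Jacobian `J(F,G)(t,λ) = ∂F/∂t ∂G/∂λ − ∂F/∂λ ∂G/∂t`. -/
noncomputable def Jac (F G : ℝ → ℝ → ℂ) (t l : ℝ) : ℂ :=
  deriv (fun s => F s l) t * deriv (fun s => G t s) l -
    deriv (fun s => F t s) l * deriv (fun s => G s l) t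

end HHCP

section PartB
open MeasureTheory Filter Topology
namespace HHCP

/-- bounded linear functional for the `L¹` seminorm, on integrable functions -/
structure L1F (μ : Measure ℝ) (l : (ℝ → ℝ) → ℂ) : Prop where
  add : ∀ f g, Integrable f μ → Integrable g μ → l (fun x => f x + g x) = l f + l g
  smul : ∀ (c : ℝ) f, Integrable f μ → l (fun x => c * f x) = c * l f
  bound : ∃ c : ℝ, 0 ≤ c ∧ ∀ f, Integrable f μ → ‖l f‖ ≤ c * ∫ x, |f x| ∂μ

theorem L1F.sub {μ : Measure ℝ} {l : (ℝ → ℝ) → ℂ} (h : L1F μ l) {f g : ℝ → ℝ}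
    (hf : Integrable f μ) (hg : Integrable g μ) : l (fun x => f x - g x) = l f - l g := by
  have h1 := h.smul (-1) g hg
  have h2 := h.add f (fun x => (-1) * g x) hf (hg.const_mul _)
  rw [h1] at h2
  have : (fun x => f x - g x) = (fun x => f x + (-1) * g x) := by ext x; ring
  rw [this, h2]; push_cast; ring

theorem L1F.congr {μ : Measure ℝ} {l : (ℝ → ℝ) → ℂ} (h : L1F μ l) {f g : ℝ → ℝ}
    (hf : Integrable f μ) (hfg : f =ᵐ[μ] g) : l f = l g := by
  have hg : Integrable g μ := hf.congr hfg
  obtain ⟨c, hc, hb⟩ := h.bound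
  have h1 := hb _ (hf.sub hg)
  have h2 : ∫ x, |(f - g) x| ∂μ = 0 := by
    rw [integral_congr_ae (g := fun _ => (0:ℝ))]
    · simp
    · filter_upwards [hfg] with x hx
      simp [hx]
  rw [h2, mul_zero] at h1
  have h3 := h.sub hf hg
  have h4 : l (f - g) = 0 := norm_le_zero_iff.1 h1
  have h5 : l (fun x => f x - g x) = 0 := h4
  rw [h5] at h3
  exact (sub_eq_zero.1 h3.symm)

theorem int_ind {μ : Measure ℝ} [IsFiniteMeasure μ] {Ω : Set ℝ} (hΩ : MeasurableSet Ω) :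
    Integrable (Set.indicator Ω (fun _ => (1 : ℝ))) μ :=
  (integrable_const 1).indicator hΩ

theorem isClosed_ind (μ : Measure ℝ) [IsFiniteMeasure μ] :
    IsClosed {f : Lp ℝ 1 μ | ∀ᵐ x ∂μ, f x = 0 ∨ f x = 1} := by
  rw [← isSeqClosed_iff_isClosed]
  intro u f hu hf
  have h1 := tendstoInMeasure_of_tendsto_Lp hf
  obtain ⟨ns, -, hns⟩ := h1.exists_seq_tendsto_ae
  have h2 : ∀ᵐ x ∂μ, ∀ n, u n x = 0 ∨ u n x = 1 := ae_all_iff.2 hu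
  filter_upwards [hns, h2] with x hx hx2
  have hc : IsClosed ({0, 1} : Set ℝ) := (Set.toFinite _).isClosed
  have := hc.mem_of_tendsto hx (Eventually.of_forall fun n => by simpa using hx2 (ns n))
  simpa using this

theorem lip_Lp {μ : Measure ℝ} {l : (ℝ → ℝ) → ℂ} (h : L1F μ l) :
    Continuous (fun f : Lp ℝ 1 μ => l f) := by
  obtain ⟨c, hc, hb⟩ := h.bound
  refine LipschitzWith.continuous (K := ⟨c, hc⟩) (LipschitzWith.of_dist_le_mul fun f g => ?_)
  have hf : Integrable f μ := L1.integrable_coeFn f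
  have hg : Integrable g μ := L1.integrable_coeFn g
  rw [dist_eq_norm, ← h.sub hf hg, dist_eq_norm, L1.norm_eq_integral_norm]
  refine (hb _ (hf.sub hg)).trans (le_of_eq ?_)
  congr 1
  apply integral_congr_ae
  filter_upwards [Lp.coeFn_sub f g] with x hx
  rw [hx]
  rfl

theorem baire_step {ι : Type*} (μ : Measure ℝ) [IsFiniteMeasure μ] (l : ι → (ℝ → ℝ) → ℂ)
    (hl : ∀ i, L1F μ (l i))
    (hs : ∀ Ω : Set ℝ, MeasurableSet Ω →
      Summable fun i => ‖l i (Set.indicator Ω (fun _ => (1 : ℝ)))‖) :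
    ∃ K ε : ℝ, 0 < ε ∧ 0 ≤ K ∧ ∀ B : Set ℝ, MeasurableSet B → (μ B).toReal < ε → ∀ F : Finset ι,
      ∑ i ∈ F, ‖l i (Set.indicator B (fun _ => (1 : ℝ)))‖ ≤ K := by
  classical
  set I : Set (Lp ℝ 1 μ) := {f : Lp ℝ 1 μ | ∀ᵐ x ∂μ, f x = 0 ∨ f x = 1} with hI
  have hIc : IsClosed I := isClosed_ind μ
  have : CompleteSpace I := hIc.completeSpace_coe
  have h0I : (0 : Lp ℝ 1 μ) ∈ I := by
    filter_upwards [Lp.coeFn_zero ℝ 1 μ] with x hx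
    left; simpa using hx
  have : Nonempty I := ⟨⟨0, h0I⟩⟩
  set A : ℕ → Set I := fun K => {f | ∀ F : Finset ι, ∑ i ∈ F, ‖l i (f : Lp ℝ 1 μ)‖ ≤ K} with hA
  have hAc : ∀ K, IsClosed (A K) := by
    intro K
    have : A K = ⋂ F : Finset ι, {f : I | ∑ i ∈ F, ‖l i (f : Lp ℝ 1 μ)‖ ≤ K} := by
      ext f; simp [hA]
    rw [this]
    refine isClosed_iInter fun F => isClosed_le ?_ continuous_const
    exact continuous_finsetSum _ fun i _ =>
      ((lip_Lp (hl i)).comp continuous_subtype_val).norm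
  have key : ∀ f : I, ∃ Ω : Set ℝ, MeasurableSet Ω ∧
      (f : Lp ℝ 1 μ) =ᵐ[μ] Set.indicator Ω (fun _ => (1 : ℝ)) := by
    intro f
    refine ⟨(f : Lp ℝ 1 μ) ⁻¹' {1}, (Lp.stronglyMeasurable _).measurable (measurableSet_singleton 1), ?_⟩
    have := f.2
    simp only [hI, Set.mem_ofPred_eq] at this
    filter_upwards [this] with x hx
    rcases hx with hx | hx <;> simp [Set.indicator, hx]
  have hAu : (⋃ K, A K) = Set.univ := by
    rw [Set.eq_univ_iff_forall]
    intro f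
    obtain ⟨Ω, hΩ, hf⟩ := key f
    obtain ⟨K, hK⟩ := exists_nat_ge (∑' i, ‖l i (Set.indicator Ω (fun _ => (1 : ℝ)))‖)
    refine Set.mem_iUnion.2 ⟨K, fun F => ?_⟩
    refine le_trans (le_of_eq ?_) (((hs Ω hΩ).sum_le_tsum F (fun i _ => norm_nonneg _)).trans hK)
    refine Finset.sum_congr rfl fun i _ => ?_
    rw [(hl i).congr (L1.integrable_coeFn _) hf]
  obtain ⟨K, f0, hf0⟩ := nonempty_interior_of_iUnion_of_closed hAc hAu
  obtain ⟨ε, hε, hball⟩ := Metric.mem_nhds_iff.1 (mem_interior_iff_mem_nhds.1 hf0)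
  obtain ⟨Ω, hΩ, hf0Ω⟩ := key f0
  have near : ∀ Ω' : Set ℝ, MeasurableSet Ω' → ∀ B : Set ℝ, MeasurableSet B →
      (μ B).toReal < ε → (∀ x, x ∉ B → (x ∈ Ω' ↔ x ∈ Ω)) → ∀ F : Finset ι,
      ∑ i ∈ F, ‖l i (Set.indicator Ω' (fun _ => (1 : ℝ)))‖ ≤ K := by
    intro Ω' hΩ' B hB hBε hd F
    have hi := int_ind (μ := μ) hΩ'
    have hco := hi.coeFn_toL1
    have hmem : hi.toL1 _ ∈ I := by
      show ∀ᵐ x ∂μ, _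
      filter_upwards [hco] with x hx
      rw [hx]
      by_cases hxx : x ∈ Ω' <;> simp [hxx]
    have hb : (⟨hi.toL1 _, hmem⟩ : I) ∈ A K := by
      apply hball
      rw [Metric.mem_ball, Subtype.dist_eq, dist_eq_norm, L1.norm_eq_integral_norm]
      refine lt_of_le_of_lt ?_ hBε
      have : (μ B).toReal = ∫ x, Set.indicator B (fun _ => (1:ℝ)) x ∂μ := by
        rw [integral_indicator hB]; simp [Measure.real]
      rw [this]
      apply integral_mono_ae (L1.integrable_coeFn _).norm (int_ind hB)
      filter_upwards [Lp.coeFn_sub (hi.toL1 _) (f0 : Lp ℝ 1 μ), hco, hf0Ω] with x h1 h2 h3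
      simp only [h1, Pi.sub_apply, h2, h3]
      have := hd x
      by_cases hxB : x ∈ B <;> by_cases h1 : x ∈ Ω' <;> by_cases h2 : x ∈ Ω <;>
        simp_all
    have := hb F
    refine le_trans (le_of_eq ?_) this
    refine Finset.sum_congr rfl fun i _ => ?_
    rw [(hl i).congr (L1.integrable_coeFn _) hco]
  refine ⟨K + K, ε, hε, by positivity, fun B hB hBε F => ?_⟩
  have h1 := near (Ω ∪ B) (hΩ.union hB) B hB hBε (by intro x hx; simp [hx]) F
  have h2 := near (Ω \ B) (hΩ.diff hB) B hB hBε (by intro x hx; simp [hx]) F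
  refine le_trans ?_ (add_le_add h1 h2)
  rw [← Finset.sum_add_distrib]
  refine Finset.sum_le_sum fun i _ => ?_
  have : Set.indicator B (fun _ => (1:ℝ)) = fun x => Set.indicator (Ω ∪ B) (fun _ => (1:ℝ)) x -
      Set.indicator (Ω \ B) (fun _ => (1:ℝ)) x := by
    ext x
    by_cases hxB : x ∈ B <;> by_cases h2 : x ∈ Ω <;> simp [hxB, h2]
  rw [this, (hl i).sub (int_ind (hΩ.union hB)) (int_ind (hΩ.diff hB))]
  exact norm_sub_le _ _

theorem nik_bound {ι : Type*} (a b : ℝ) (l : ι → (ℝ → ℝ) → ℂ)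
    (hl : ∀ i, L1F (volume.restrict (Set.Icc a b)) (l i))
    (hs : ∀ Ω : Set ℝ, MeasurableSet Ω →
      Summable fun i => ‖l i (Set.indicator Ω (fun _ => (1 : ℝ)))‖) :
    ∃ K : ℝ, 0 ≤ K ∧ ∀ B : Set ℝ, MeasurableSet B → ∀ F : Finset ι,
      ∑ i ∈ F, ‖l i (Set.indicator B (fun _ => (1 : ℝ)))‖ ≤ K := by
  obtain ⟨K, ε, hε, hK, h⟩ := baire_step _ l hl hs
  have ind : ∀ (n : ℕ) (B : Set ℝ), MeasurableSet B → ∀ F : Finset ι,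
      ∑ i ∈ F, ‖l i (Set.indicator (B ∩ Set.Iic (a + n * (ε / 2))) (fun _ => (1 : ℝ)))‖
        ≤ (n + 1) * K := by
    intro n
    induction n with
    | zero =>
      intro B hB F
      have h0 := h (B ∩ Set.Iic (a + (0:ℕ) * (ε / 2))) (hB.inter measurableSet_Iic) (by
        have : (volume.restrict (Set.Icc a b)) (B ∩ Set.Iic (a + (0:ℕ) * (ε / 2))) = 0 := by
          refine le_antisymm ?_ bot_le
          rw [Measure.restrict_apply (hB.inter measurableSet_Iic)]
          refine (measure_mono (t := {a}) ?_).trans (by simp)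
          rintro x ⟨⟨_, hx⟩, hx2, _⟩
          simp at hx
          exact le_antisymm hx hx2
        rw [this]; simpa using hε) F
      simpa using h0
    | succ n ih =>
      intro B hB F
      have h1 := ih B hB F
      have hm : MeasurableSet (B ∩ Set.Ioc (a + n * (ε / 2)) (a + (n + 1 : ℕ) * (ε / 2))) :=
        hB.inter measurableSet_Ioc
      have h2 := h _ hm (by
        have h3 : (volume.restrict (Set.Icc a b))
            (B ∩ Set.Ioc (a + n * (ε / 2)) (a + (n + 1 : ℕ) * (ε / 2))) ≤
            ENNReal.ofReal (ε / 2) := by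
          refine (Measure.restrict_apply_le _ _).trans ?_
          refine (measure_mono Set.inter_subset_right).trans ?_
          rw [Real.volume_Ioc]
          apply ENNReal.ofReal_le_ofReal
          push_cast; linarith
        refine lt_of_le_of_lt (ENNReal.toReal_mono ENNReal.ofReal_ne_top h3) ?_
        rw [ENNReal.toReal_ofReal (by positivity)]
        linarith) F
      push_cast at h2 ⊢
      have e : ((n : ℝ) + 1 + 1) * K = (n + 1) * K + K := by ring
      rw [e]
      refine le_trans ?_ (add_le_add h1 h2)
      rw [← Finset.sum_add_distrib]
      refine Finset.sum_le_sum fun i _ => ?_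
      have : Set.indicator (B ∩ Set.Iic (a + ((n:ℝ) + 1) * (ε / 2))) (fun _ => (1:ℝ)) =
          fun x => Set.indicator (B ∩ Set.Iic (a + n * (ε / 2))) (fun _ => (1:ℝ)) x +
        Set.indicator (B ∩ Set.Ioc (a + n * (ε / 2)) (a + ((n:ℝ) + 1) * (ε / 2)))
          (fun _ => (1:ℝ)) x := by
        ext x
        by_cases hB : x ∈ B
        · by_cases h1 : x ≤ a + n * (ε / 2)
          · have : x ≤ a + (n + 1) * (ε / 2) := by linarith
            simp [Set.indicator, hB, h1, this]
          · by_cases h2 : x ≤ a + (n + 1) * (ε / 2)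
            · simp [Set.indicator, hB, h2, not_le.1 h1, h1]
            · simp [Set.indicator, h2, h1]
        · simp [hB]
      push_cast at hm
      rw [this, (hl i).add _ _ (int_ind (hB.inter measurableSet_Iic)) (int_ind hm)]
      exact norm_add_le _ _
  obtain ⟨n, hn⟩ := exists_nat_ge ((b - a) / (ε / 2))
  refine ⟨(n + 1) * K, by positivity, fun B hB F => ?_⟩
  refine le_trans (le_of_eq ?_) (ind n B hB F)
  refine Finset.sum_congr rfl fun i _ => ?_
  congr 1
  refine (hl i).congr (int_ind hB) ?_
  filter_upwards [ae_restrict_mem measurableSet_Icc] with x hx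
  have : x ≤ a + n * (ε / 2) := by
    rw [div_le_iff₀ (by positivity)] at hn
    linarith [hx.2]
  by_cases hxB : x ∈ B <;> simp [hxB, this]

/-- binary digits of `f` -/
noncomputable def dig (f : ℝ → ℝ) : ℕ → ℝ → ℝ
  | 0 => fun _ => 0
  | n + 1 => fun x => dig f n x +
      (1 / 2) ^ (n + 1) * Set.indicator {y | dig f n y + (1 / 2) ^ (n + 1) ≤ f y} (fun _ => (1 : ℝ)) x

noncomputable def digS (f : ℝ → ℝ) (n : ℕ) : Set ℝ := {y | dig f n y + (1 / 2) ^ (n + 1) ≤ f y}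

theorem dig_succ (f : ℝ → ℝ) (n : ℕ) : dig f (n + 1) = fun x => dig f n x +
      (1 / 2) ^ (n + 1) * Set.indicator (digS f n) (fun _ => (1 : ℝ)) x := rfl

theorem dig_meas {f : ℝ → ℝ} (hf : Measurable f) (n : ℕ) : Measurable (dig f n) := by
  induction n with
  | zero => exact measurable_const
  | succ n ih =>
    rw [dig_succ]
    refine ih.add (measurable_const.mul (measurable_const.indicator ?_))
    exact measurableSet_le (ih.add_const _) hf

theorem digS_meas {f : ℝ → ℝ} (hf : Measurable f) (n : ℕ) : MeasurableSet (digS f n) :=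
  measurableSet_le ((dig_meas hf n).add_const _) hf

theorem dig_bd {f : ℝ → ℝ} (h0 : ∀ x, 0 ≤ f x) (h1 : ∀ x, f x ≤ 1) (n : ℕ) (x : ℝ) :
    0 ≤ f x - dig f n x ∧ f x - dig f n x ≤ (1 / 2) ^ n := by
  induction n with
  | zero => simp [dig, h0, h1]
  | succ n ih =>
    rw [dig_succ]
    by_cases hx : x ∈ digS f n
    · have : dig f n x + (1 / 2) ^ (n + 1) ≤ f x := hx
      simp only [hx, Set.indicator_of_mem]
      have e : (1 / 2 : ℝ) ^ n = 2 * (1 / 2) ^ (n + 1) := by rw [pow_succ]; ring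
      constructor <;> linarith [ih.1, ih.2]
    · have : ¬ (dig f n x + (1 / 2) ^ (n + 1) ≤ f x) := hx
      simp only [hx, not_false_eq_true, Set.indicator_of_notMem]
      constructor <;> linarith [ih.1, ih.2]

theorem nik_ext {ι Q : Type*} [MeasurableSpace Q] (M : Measure Q) (a b : ℝ)
    (p : Q → ℝ) (hp : Measurable p) (h : Q → ℝ) (hh : Integrable h M) (l : ι → (ℝ → ℝ) → ℂ)
    (hl : ∀ i, L1F (volume.restrict (Set.Icc a b)) (l i))
    (hs : ∀ Ω : Set ℝ, MeasurableSet Ω →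
      HasSum (fun i => l i (Set.indicator Ω (fun _ => (1 : ℝ))))
        ((∫ q, Set.indicator Ω (fun _ => (1 : ℝ)) (p q) * h q ∂M : ℝ) : ℂ))
    (f : ℝ → ℝ) (hf : Measurable f) (h0 : ∀ x, 0 ≤ f x) (h1 : ∀ x, f x ≤ 1) :
    HasSum (fun i => l i f) ((∫ q, f (p q) * h q ∂M : ℝ) : ℂ) := by
  classical
  have hsn : ∀ Ω : Set ℝ, MeasurableSet Ω →
      Summable fun i => ‖l i (Set.indicator Ω (fun _ => (1 : ℝ)))‖ :=
    fun Ω hΩ => summable_norm_iff.2 (hs Ω hΩ).summable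
  obtain ⟨K, hK, hKb⟩ := nik_bound a b l hl hsn
  set μ := volume.restrict (Set.Icc a b) with hμ
  have hdi : ∀ n, Integrable (dig f n) μ := by
    intro n
    refine Integrable.of_bound (C := 2) (dig_meas hf n).aestronglyMeasurable ?_
    refine Eventually.of_forall fun x => ?_
    have := dig_bd h0 h1 n x
    have h3 : (1 / 2 : ℝ) ^ n ≤ 1 := pow_le_one₀ (by norm_num) (by norm_num)
    rw [Real.norm_eq_abs, abs_le]
    constructor <;> linarith [h0 x, h1 x, this.1, this.2]
  have hfi : Integrable f μ := by
    refine Integrable.of_bound (C := 1) hf.aestronglyMeasurable ?_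
    refine Eventually.of_forall fun x => ?_
    rw [Real.norm_eq_abs, abs_le]
    constructor <;> linarith [h0 x, h1 x]
  set g : ι → ℕ → ℂ := fun i n => ((1 / 2 : ℝ) ^ (n + 1) : ℝ) *
    l i (Set.indicator (digS f n) (fun _ => (1 : ℝ))) with hg
  set Λ : ℕ → ℝ := fun n => ∫ q, Set.indicator (digS f n) (fun _ => (1 : ℝ)) (p q) * h q ∂M with hΛ
  have hhal : Tendsto (fun n : ℕ => (1 / 2 : ℝ) ^ n) atTop (𝓝 0) :=
    tendsto_pow_atTop_nhds_zero_of_lt_one (by norm_num) (by norm_num)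
  -- partial sums in n for fixed i
  have hpart : ∀ i N, ∑ n ∈ Finset.range N, g i n = l i (dig f N) := by
    intro i N
    induction N with
    | zero =>
      have := (hl i).smul 0 (fun _ => 0) (integrable_zero _ _ _)
      simp at this
      simp [dig, this]
    | succ N ih =>
      rw [Finset.sum_range_succ, ih, dig_succ, (hl i).add _ _ (hdi N)
        ((int_ind (digS_meas hf N)).const_mul _), (hl i).smul _ _ (int_ind (digS_meas hf N))]
  have htend : ∀ i, Tendsto (fun N => l i (dig f N)) atTop (𝓝 (l i f)) := by
    intro i
    obtain ⟨c, hc, hb⟩ := (hl i).bound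
    rw [tendsto_iff_norm_sub_tendsto_zero]
    have hz : Tendsto (fun n : ℕ => c * ((1 / 2 : ℝ) ^ n * (μ Set.univ).toReal)) atTop (𝓝 0) := by
      simpa using (hhal.mul_const (μ Set.univ).toReal).const_mul c
    refine squeeze_zero (fun _ => norm_nonneg _) (fun n => ?_) hz
    rw [norm_sub_rev, ← (hl i).sub hfi (hdi n)]
    refine (hb _ (hfi.sub (hdi n))).trans ?_
    refine mul_le_mul_of_nonneg_left ?_ hc
    have : ∫ x, |f x - dig f n x| ∂μ ≤ ∫ x, (1 / 2 : ℝ) ^ n ∂μ := by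
      refine integral_mono (hfi.sub (hdi n)).abs (integrable_const _) fun x => ?_
      have := dig_bd h0 h1 n x
      show |f x - dig f n x| ≤ _
      rw [abs_of_nonneg this.1]; exact this.2
    refine this.trans (le_of_eq ?_)
    simp [Measure.real, mul_comm]
  have hsumn : Summable (fun x : ℕ × ι => ‖g x.2 x.1‖) := by
    rw [summable_prod_of_nonneg (fun _ => norm_nonneg _)]
    have hK' : ∀ n, ∑' i, ‖g i n‖ ≤ (1 / 2 : ℝ) ^ (n + 1) * K := by
      intro n
      have e : ∀ i, ‖g i n‖ = (1 / 2 : ℝ) ^ (n + 1) *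
          ‖l i (Set.indicator (digS f n) (fun _ => (1 : ℝ)))‖ := by
        intro i
        simp only [hg, norm_mul, Complex.norm_real]
        rw [Real.norm_of_nonneg (by positivity)]
      simp_rw [e]
      rw [tsum_mul_left]
      refine mul_le_mul_of_nonneg_left ?_ (by positivity)
      exact (hsn _ (digS_meas hf n)).tsum_le_of_sum_le (hKb _ (digS_meas hf n))
    refine ⟨fun n => ?_, ?_⟩
    · have := (hsn _ (digS_meas hf n)).mul_left ((1 / 2 : ℝ) ^ (n + 1))
      refine this.congr fun i => ?_
      simp only [hg, norm_mul, Complex.norm_real]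
      rw [Real.norm_of_nonneg (by positivity)]
    · refine Summable.of_nonneg_of_le (fun n => tsum_nonneg fun _ => norm_nonneg _) hK' ?_
      refine Summable.mul_right _ ?_
      exact (summable_nat_add_iff 1).2 (summable_geometric_of_lt_one (by norm_num) (by norm_num))
  have hsum : Summable (fun x : ℕ × ι => g x.2 x.1) := hsumn.of_norm
  obtain ⟨S, hS⟩ := hsum
  have hn : HasSum (fun n => (((1 / 2 : ℝ) ^ (n + 1) * Λ n : ℝ) : ℂ)) S := by
    refine hS.prod_fiberwise fun n => ?_
    have := (hs _ (digS_meas hf n)).mul_left (((1 / 2 : ℝ) ^ (n + 1) : ℝ) : ℂ)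
    rw [Complex.ofReal_mul]
    exact this
  have hi : HasSum (fun i => l i f) S := by
    have hS' : HasSum (fun x : ι × ℕ => g x.1 x.2) S := by
      rw [← (Equiv.prodComm ℕ ι).hasSum_iff]
      exact hS
    refine hS'.prod_fiberwise fun i => ?_
    have hsi : Summable (fun n => g i n) := hS'.summable.prod_factor i
    have h2 := hsi.hasSum.tendsto_sum_nat
    simp_rw [hpart] at h2
    have := tendsto_nhds_unique h2 (htend i)
    rw [← this]
    exact hsi.hasSum
  have hii : ∀ n, Integrable (fun q => Set.indicator (digS f n) (fun _ => (1 : ℝ)) (p q) * h q) M := by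
    intro n
    refine hh.bdd_mul (c := 1) ((measurable_const.indicator (digS_meas hf n)).comp hp).aestronglyMeasurable ?_
    refine Eventually.of_forall fun q => ?_
    by_cases hq : p q ∈ digS f n <;> simp [hq]
  have hdii : ∀ n, Integrable (fun q => dig f n (p q) * h q) M := by
    intro n
    refine hh.bdd_mul (c := 2) ((dig_meas hf n).comp hp).aestronglyMeasurable ?_
    refine Eventually.of_forall fun q => ?_
    have := dig_bd h0 h1 n (p q)
    have h3 : (1 / 2 : ℝ) ^ n ≤ 1 := pow_le_one₀ (by norm_num) (by norm_num)
    rw [Real.norm_eq_abs, abs_le]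
    constructor <;> linarith [h0 (p q), h1 (p q), this.1, this.2]
  have hfii : Integrable (fun q => f (p q) * h q) M := by
    refine hh.bdd_mul (c := 1) (hf.comp hp).aestronglyMeasurable ?_
    refine Eventually.of_forall fun q => ?_
    rw [Real.norm_eq_abs, abs_le]
    constructor <;> linarith [h0 (p q), h1 (p q)]
  have hpL : ∀ N, ∑ n ∈ Finset.range N, (1 / 2 : ℝ) ^ (n + 1) * Λ n =
      ∫ q, dig f N (p q) * h q ∂M := by
    intro N
    induction N with
    | zero => simp [dig]
    | succ N ih =>
      rw [Finset.sum_range_succ, ih, dig_succ]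
      simp only [hΛ]
      rw [← integral_const_mul, ← integral_add (hdii N) ((hii N).const_mul _)]
      congr 1; ext q; ring
  have htL : Tendsto (fun N => ∫ q, dig f N (p q) * h q ∂M) atTop (𝓝 (∫ q, f (p q) * h q ∂M)) := by
    rw [tendsto_iff_norm_sub_tendsto_zero]
    have hz : Tendsto (fun n : ℕ => (1 / 2 : ℝ) ^ n * ∫ q, |h q| ∂M) atTop (𝓝 0) := by
      simpa using (hhal.mul_const (∫ q, |h q| ∂M))
    refine squeeze_zero (fun _ => norm_nonneg _) (fun n => ?_) hz
    rw [norm_sub_rev, ← integral_sub hfii (hdii n), ← integral_const_mul]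
    refine (norm_integral_le_integral_norm _).trans ?_
    refine integral_mono (hfii.sub (hdii n)).norm (hh.abs.const_mul _) fun q => ?_
    have := dig_bd h0 h1 n (p q)
    show ‖f (p q) * h q - dig f n (p q) * h q‖ ≤ (1 / 2 : ℝ) ^ n * |h q|
    rw [← sub_mul, norm_mul, Real.norm_of_nonneg this.1, Real.norm_eq_abs]
    exact mul_le_mul_of_nonneg_right this.2 (abs_nonneg _)
  have h3 : Tendsto (fun N => (((∫ q, dig f N (p q) * h q ∂M : ℝ)) : ℂ)) atTop (𝓝 S) := by
    have := hn.tendsto_sum_nat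
    refine this.congr fun N => ?_
    rw [← hpL N]; push_cast; rfl
  have h4 := tendsto_nhds_unique h3
    ((Complex.continuous_ofReal.tendsto _).comp htL)
  rw [h4] at hi
  exact hi

theorem nik_ext' {ι Q : Type*} [MeasurableSpace Q] (M : Measure Q) (a b : ℝ)
    (p : Q → ℝ) (hp : Measurable p) (hpM : ∀ᵐ q ∂M, p q ∈ Set.Icc a b)
    (h : Q → ℝ) (hh : Integrable h M) (l : ι → (ℝ → ℝ) → ℂ)
    (hl : ∀ i, L1F (volume.restrict (Set.Icc a b)) (l i))
    (hs : ∀ Ω : Set ℝ, MeasurableSet Ω →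
      HasSum (fun i => l i (Set.indicator Ω (fun _ => (1 : ℝ))))
        ((∫ q, Set.indicator Ω (fun _ => (1 : ℝ)) (p q) * h q ∂M : ℝ) : ℂ))
    (f : ℝ → ℝ) (hf : Continuous f) :
    HasSum (fun i => l i f) ((∫ q, f (p q) * h q ∂M : ℝ) : ℂ) := by
  obtain ⟨C, hC⟩ := (isCompact_Icc (a := a) (b := b)).exists_bound_of_continuousOn hf.continuousOn
  set D := max C 1 with hD
  have hD0 : 0 < D := lt_of_lt_of_le one_pos (le_max_right _ _)
  have hDf : ∀ x ∈ Set.Icc a b, |f x| ≤ D := fun x hx => (hC x hx).trans (le_max_left _ _)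
  set g : ℝ → ℝ := fun x => max 0 (min 1 ((f x + D) / (2 * D))) with hg
  have hgc : Continuous g := by fun_prop
  have hg0 : ∀ x, 0 ≤ g x := fun x => le_max_left _ _
  have hg1 : ∀ x, g x ≤ 1 := fun x => max_le zero_le_one (min_le_left _ _)
  have hgf : ∀ x ∈ Set.Icc a b, f x = (2 * D) * g x + (-D) * Set.indicator Set.univ (fun _ => (1:ℝ)) x := by
    intro x hx
    have := abs_le.1 (hDf x hx)
    have e1 : (f x + D) / (2 * D) ≤ 1 := by rw [div_le_one (by positivity)]; linarith
    have e2 : 0 ≤ (f x + D) / (2 * D) := div_nonneg (by linarith) (by positivity)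
    simp only [hg, min_eq_right e1, max_eq_right e2, Set.indicator_univ]
    field_simp; ring
  have A := nik_ext M a b p hp h hh l hl hs g hgc.measurable hg0 hg1
  have B := hs Set.univ MeasurableSet.univ
  have S := (A.mul_left ((2 * D : ℝ) : ℂ)).add (B.mul_left ((-D : ℝ) : ℂ))
  have hgi : Integrable g (volume.restrict (Set.Icc a b)) := hgc.integrableOn_Icc
  have hui : Integrable (Set.indicator Set.univ (fun _ => (1:ℝ))) (volume.restrict (Set.Icc a b)) :=
    int_ind MeasurableSet.univ
  have e1 : (fun i => l i f) = fun b => ((2 * D : ℝ) : ℂ) * l b g +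
      ((-D : ℝ) : ℂ) * l b (Set.univ.indicator fun _ => (1 : ℝ)) := by
    ext i
    rw [← (hl i).smul _ _ hgi, ← (hl i).smul _ _ hui,
      ← (hl i).add _ _ (hgi.const_mul _) (hui.const_mul _)]
    refine (hl i).congr hf.integrableOn_Icc ?_
    filter_upwards [ae_restrict_mem measurableSet_Icc] with x hx
    exact hgf x hx
  have e2 : ((∫ q, f (p q) * h q ∂M : ℝ) : ℂ) = ((2 * D : ℝ) : ℂ) * ((∫ q, g (p q) * h q ∂M : ℝ) : ℂ) +
      ((-D : ℝ) : ℂ) * ((∫ q, Set.univ.indicator (fun _ => (1 : ℝ)) (p q) * h q ∂M : ℝ) : ℂ) := by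
    rw [← Complex.ofReal_mul, ← Complex.ofReal_mul, ← Complex.ofReal_add]
    congr 1
    rw [← integral_const_mul, ← integral_const_mul, ← integral_add]
    · apply integral_congr_ae
      filter_upwards [hpM] with q hq
      rw [hgf _ hq]; ring
    · refine Integrable.const_mul ?_ _
      refine hh.bdd_mul (c := 1) (hgc.measurable.comp hp).aestronglyMeasurable ?_
      refine Eventually.of_forall fun q => ?_
      rw [Real.norm_of_nonneg (hg0 _)]; exact hg1 _
    · refine Integrable.const_mul ?_ _
      simpa using hh
  rw [e1, e2]
  exact S

end HHCP

end PartB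

section PartD
open MeasureTheory Filter Topology
open scoped InnerProductSpace
namespace HHCP

variable {H : Type*} [NormedAddCommGroup H] [InnerProductSpace ℂ H] [CompleteSpace H]

theorem parseval {ι : Type*} (e : HilbertBasis ι ℂ H) (v : H) :
    HasSum (fun j => ‖⟪e j, v⟫_ℂ‖ ^ 2) (‖v‖ ^ 2) := by
  have h := e.hasSum_inner_mul_inner v v
  have h2 := (Complex.hasSum_re h)
  have e1 : (⟪v, v⟫_ℂ).re = ‖v‖ ^ 2 := inner_self_eq_norm_sq (𝕜 := ℂ) v
  rw [e1] at h2
  refine h2.congr_fun ?_ |> fun h => h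
  intro j
  rw [← inner_conj_symm v (e j), ← Complex.normSq_eq_conj_mul_self, Complex.ofReal_re,
    Complex.normSq_eq_norm_sq]

/-- Hilbert–Schmidt with respect to `e` -/
def HS {ι : Type*} (e : HilbertBasis ι ℂ H) (P : H →L[ℂ] H) : Prop :=
  Summable fun i => ‖P (e i)‖ ^ 2

theorem HS.double {ι : Type*} {e : HilbertBasis ι ℂ H} {P : H →L[ℂ] H} (h : HS e P) :
    Summable (fun x : ι × ι => ‖⟪e x.2, P (e x.1)⟫_ℂ‖ ^ 2) := by
  rw [summable_prod_of_nonneg (fun _ => by positivity)]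
  refine ⟨fun i => (parseval e (P (e i))).summable, ?_⟩
  refine h.congr fun i => ?_
  exact (parseval e (P (e i))).tsum_eq.symm

theorem HS.adj {ι : Type*} {e : HilbertBasis ι ℂ H} {P : H →L[ℂ] H} (h : HS e P) :
    HS e (ContinuousLinearMap.adjoint P) := by
  have h1 := (Equiv.prodComm ι ι).summable_iff.2 h.double
  have h2 := (summable_prod_of_nonneg (fun _ => sq_nonneg _)).1 h1
  refine h2.2.congr fun i => ?_
  rw [← (parseval e (ContinuousLinearMap.adjoint P (e i))).tsum_eq]
  refine tsum_congr fun j => ?_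
  simp only [Function.comp, Equiv.prodComm_apply, Prod.swap]
  rw [ContinuousLinearMap.adjoint_inner_right, ← inner_conj_symm, RCLike.norm_conj]

theorem HS.left {ι : Type*} {e : HilbertBasis ι ℂ H} {P : H →L[ℂ] H} (h : HS e P)
    (A : H →L[ℂ] H) : HS e (A * P) := by
  refine Summable.of_nonneg_of_le (fun i => by positivity) (fun i => ?_)
    (h.mul_left (‖A‖ ^ 2))
  rw [← mul_pow]
  exact pow_le_pow_left₀ (norm_nonneg _) (A.le_opNorm _) 2

theorem HS.right {ι : Type*} {e : HilbertBasis ι ℂ H} {P : H →L[ℂ] H} (h : HS e P)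
    (A : H →L[ℂ] H) : HS e (P * A) := by
  have := (h.adj.left (ContinuousLinearMap.adjoint A)).adj
  have e1 : ContinuousLinearMap.adjoint (ContinuousLinearMap.adjoint A *
      ContinuousLinearMap.adjoint P) = P * A := by
    rw [← ContinuousLinearMap.star_eq_adjoint, ← ContinuousLinearMap.star_eq_adjoint,
      ← ContinuousLinearMap.star_eq_adjoint, star_mul, star_star, star_star]
  rwa [e1] at this

theorem hs_cyc {ι : Type*} {e : HilbertBasis ι ℂ H} {P Q : H →L[ℂ] H} (hP : HS e P)
    (hQ : HS e Q) : ∃ t : ℂ, HasSum (fun i => ⟪e i, P (Q (e i))⟫_ℂ) t ∧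
      HasSum (fun i => ⟪e i, Q (P (e i))⟫_ℂ) t := by
  set f : ι × ι → ℂ := fun x => ⟪e x.1, P (e x.2)⟫_ℂ * ⟪e x.2, Q (e x.1)⟫_ℂ with hf
  have h1 := (Equiv.prodComm ι ι).summable_iff.2 hP.double
  have hs : Summable f := by
    refine Summable.of_norm_bounded (h1.add hQ.double) fun x => ?_
    simp only [hf, norm_mul, Function.comp, Equiv.prodComm_apply, Prod.swap]
    nlinarith [sq_nonneg (‖⟪e x.1, P (e x.2)⟫_ℂ‖ - ‖⟪e x.2, Q (e x.1)⟫_ℂ‖),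
      sq_nonneg (‖⟪e x.1, P (e x.2)⟫_ℂ‖ + ‖⟪e x.2, Q (e x.1)⟫_ℂ‖),
      norm_nonneg ⟪e x.1, P (e x.2)⟫_ℂ, norm_nonneg ⟪e x.2, Q (e x.1)⟫_ℂ]
  obtain ⟨t, ht⟩ := hs
  refine ⟨t, ht.prod_fiberwise fun i => ?_, ?_⟩
  · have := e.hasSum_inner_mul_inner (ContinuousLinearMap.adjoint P (e i)) (Q (e i))
    simp only [ContinuousLinearMap.adjoint_inner_left] at this
    exact this
  · have ht' := (Equiv.prodComm ι ι).hasSum_iff.2 ht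
    refine ht'.prod_fiberwise fun i => ?_
    have := e.hasSum_inner_mul_inner (ContinuousLinearMap.adjoint Q (e i)) (P (e i))
    simp only [ContinuousLinearMap.adjoint_inner_left] at this
    refine this.congr_fun ?_ |> fun h => h
    intro j
    simp only [hf, Function.comp, Equiv.prodComm_apply, Prod.swap]
    ring

theorem tau_summable {ι : Type*} {e : HilbertBasis ι ℂ H} {S : H →L[ℂ] H} (hS : HS e S)
    (B : H →L[ℂ] H) : Summable (fun i => ‖⟪S (e i), B (S (e i))⟫_ℂ‖) := by
  refine Summable.of_nonneg_of_le (fun _ => norm_nonneg _) (fun i => ?_) (hS.mul_left ‖B‖)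
  refine (norm_inner_le_norm _ _).trans ?_
  have := B.le_opNorm (S (e i))
  nlinarith [norm_nonneg (S (e i))]

/-- `τ(B) = Tr (S⋆ B S)` -/
noncomputable def tau {ι : Type*} (e : HilbertBasis ι ℂ H) (S : H →L[ℂ] H) (hS : HS e S) :
    (H →L[ℂ] H) →L[ℂ] ℂ :=
  LinearMap.mkContinuous
    { toFun := fun B => ∑' i, ⟪S (e i), B (S (e i))⟫_ℂ
      map_add' := by
        intro A B
        rw [← (tau_summable hS A).of_norm.tsum_add (tau_summable hS B).of_norm]
        simp [inner_add_right]
      map_smul' := by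
        intro c A
        simp [inner_smul_right, tsum_mul_left] }
    (∑' i, ‖S (e i)‖ ^ 2) (by
      intro B
      refine (norm_tsum_le_tsum_norm (tau_summable hS B)).trans ?_
      rw [mul_comm, ← tsum_mul_left]
      refine (tau_summable hS B).tsum_le_tsum (fun i => ?_) (hS.mul_left ‖B‖)
      refine (norm_inner_le_norm _ _).trans ?_
      have := B.le_opNorm (S (e i))
      nlinarith [norm_nonneg (S (e i))])

theorem tau_apply {ι : Type*} {e : HilbertBasis ι ℂ H} {S : H →L[ℂ] H} (hS : HS e S)
    (B : H →L[ℂ] H) : tau e S hS B = ∑' i, ⟪S (e i), B (S (e i))⟫_ℂ := rfl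

/-- `Tr (A L L⋆ B) = τ(B A)` -/
theorem trace_tau_adj {ι : Type*} {e : HilbertBasis ι ℂ H} {L : H →L[ℂ] H} (hL : HS e L)
    (A B : H →L[ℂ] H) :
    HasSum (fun i => ⟪e i, (A * (L * ContinuousLinearMap.adjoint L) * B) (e i)⟫_ℂ)
      (tau e L hL (B * A)) := by
  obtain ⟨t, h1, h2⟩ := hs_cyc (hL.left A) (hL.adj.right B)
  have h3 : tau e L hL (B * A) = t := by
    rw [tau_apply, ← h2.tsum_eq]
    refine tsum_congr fun i => ?_
    rw [← ContinuousLinearMap.adjoint_inner_right]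
    rfl
  rw [h3]
  exact h1

/-- `Tr (A S² B) = τ(B A)` -/
theorem trace_tau {ι : Type*} {e : HilbertBasis ι ℂ H} {S : H →L[ℂ] H} (hS : HS e S)
    (hSa : IsSelfAdjoint S) (A B : H →L[ℂ] H) :
    HasSum (fun i => ⟪e i, (A * (S * S) * B) (e i)⟫_ℂ) (tau e S hS (B * A)) := by
  have := trace_tau_adj hS A B
  rwa [show ContinuousLinearMap.adjoint S = S from hSa.star_eq] at this

theorem pow_diff {R : Type*} [Ring R] (A B Z : R) (m : ℕ) :
    A ^ (m + 1) * Z - Z * B ^ (m + 1) =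
      ∑ k ∈ Finset.range (m + 1), A ^ k * (A * Z - Z * B) * B ^ (m - k) := by
  induction m with
  | zero => simp
  | succ m ih =>
    rw [Finset.sum_range_succ']
    have : ∀ k ∈ Finset.range (m + 1), A ^ (k + 1) * (A * Z - Z * B) * B ^ (m + 1 - (k + 1)) =
        A * (A ^ k * (A * Z - Z * B) * B ^ (m - k)) := by
      intro k _
      rw [Nat.add_sub_add_right, pow_succ' A k]
      noncomm_ring
    rw [Finset.sum_congr rfl this, ← Finset.mul_sum, ← ih]
    simp only [pow_zero, one_mul, Nat.sub_zero]
    rw [pow_succ' A (m + 1), pow_succ' B (m+1)]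
    noncomm_ring

end HHCP

end PartD

section PartV
open MeasureTheory Filter Topology
open scoped InnerProductSpace
namespace HHCP

variable {H : Type*} [NormedAddCommGroup H] [InnerProductSpace ℂ H] [CompleteSpace H]

noncomputable def Qop (Y L : H →L[ℂ] H) (w s : ℂ) : H →L[ℂ] H :=
  Y + s • (L * ContinuousLinearMap.adjoint L) - w • 1

theorem sa_inner_im {Y : H →L[ℂ] H} (hY : IsSelfAdjoint Y) (x : H) : (⟪x, Y x⟫_ℂ).im = 0 := by
  have h : ContinuousLinearMap.adjoint Y = Y := hY.star_eq
  have h1 : (starRingEnd ℂ) ⟪x, Y x⟫_ℂ = ⟪x, Y x⟫_ℂ := by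
    rw [inner_conj_symm]
    conv_lhs => rw [← h]
    rw [ContinuousLinearMap.adjoint_inner_left]
  exact Complex.conj_eq_iff_im.1 h1

theorem LL_inner (L : H →L[ℂ] H) (x : H) :
    ⟪x, (L * ContinuousLinearMap.adjoint L) x⟫_ℂ =
      ((‖ContinuousLinearMap.adjoint L x‖ ^ 2 : ℝ) : ℂ) := by
  rw [ContinuousLinearMap.mul_apply, ← ContinuousLinearMap.adjoint_inner_left,
    inner_self_eq_norm_sq_to_K]
  norm_cast

theorem Q_im {Y : H →L[ℂ] H} (hY : IsSelfAdjoint Y) (L : H →L[ℂ] H) (w s : ℂ) (x : H) :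
    (⟪x, Qop Y L w s x⟫_ℂ).im =
      s.im * ‖ContinuousLinearMap.adjoint L x‖ ^ 2 - w.im * ‖x‖ ^ 2 := by
  have h1 : ⟪x, Qop Y L w s x⟫_ℂ = ⟪x, Y x⟫_ℂ +
      s * ((‖ContinuousLinearMap.adjoint L x‖ ^ 2 : ℝ) : ℂ) - w * ((‖x‖ ^ 2 : ℝ) : ℂ) := by
    simp only [Qop, ContinuousLinearMap.sub_apply, ContinuousLinearMap.add_apply,
      ContinuousLinearMap.smul_apply, inner_sub_right, inner_add_right, inner_smul_right]
    rw [LL_inner, ContinuousLinearMap.one_apply, inner_self_eq_norm_sq_to_K]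
    norm_cast
  rw [h1, Complex.sub_im, Complex.add_im, sa_inner_im hY, Complex.im_mul_ofReal,
    Complex.im_mul_ofReal]
  ring

theorem Q_unit {Y : H →L[ℂ] H} (hY : IsSelfAdjoint Y) (L : H →L[ℂ] H) {w s : ℂ}
    (hw : 0 < w.im) (hs : s.im ≤ 0) : IsUnit (Qop Y L w s) := by
  refine ContinuousLinearMap.isUnit_of_forall_le_norm_inner_map _ (c := ⟨w.im, hw.le⟩) hw
    fun x => ?_
  have h := Q_im hY L w s x
  have h2 := Complex.abs_im_le_norm ⟪x, Qop Y L w s x⟫_ℂ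
  rw [← inner_conj_symm, RCLike.norm_conj]
  refine le_trans ?_ h2
  rw [h]
  refine le_trans ?_ (neg_le_abs _)
  change ‖x‖ ^ 2 * w.im ≤ _
  nlinarith [mul_nonneg (neg_nonneg.2 hs) (sq_nonneg ‖ContinuousLinearMap.adjoint L x‖)]

theorem Q_bound {Y : H →L[ℂ] H} (hY : IsSelfAdjoint Y) (L : H →L[ℂ] H) {w s : ℂ}
    (hw : 0 < w.im) (hs : s.im < 0) (v : H) :
    ‖⟪L v, Ring.inverse (Qop Y L w s) (L v)⟫_ℂ‖ * (-s.im) ≤ ‖v‖ ^ 2 := by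
  obtain ⟨Q, hQ⟩ := Q_unit hY L hw hs.le
  rw [← hQ, Ring.inverse_unit]
  set x := (↑Q⁻¹ : H →L[ℂ] H) (L v) with hx
  have hQx : Qop Y L w s x = L v := by
    rw [hx, ← hQ, ← ContinuousLinearMap.mul_apply, Units.mul_inv, ContinuousLinearMap.one_apply]
  have h := Q_im hY L w s x
  rw [hQx, ← ContinuousLinearMap.adjoint_inner_left] at h
  have h2 := Complex.abs_im_le_norm ⟪ContinuousLinearMap.adjoint L x, v⟫_ℂ
  have h3 := norm_inner_le_norm (𝕜 := ℂ) (ContinuousLinearMap.adjoint L x) v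
  rw [← ContinuousLinearMap.adjoint_inner_right]
  have h4 := norm_inner_le_norm (𝕜 := ℂ) v (ContinuousLinearMap.adjoint L x)
  set q := ‖ContinuousLinearMap.adjoint L x‖
  rw [h] at h2
  have h5 := (neg_le_abs (s.im * q ^ 2 - w.im * ‖x‖ ^ 2)).trans (h2.trans h3)
  have h6 : (-s.im) * q ^ 2 ≤ q * ‖v‖ := by nlinarith [mul_nonneg hw.le (sq_nonneg ‖x‖)]
  have h7 : (-s.im) * q ≤ ‖v‖ := by
    rcases (norm_nonneg _ : 0 ≤ q).eq_or_lt with h0 | h0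
    · have h0' : q = 0 := h0.symm
      rw [h0']; simp
    · refine le_of_mul_le_mul_left ?_ h0
      linarith
  have : ‖⟪v, ContinuousLinearMap.adjoint L x⟫_ℂ‖ * (-s.im) ≤ ‖v‖ * q * (-s.im) :=
    mul_le_mul_of_nonneg_right h4 (by linarith)
  nlinarith [norm_nonneg v]

theorem Q_diff {Y : H →L[ℂ] H} (hY : IsSelfAdjoint Y) (L : H →L[ℂ] H) {w s : ℂ}
    (hw : 0 < w.im) (hs : s.im ≤ 0) (v : H) :
    DifferentiableAt ℂ (fun s => ⟪v, Ring.inverse (Qop Y L w s) v⟫_ℂ) s := by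
  obtain ⟨Q, hQ⟩ := Q_unit hY L hw hs
  have h1 : DifferentiableAt ℂ (Qop Y L w) s := by
    unfold Qop
    fun_prop
  have h2 : DifferentiableAt ℂ (Ring.inverse : (H →L[ℂ] H) → (H →L[ℂ] H)) (Qop Y L w s) := by
    exact differentiableAt_inverse (hQ ▸ Q.isUnit)
  have h3 := h2.comp s h1
  have h4 : DifferentiableAt ℂ (fun A : H →L[ℂ] H => (innerSL ℂ v) (A v))
    (Ring.inverse (Qop Y L w s)) := by fun_prop
  exact DifferentiableAt.comp (g := fun A : H →L[ℂ] H => (innerSL ℂ v) (A v)) s h4 h3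

theorem Q_real {Y : H →L[ℂ] H} (hY : IsSelfAdjoint Y) (L : H →L[ℂ] H) {w : ℂ}
    (hw : 0 < w.im) (s : ℝ) (v : H) :
    (⟪v, Ring.inverse (Qop Y L w s) v⟫_ℂ).im = w.im * ‖Ring.inverse (Qop Y L w s) v‖ ^ 2 := by
  obtain ⟨Q, hQ⟩ := Q_unit hY L hw (s := s) (by simp)
  rw [← hQ, Ring.inverse_unit]
  set x := (↑Q⁻¹ : H →L[ℂ] H) v with hx
  have hQx : Qop Y L w s x = v := by
    rw [hx, ← hQ, ← ContinuousLinearMap.mul_apply, Units.mul_inv, ContinuousLinearMap.one_apply]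
  have h := Q_im hY L w s x
  rw [hQx, ← inner_conj_symm, Complex.conj_im] at h
  simp at h
  linarith

theorem contour {Y : H →L[ℂ] H} (hY : IsSelfAdjoint Y) (L : H →L[ℂ] H) {w : ℂ}
    (hw : 0 < w.im) (v : H) :
    ∫ s in (0:ℝ)..1, w.im * ‖Ring.inverse (Qop Y L w s) (L v)‖ ^ 2 ≤ 28 * ‖v‖ ^ 2 := by
  set h : ℂ → ℂ := fun s => ⟪L v, Ring.inverse (Qop Y L w s) (L v)⟫_ℂ with hh
  set f : ℂ → ℂ := fun s => (s + 1) * (2 - s) * h s with hf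
  have hd : ∀ s : ℂ, s.im ≤ 0 → DifferentiableAt ℂ f s := fun s hs =>
    (by fun_prop : DifferentiableAt ℂ (fun s : ℂ => (s + 1) * (2 - s)) s).mul (Q_diff hY L hw hs _)
  have hcont : Continuous fun s : ℝ => h s := by
    refine continuous_iff_continuousAt.2 fun s => ?_
    exact (Q_diff hY L hw (s := s) (by simp) (L v)).continuousAt.comp
      Complex.continuous_ofReal.continuousAt
  have hC := Complex.integral_boundary_rect_eq_zero_of_differentiableOn f (⟨-1, -1⟩ : ℂ) (⟨2, 0⟩ : ℂ)
    (by
      intro s hs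
      refine (hd s ?_).differentiableWithinAt
      have := hs.2
      simp only [Set.mem_preimage] at this
      rw [Set.uIcc_of_le (by norm_num)] at this
      exact this.2)
  simp only at hC
  have hb : ∀ s : ℂ, s.im < 0 → ‖h s‖ * (-s.im) ≤ ‖v‖ ^ 2 := fun s hs => Q_bound hY L hw hs v
  have e1 : ‖∫ x in (-1:ℝ)..2, f (x + ((-1 : ℝ) : ℂ) * Complex.I)‖ ≤ 16 * ‖v‖ ^ 2 * |2 - (-1:ℝ)| := by
    refine intervalIntegral.norm_integral_le_of_norm_le_const fun x hx => ?_
    rw [Set.uIoc_of_le (by norm_num)] at hx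
    have h1 := hb (x + ((-1 : ℝ) : ℂ) * Complex.I) (by simp)
    simp only [Complex.add_im, Complex.ofReal_im, Complex.mul_im, Complex.ofReal_re,
      Complex.I_im, Complex.I_re] at h1
    simp only [hf, norm_mul]
    have h2 : ‖(x : ℂ) + ((-1 : ℝ) : ℂ) * Complex.I + 1‖ ≤ 4 := by
      refine (Complex.norm_le_abs_re_add_abs_im _).trans ?_
      simp
      rw [abs_of_nonneg (by linarith [hx.1])]; linarith [hx.2]
    have h3 : ‖2 - ((x : ℂ) + ((-1 : ℝ) : ℂ) * Complex.I)‖ ≤ 4 := by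
      refine (Complex.norm_le_abs_re_add_abs_im _).trans ?_
      simp
      rw [abs_of_nonneg (by linarith [hx.2])]; linarith [hx.1]
    have h4 := mul_le_mul h2 h3 (norm_nonneg _) (by norm_num)
    refine mul_le_mul (h4.trans (by norm_num)) (by linarith) (norm_nonneg _) (by norm_num)
  have side : ∀ y ∈ Set.uIoc (-1:ℝ) 0, ∀ q : ℂ, (‖q‖ ≤ 4 * (-y)) → ∀ s : ℂ, s.im = y →
      ‖q * h s‖ ≤ 4 * ‖v‖ ^ 2 := by
    intro y hy q hq s hs
    rw [Set.uIoc_of_le (by norm_num)] at hy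
    rw [norm_mul]
    rcases hy.2.eq_or_lt with h0 | h0
    · rw [h0] at hq
      have : ‖q‖ = 0 := le_antisymm (by simpa using hq) (norm_nonneg _)
      rw [this]; simp
    · have h1 := hb s (by rw [hs]; exact h0)
      rw [hs] at h1
      have := mul_le_mul_of_nonneg_right hq (norm_nonneg (h s))
      nlinarith
  have e2 : ‖∫ y in (-1:ℝ)..0, f (((2 : ℝ) : ℂ) + y * Complex.I)‖ ≤ 4 * ‖v‖ ^ 2 * |0 - (-1:ℝ)| := by
    refine intervalIntegral.norm_integral_le_of_norm_le_const fun y hy => ?_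
    refine side y hy _ ?_ _ (by simp)
    rw [Set.uIoc_of_le (by norm_num)] at hy
    have h1 : (2 - (((2 : ℝ) : ℂ) + y * Complex.I)) = -(y * Complex.I) := by push_cast; ring
    rw [norm_mul, h1, norm_neg, norm_mul, Complex.norm_I, Complex.norm_real, mul_one,
      Real.norm_eq_abs, abs_of_nonpos hy.2]
    refine mul_le_mul_of_nonneg_right ?_ (by linarith [hy.2])
    refine (Complex.norm_le_abs_re_add_abs_im _).trans ?_
    simp
    rw [abs_of_nonpos hy.2, abs_of_nonneg (by norm_num)]; linarith [hy.1]
  have e3 : ‖∫ y in (-1:ℝ)..0, f (((-1 : ℝ) : ℂ) + y * Complex.I)‖ ≤ 4 * ‖v‖ ^ 2 * |0 - (-1:ℝ)| := by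
    refine intervalIntegral.norm_integral_le_of_norm_le_const fun y hy => ?_
    refine side y hy _ ?_ _ (by simp)
    rw [Set.uIoc_of_le (by norm_num)] at hy
    have h1 : ((((-1 : ℝ) : ℂ) + y * Complex.I) + 1) = (y * Complex.I) := by push_cast; ring
    rw [norm_mul, h1, norm_mul, Complex.norm_I, Complex.norm_real, mul_one,
      Real.norm_eq_abs, abs_of_nonpos hy.2, mul_comm]
    refine mul_le_mul_of_nonneg_right ?_ (by linarith [hy.2])
    refine (Complex.norm_le_abs_re_add_abs_im _).trans ?_
    simp
    rw [abs_of_nonpos hy.2, abs_of_nonneg (by norm_num)]; linarith [hy.1]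
  have e4 : ‖∫ x in (-1:ℝ)..2, f (x : ℂ)‖ ≤ 56 * ‖v‖ ^ 2 := by
    have h1 : (∫ x in (-1:ℝ)..2, f (x : ℂ)) = (∫ x in (-1:ℝ)..2, f (x + ((-1 : ℝ) : ℂ) * Complex.I)) +
      (Complex.I • (∫ y in (-1:ℝ)..0, f (((2 : ℝ) : ℂ) + y * Complex.I)) -
      Complex.I • (∫ y in (-1:ℝ)..0, f (((-1 : ℝ) : ℂ) + y * Complex.I))) := by
      have h2 : ∀ x : ℝ, (x : ℂ) + ((0 : ℝ) : ℂ) * Complex.I = x := by intro x; simp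
      simp only [h2] at hC
      linear_combination -hC
    rw [h1]
    refine (norm_add_le _ _).trans ?_
    have h3 := norm_sub_le (Complex.I • (∫ y in (-1:ℝ)..0, f (((2 : ℝ) : ℂ) + y * Complex.I)))
      (Complex.I • (∫ y in (-1:ℝ)..0, f (((-1 : ℝ) : ℂ) + y * Complex.I)))
    rw [norm_smul, norm_smul, Complex.norm_I, one_mul, one_mul] at h3
    norm_num [abs_of_nonneg] at e1 e2 e3 h3 ⊢
    linarith
  have hfc : Continuous fun s : ℝ => f s := by
    simp only [hf]
    exact (by fun_prop : Continuous fun s : ℝ => ((s:ℂ) + 1) * (2 - s)).mul hcont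
  have hg : ∀ s : ℝ, (f s).im = (s + 1) * (2 - s) * (w.im * ‖Ring.inverse (Qop Y L w s) (L v)‖ ^ 2) := by
    intro s
    simp only [hf]
    rw [show ((s:ℂ) + 1) * (2 - s) = (((s + 1) * (2 - s) : ℝ) : ℂ) by push_cast; ring,
      Complex.im_ofReal_mul, hh, Q_real hY L hw]
  have hnn : ∀ s : ℝ, 0 ≤ w.im * ‖Ring.inverse (Qop Y L w s) (L v)‖ ^ 2 := fun s => by positivity
  have hgc : Continuous fun s : ℝ => w.im * ‖Ring.inverse (Qop Y L w s) (L v)‖ ^ 2 := by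
    have : (fun s : ℝ => w.im * ‖Ring.inverse (Qop Y L w s) (L v)‖ ^ 2) = fun s : ℝ => (h s).im := by
      funext s; rw [hh, Q_real hY L hw]
    rw [this]
    exact Complex.continuous_im.comp hcont
  have hfi : Continuous fun s : ℝ => (f s).im := Complex.continuous_im.comp hfc
  have e5 : (∫ x in (-1:ℝ)..2, (f (x : ℂ)).im) ≤ 56 * ‖v‖ ^ 2 := by
    have : (∫ x in (-1:ℝ)..2, (f (x : ℂ)).im) = (∫ x in (-1:ℝ)..2, f (x : ℂ)).im := by
      have := Complex.imCLM.intervalIntegral_comp_comm (hfc.intervalIntegrable (μ := volume) (-1) 2)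
      simpa using this
    rw [this]
    exact ((le_abs_self _).trans (Complex.abs_im_le_norm _)).trans e4
  have e6 : (∫ x in (0:ℝ)..1, (f (x : ℂ)).im) ≤ ∫ x in (-1:ℝ)..2, (f (x : ℂ)).im := by
    refine intervalIntegral.integral_mono_interval (by norm_num) (by norm_num) (by norm_num) ?_
      (hfi.intervalIntegrable _ _)
    refine (ae_restrict_iff' measurableSet_Ioc).2 (Eventually.of_forall fun s hs => ?_)
    simp only [Pi.zero_apply]
    rw [hg]
    exact mul_nonneg (mul_nonneg (by linarith [hs.1]) (by linarith [hs.2])) (hnn s)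
  have e7 : (∫ s in (0:ℝ)..1, 2 * (w.im * ‖Ring.inverse (Qop Y L w s) (L v)‖ ^ 2)) ≤
      ∫ x in (0:ℝ)..1, (f (x : ℂ)).im := by
    refine intervalIntegral.integral_mono_on (by norm_num) ((hgc.const_mul 2).intervalIntegrable _ _)
      (hfi.intervalIntegrable _ _) fun s hs => ?_
    rw [hg]
    refine mul_le_mul_of_nonneg_right ?_ (hnn s)
    nlinarith [hs.1, hs.2]
  rw [intervalIntegral.integral_const_mul] at e7
  linarith

end HHCP

end PartV

section PartW
open MeasureTheory Filter Topology
open scoped InnerProductSpace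
namespace HHCP

variable {H : Type*} [NormedAddCommGroup H] [InnerProductSpace ℂ H] [CompleteSpace H]

/-- bounded linear functionals on continuous functions on `[a,b]` -/
structure CF (a b : ℝ) (Φ : (ℝ → ℝ) → ℂ) : Prop where
  add : ∀ f g : ℝ → ℝ, Continuous f → Continuous g → Φ (fun t => f t + g t) = Φ f + Φ g
  smul : ∀ (c : ℝ) (f : ℝ → ℝ), Continuous f → Φ (fun t => c * f t) = c * Φ f
  bound : ∃ C : ℝ, 0 ≤ C ∧ ∀ (f : ℝ → ℝ) (ε : ℝ), Continuous f → 0 ≤ ε →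
    (∀ t ∈ Set.Icc a b, |f t| ≤ ε) → ‖Φ f‖ ≤ C * ε

theorem CF.poly {a b : ℝ} {Φ Ψ : (ℝ → ℝ) → ℂ} (h1 : CF a b Φ) (h2 : CF a b Ψ)
    (h : ∀ n : ℕ, Φ (fun t => t ^ n) = Ψ (fun t => t ^ n)) (p : Polynomial ℝ) :
    Φ (fun t => p.eval t) = Ψ (fun t => p.eval t) := by
  induction p using Polynomial.induction_on' with
  | add p q hp hq =>
    simp only [Polynomial.eval_add]
    rw [h1.add _ _ p.continuous q.continuous, h2.add _ _ p.continuous q.continuous, hp, hq]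
  | monomial n c =>
    simp only [Polynomial.eval_monomial]
    rw [h1.smul _ _ (continuous_pow n), h2.smul _ _ (continuous_pow n), h]

theorem CF.sub {a b : ℝ} {Φ : (ℝ → ℝ) → ℂ} (h1 : CF a b Φ) (f g : ℝ → ℝ) (hf : Continuous f)
    (hg : Continuous g) : Φ (fun t => f t - g t) = Φ f - Φ g := by
  have h3 := h1.add f (fun t => (-1 : ℝ) * g t) hf (hg.const_mul _)
  rw [h1.smul _ _ hg] at h3
  have : (fun t => f t + -1 * g t) = fun t => f t - g t := by funext t; ring
  rw [this] at h3
  rw [h3]; push_cast; ring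

theorem CF.eq {a b : ℝ} {Φ Ψ : (ℝ → ℝ) → ℂ} (h1 : CF a b Φ) (h2 : CF a b Ψ)
    (h : ∀ n : ℕ, Φ (fun t => t ^ n) = Ψ (fun t => t ^ n)) (f : ℝ → ℝ) (hf : Continuous f) :
    Φ f = Ψ f := by
  obtain ⟨C1, hC1, hb1⟩ := h1.bound
  obtain ⟨C2, hC2, hb2⟩ := h2.bound
  have key : ∀ ε : ℝ, 0 < ε → ‖Φ f - Ψ f‖ ≤ (C1 + C2) * ε := by
    intro ε hε
    obtain ⟨p, hp⟩ := exists_polynomial_near_of_continuousOn a b f hf.continuousOn ε hε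
    have e1 := hb1 (fun t => p.eval t - f t) ε (p.continuous.sub hf) hε.le fun t ht => (hp t ht).le
    have e2 := hb2 (fun t => p.eval t - f t) ε (p.continuous.sub hf) hε.le fun t ht => (hp t ht).le
    rw [h1.sub _ _ p.continuous hf] at e1
    rw [h2.sub _ _ p.continuous hf, ← CF.poly h1 h2 h p] at e2
    have : Φ f - Ψ f = (Φ (fun t => p.eval t) - Ψ f) - (Φ (fun t => p.eval t) - Φ f) := by ring
    rw [this]
    refine (norm_sub_le _ _).trans ?_
    linarith
  have : ‖Φ f - Ψ f‖ ≤ 0 := by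
    refine le_of_forall_pos_le_add fun δ hδ => ?_
    refine (key (δ / (C1 + C2 + 1)) (by positivity)).trans ?_
    rw [zero_add, mul_div_assoc', div_le_iff₀ (by positivity)]
    nlinarith
  exact sub_eq_zero.1 (norm_le_zero_iff.1 this)

theorem CF.op {a b : ℝ} (Λ : (H →L[ℂ] H) →L[ℂ] ℂ) {A : H →L[ℂ] H} (hA : IsSelfAdjoint A)
    (hs : spectrum ℝ A ⊆ Set.Icc a b) : CF a b (fun f => Λ (cfc f A)) where
  add f g hf hg := by
    rw [cfc_add (a := A) (f := f) (g := g) hf.continuousOn hg.continuousOn, map_add]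
  smul c f hf := by
    rw [cfc_const_mul c f A hf.continuousOn]
    rw [show c • cfc f A = (c : ℂ) • cfc f A from rfl, map_smul, smul_eq_mul]
  bound := by
    refine ⟨‖Λ‖, norm_nonneg _, fun f ε hf hε h => (Λ.le_opNorm _).trans ?_⟩
    refine mul_le_mul_of_nonneg_left ?_ (norm_nonneg _)
    exact norm_cfc_le hε fun t ht => h t (hs ht)

theorem CF.meas {a b : ℝ} {Q : Type*} [MeasurableSpace Q] (M : Measure Q) (p : Q → ℝ)
    (hp : Measurable p) (hpM : ∀ᵐ q ∂M, p q ∈ Set.Icc a b) (g : Q → ℝ) (hg : Integrable g M) :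
    CF a b (fun f => ((∫ q, f (p q) * g q ∂M : ℝ) : ℂ)) := by
  have hi : ∀ f : ℝ → ℝ, Continuous f → Integrable (fun q => f (p q) * g q) M := by
    intro f hf
    obtain ⟨C, hC⟩ := (isCompact_Icc (a := a) (b := b)).exists_bound_of_continuousOn hf.continuousOn
    refine hg.bdd_mul (c := C) (hf.measurable.comp hp).aestronglyMeasurable ?_
    filter_upwards [hpM] with q hq using hC _ hq
  refine ⟨fun f g hf hg => ?_, fun c f hf => ?_, ?_⟩
  · rw [← Complex.ofReal_add, ← integral_add (hi f hf) (hi g hg)]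
    simp only [add_mul]
  · rw [← Complex.ofReal_mul, ← integral_const_mul]
    simp only [mul_assoc]
  · refine ⟨∫ q, |g q| ∂M, by positivity, fun f ε hf hε h => ?_⟩
    rw [Complex.norm_real]
    refine (norm_integral_le_integral_norm _).trans ?_
    rw [mul_comm, ← integral_const_mul]
    refine integral_mono_ae (hi f hf).norm (hg.abs.const_mul _) ?_
    filter_upwards [hpM] with q hq
    rw [norm_mul, Real.norm_eq_abs, Real.norm_eq_abs]
    exact mul_le_mul_of_nonneg_right (h _ hq) (abs_nonneg _)

theorem spec_norm {A : H →L[ℂ] H} {ρ : ℝ} (h : ‖A‖ ≤ ρ) :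
    spectrum ℝ A ⊆ Set.Icc (-ρ) ρ := by
  intro t ht
  by_cases hn : Nontrivial H
  · have := spectrum.norm_le_norm_of_mem ht
    rw [Real.norm_eq_abs] at this
    exact abs_le.1 (this.trans h)
  · rw [not_nontrivial_iff_subsingleton] at hn
    have : Subsingleton (H →L[ℂ] H) := inferInstance
    simp [spectrum.of_subsingleton] at ht

theorem CF.int {ρ : ℝ} (Λ : (H →L[ℂ] H) →L[ℂ] ℂ) (A : ℝ → (H →L[ℂ] H)) (hc : Continuous A)
    (hA : ∀ s, IsSelfAdjoint (A s)) (hn : ∀ s ∈ Set.Icc (0:ℝ) 1, ‖A s‖ ≤ ρ) :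
    CF (-ρ) ρ (fun f => ∫ s in (0:ℝ)..1, Λ (cfc f (A s))) := by
  have hsp : ∀ s ∈ Set.Icc (0:ℝ) 1, spectrum ℝ (A s) ⊆ Set.Icc (-ρ) ρ :=
    fun s hs => spec_norm (hn s hs)
  have hi : ∀ f : ℝ → ℝ, Continuous f →
      IntervalIntegrable (fun s => Λ (cfc f (A s))) volume 0 1 := by
    intro f hf
    refine ContinuousOn.intervalIntegrable ?_
    rw [Set.uIcc_of_le (by norm_num)]
    exact Λ.continuous.comp_continuousOn
      (ContinuousOn.cfc' (isCompact_Icc (a := -ρ) (b := ρ)) f hc.continuousOn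
        (fun s hs => hsp s hs) (fun s _ => hA s) hf.continuousOn)
  refine ⟨fun f g hf hg => ?_, fun c f hf => ?_, ?_⟩
  · rw [← intervalIntegral.integral_add (hi f hf) (hi g hg)]
    refine intervalIntegral.integral_congr fun s hs => ?_
    rw [Set.uIcc_of_le (by norm_num)] at hs
    exact (CF.op Λ (hA s) (hsp s hs)).add f g hf hg
  · rw [← intervalIntegral.integral_const_mul]
    refine intervalIntegral.integral_congr fun s hs => ?_
    rw [Set.uIcc_of_le (by norm_num)] at hs
    exact (CF.op Λ (hA s) (hsp s hs)).smul c f hf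
  · refine ⟨‖Λ‖, norm_nonneg _, fun f ε hf hε h => ?_⟩
    have := intervalIntegral.norm_integral_le_of_norm_le_const (a := (0:ℝ)) (b := 1)
      (f := fun s => Λ (cfc f (A s))) (C := ‖Λ‖ * ε) ?_
    · simpa using this
    · intro s hs
      rw [Set.uIoc_of_le (by norm_num)] at hs
      refine (Λ.le_opNorm _).trans (mul_le_mul_of_nonneg_left ?_ (norm_nonneg _))
      exact norm_cfc_le hε fun t ht => h t (hsp s ⟨hs.1.le, hs.2⟩ ht)

/-- the quadratic `1/((t-x)²+y²)` applied to an operator -/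
noncomputable def Rq (x y : ℝ) (A : H →L[ℂ] H) : H →L[ℂ] H :=
  cfc (fun t : ℝ => 1 / ((t - x) ^ 2 + y ^ 2)) A

theorem q_cont (x : ℝ) {y : ℝ} (hy : 0 < y) : Continuous (fun t : ℝ => 1 / ((t - x) ^ 2 + y ^ 2)) := by
  refine Continuous.div continuous_const (by fun_prop) fun t => ?_
  positivity

theorem Rq_sa (x y : ℝ) (A : H →L[ℂ] H) : IsSelfAdjoint (Rq x y A) := cfc_predicate _ _

theorem Rq_comm (x y : ℝ) {A : H →L[ℂ] H} (hA : IsSelfAdjoint A) (z : ℂ) :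
    Commute (Rq x y A) (A - z • 1) := by
  have h : Commute (Rq x y A) A := by
    have := cfc_commute_cfc (fun t : ℝ => 1 / ((t - x) ^ 2 + y ^ 2)) (fun t : ℝ => t) A
    rwa [cfc_id' ℝ A] at this
  have h2 : Commute (Rq x y A) (z • (1 : H →L[ℂ] H)) := (Commute.one_right _).smul_right z
  exact h.sub_right h2

theorem Rq_mul (x : ℝ) {y : ℝ} (hy : 0 < y) {A : H →L[ℂ] H} (hA : IsSelfAdjoint A) :
    Rq x y A * ((A - ((x : ℂ) + y * Complex.I) • 1) * (A - ((x : ℂ) - y * Complex.I) • 1)) = 1 := by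
  have h1 : (A - ((x : ℂ) + y * Complex.I) • (1 : H →L[ℂ] H)) *
      (A - ((x : ℂ) - y * Complex.I) • 1) = cfc (fun t : ℝ => (t - x) ^ 2 + y ^ 2) A := by
    rw [cfc_add (a := A) (fun t : ℝ => (t - x) ^ 2) (fun _ => y ^ 2) (by fun_prop) (by fun_prop),
      cfc_pow (a := A) (fun t : ℝ => t - x) 2 (by fun_prop),
      cfc_sub (a := A) (fun t : ℝ => t) (fun _ => x) (by fun_prop) (by fun_prop), cfc_id' ℝ A,
      cfc_const x A, cfc_const (y ^ 2) A]
    rw [show algebraMap ℝ (H →L[ℂ] H) x = (x : ℂ) • 1 from rfl,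
      show algebraMap ℝ (H →L[ℂ] H) (y ^ 2) = ((y ^ 2 : ℝ) : ℂ) • 1 from rfl]
    simp only [sub_mul, mul_sub, smul_mul_assoc, mul_smul_comm, mul_one, one_mul, pow_two, smul_sub,
      smul_smul]
    have : ((y * y : ℝ) : ℂ) = -((y * Complex.I) * (y * Complex.I)) := by
      push_cast
      linear_combination (y:ℂ) * y * (Complex.I_mul_I : Complex.I * Complex.I = -1)
    rw [this]
    module
  rw [h1, Rq, ← cfc_mul _ _ A (q_cont x hy).continuousOn (by fun_prop)]
  have : (fun t : ℝ => 1 / ((t - x) ^ 2 + y ^ 2) * ((t - x) ^ 2 + y ^ 2)) = fun _ => 1 := by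
    funext t
    have : (t - x) ^ 2 + y ^ 2 ≠ 0 := by positivity
    field_simp
  rw [this, cfc_const_one ℝ A]

end HHCP

end PartW

section PartW2
open MeasureTheory Filter Topology
open scoped InnerProductSpace
namespace HHCP

variable {H : Type*} [NormedAddCommGroup H] [InnerProductSpace ℂ H] [CompleteSpace H]

noncomputable def Wm {ι : Type*} (e : HilbertBasis ι ℂ H) (S : H →L[ℂ] H) (hS : HS e S)
    (Y : H →L[ℂ] H) (m : ℕ) : (H →L[ℂ] H) →L[ℂ] ℂ :=
  ∑ j ∈ Finset.range (m + 1), (tau e S hS) ∘L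
    (ContinuousLinearMap.mulLeftRight ℂ (H →L[ℂ] H) (Y ^ (m - j)) (Y ^ j))

theorem Wm_apply {ι : Type*} {e : HilbertBasis ι ℂ H} {S : H →L[ℂ] H} (hS : HS e S)
    (Y : H →L[ℂ] H) (m : ℕ) (A : H →L[ℂ] H) :
    Wm e S hS Y m A = ∑ j ∈ Finset.range (m + 1), tau e S hS (Y ^ (m - j) * A * Y ^ j) := by
  simp [Wm, ContinuousLinearMap.sum_apply]

theorem comm_pow {X Y C : H →L[ℂ] H} (h : Y * X - X * Y = Complex.I • C) (m : ℕ) :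
    Y ^ (m + 1) * X - X * Y ^ (m + 1) =
      Complex.I • ∑ j ∈ Finset.range (m + 1), Y ^ j * C * Y ^ (m - j) := by
  rw [pow_diff, h, Finset.smul_sum]
  simp

theorem hasSum_op {ι κ : Type*} {e : HilbertBasis ι ℂ H} (s : Finset κ) (A : κ → (H →L[ℂ] H))
    (t : κ → ℂ) (h : ∀ k ∈ s, HasSum (fun i => ⟪e i, A k (e i)⟫_ℂ) (t k)) :
    HasSum (fun i => ⟪e i, (∑ k ∈ s, A k) (e i)⟫_ℂ) (∑ k ∈ s, t k) := by
  simp only [ContinuousLinearMap.sum_apply, inner_sum]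
  exact hasSum_sum h

theorem hasSum_op_smul {ι : Type*} {e : HilbertBasis ι ℂ H} (A : H →L[ℂ] H) (c t : ℂ)
    (h : HasSum (fun i => ⟪e i, A (e i)⟫_ℂ) t) :
    HasSum (fun i => ⟪e i, (c • A) (e i)⟫_ℂ) (c * t) := by
  simp only [ContinuousLinearMap.smul_apply, inner_smul_right]
  exact h.mul_left c

theorem trace_XY {ι : Type*} {e : HilbertBasis ι ℂ H} {X Y S : H →L[ℂ] H} (hS : HS e S)
    (hSa : IsSelfAdjoint S) (h : Y * X - X * Y = Complex.I • (S * S)) (m n : ℕ) :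
    HasSum (fun i => ⟪e i, ((-Complex.I) •
      (Y ^ (m + 1) * X ^ (n + 1) - X ^ (n + 1) * Y ^ (m + 1))) (e i)⟫_ℂ)
      ((n + 1) * Wm e S hS Y m (X ^ n)) := by
  have e1 : ((-Complex.I) • (Y ^ (m + 1) * X ^ (n + 1) - X ^ (n + 1) * Y ^ (m + 1))) =
      ∑ k ∈ Finset.range (n + 1), ∑ j ∈ Finset.range (m + 1),
        (X ^ k * Y ^ j) * (S * S) * (Y ^ (m - j) * X ^ (n - k)) := by
    have e2 := pow_diff X X (Y ^ (m + 1)) n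
    have e3 : X * Y ^ (m + 1) - Y ^ (m + 1) * X =
        -(Complex.I • ∑ j ∈ Finset.range (m + 1), Y ^ j * (S * S) * Y ^ (m - j)) := by
      rw [← comm_pow h, neg_sub]
    rw [← neg_sub (X ^ (n + 1) * Y ^ (m + 1)), e2, e3, smul_neg, neg_smul, neg_neg,
      Finset.smul_sum]
    refine Finset.sum_congr rfl fun k _ => ?_
    rw [mul_neg, neg_mul, mul_smul_comm, smul_mul_assoc, smul_neg, smul_smul, Complex.I_mul_I,
      neg_one_smul, neg_neg, Finset.mul_sum, Finset.sum_mul]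
    refine Finset.sum_congr rfl fun j _ => ?_
    simp only [mul_assoc]
  have e2 : (((n : ℂ) + 1) * Wm e S hS Y m (X ^ n)) =
      ∑ k ∈ Finset.range (n + 1), ∑ j ∈ Finset.range (m + 1),
        tau e S hS ((Y ^ (m - j) * X ^ (n - k)) * (X ^ k * Y ^ j)) := by
    rw [Wm_apply]
    have : ∀ k ∈ Finset.range (n + 1), ∑ j ∈ Finset.range (m + 1),
        tau e S hS ((Y ^ (m - j) * X ^ (n - k)) * (X ^ k * Y ^ j)) =
        ∑ j ∈ Finset.range (m + 1), tau e S hS (Y ^ (m - j) * X ^ n * Y ^ j) := by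
      intro k hk
      refine Finset.sum_congr rfl fun j _ => ?_
      have hkn : n - k + k = n := Nat.sub_add_cancel (Nat.lt_succ_iff.1 (Finset.mem_range.1 hk))
      congr 1
      calc _ = Y ^ (m - j) * (X ^ (n - k) * X ^ k) * Y ^ j := by simp only [mul_assoc]
        _ = _ := by rw [← pow_add, hkn]
    rw [Finset.sum_congr rfl this, Finset.sum_const, Finset.card_range, nsmul_eq_mul]
    push_cast
    rfl
  rw [e1, e2]
  exact hasSum_op _ _ _ fun k _ => hasSum_op _ _ _ fun j _ => trace_tau hS hSa _ _

noncomputable def Ys (Y L : H →L[ℂ] H) (s : ℝ) : H →L[ℂ] H :=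
  Y + (s : ℂ) • (L * ContinuousLinearMap.adjoint L)

theorem Ys_cont (Y L : H →L[ℂ] H) : Continuous (Ys Y L) := by
  unfold Ys; fun_prop

theorem Ys_sa {Y : H →L[ℂ] H} (hY : IsSelfAdjoint Y) (L : H →L[ℂ] H) (s : ℝ) :
    IsSelfAdjoint (Ys Y L s) := by
  refine hY.add ?_
  have h1 : IsSelfAdjoint (L * ContinuousLinearMap.adjoint L) := IsSelfAdjoint.mul_star_self L
  have h2 : IsSelfAdjoint (s : ℂ) := Complex.conj_ofReal s
  exact h2.smul h1

theorem Ys_trace {ι : Type*} {e : HilbertBasis ι ℂ H} {Y L : H →L[ℂ] H} (hL : HS e L)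
    (m : ℕ) (s s' : ℝ) :
    HasSum (fun i => ⟪e i, (Ys Y L s' ^ (m + 1) - Ys Y L s ^ (m + 1)) (e i)⟫_ℂ)
      (((s' - s : ℝ) : ℂ) * ∑ k ∈ Finset.range (m + 1),
        tau e L hL (Ys Y L s ^ (m - k) * Ys Y L s' ^ k)) := by
  have h := pow_diff (Ys Y L s') (Ys Y L s) 1 m
  rw [mul_one, one_mul, mul_one, one_mul] at h
  have h1 : Ys Y L s' - Ys Y L s = ((s' - s : ℝ) : ℂ) • (L * ContinuousLinearMap.adjoint L) := by
    unfold Ys; push_cast; module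
  rw [h1] at h
  have h2 : Ys Y L s' ^ (m + 1) - Ys Y L s ^ (m + 1) = ((s' - s : ℝ) : ℂ) •
      ∑ k ∈ Finset.range (m + 1), Ys Y L s' ^ k * (L * ContinuousLinearMap.adjoint L) *
        Ys Y L s ^ (m - k) := by
    rw [h, Finset.smul_sum]
    simp
  rw [h2]
  exact hasSum_op_smul _ _ _ (hasSum_op _ _ _ fun k _ => trace_tau_adj hL _ _)

theorem Ys_int {ι : Type*} {e : HilbertBasis ι ℂ H} {Y L : H →L[ℂ] H} (hL : HS e L)
    (m : ℕ) :
    HasSum (fun i => ⟪e i, (Ys Y L 1 ^ (m + 1) - Y ^ (m + 1)) (e i)⟫_ℂ)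
      (((m : ℂ) + 1) * ∫ s in (0:ℝ)..1, tau e L hL (Ys Y L s ^ m)) := by
  have h0 : Ys Y L 0 = Y := by simp [Ys]
  set G : ℝ → ℝ → ℂ := fun s' s => ∑ k ∈ Finset.range (m + 1),
        tau e L hL (Ys Y L s ^ (m - k) * Ys Y L s' ^ k) with hG
  set θ : ℝ → ℂ := fun s => ((s - 0 : ℝ) : ℂ) * G s 0 with hθ
  have hθ1 := Ys_trace hL (Y := Y) m 0 1
  rw [h0] at hθ1
  have hd : ∀ s s', θ s' - θ s = ((s' - s : ℝ) : ℂ) * G s' s := by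
    intro s s'
    have h1 := (Ys_trace hL (Y := Y) m 0 s').sub (Ys_trace hL (Y := Y) m 0 s)
    have h2 := Ys_trace hL (Y := Y) m s s'
    refine HasSum.unique h1 (h2.congr_fun ?_ |> fun h => h)
    intro i
    simp [inner_sub_right]
  have hGc : ∀ s, Continuous fun s' => G s' s := by
    intro s
    have := Ys_cont Y L
    simp only [hG]
    fun_prop
  have hGd : ∀ s, G s s = (m + 1) * tau e L hL (Ys Y L s ^ m) := by
    intro s
    have : ∀ k ∈ Finset.range (m + 1), tau e L hL (Ys Y L s ^ (m - k) * Ys Y L s ^ k) =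
        tau e L hL (Ys Y L s ^ m) := by
      intro k hk
      rw [← pow_add, Nat.sub_add_cancel (Nat.lt_succ_iff.1 (Finset.mem_range.1 hk))]
    simp only [hG]
    rw [Finset.sum_congr rfl this, Finset.sum_const, Finset.card_range, nsmul_eq_mul]
    push_cast; rfl
  have hder : ∀ s, HasDerivAt θ ((m + 1) * tau e L hL (Ys Y L s ^ m)) s := by
    intro s
    rw [← hGd, hasDerivAt_iff_tendsto_slope]
    have h1 : Tendsto (fun s' => G s' s) (𝓝[≠] s) (𝓝 (G s s)) :=
      ((hGc s).tendsto s).mono_left nhdsWithin_le_nhds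
    refine h1.congr' ?_
    filter_upwards [self_mem_nhdsWithin] with s' hs'
    rw [slope_def_module, hd]
    have : s' - s ≠ 0 := sub_ne_zero.2 hs'
    rw [Complex.real_smul, ← mul_assoc, ← Complex.ofReal_mul, inv_mul_cancel₀ this]
    simp
  have hftc := intervalIntegral.integral_eq_sub_of_hasDerivAt (a := (0:ℝ)) (b := 1)
    (fun s _ => hder s) (by
      refine Continuous.intervalIntegrable ?_ _ _
      have := Ys_cont Y L
      fun_prop)
  rw [intervalIntegral.integral_const_mul] at hftc
  rw [hftc]
  have : θ 1 - θ 0 = θ 1 := by simp [hθ]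
  rw [this]
  simp only [hθ, hG, h0]
  exact hθ1

theorem U_alg {R : Type*} [Ring R] {B B' Bi Bi' c Z : R} (h1 : B * Bi = 1) 
    (h2 : B' * Bi' = 1) (h2' : Bi' * B' = 1) (hc : B = B' + c) (hcc : ∀ r : R, c * r = r * c) :
    B * Bi' * Z * (B' * Bi) = Z + c * (Bi' * (Z * B' - B' * Z) * Bi) := by
  have e1 : B * Bi' = 1 + c * Bi' := by rw [hc, add_mul, h2]
  have e2 : B' * Bi = 1 - c * Bi := by
    have : B' = B - c := by rw [hc]; noncomm_ring
    rw [this, sub_mul, h1]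
  have e3 : c * (Bi' * (Z * B' - B' * Z) * Bi) = c * (Bi' * Z * (B' * Bi)) - c * ((Bi' * B') * Z * Bi) := by
    noncomm_ring
  rw [e3, h2', e1, one_mul, hcc (Z * Bi), add_mul, one_mul, add_mul, ← hcc (Z * Bi)]
  have e4 : Z * (B' * Bi) = Z - c * (Z * Bi) := by
    rw [e2, mul_sub, mul_one, hcc (Z * Bi), hcc Bi]; noncomm_ring
  rw [e4]
  noncomm_ring

end HHCP

end PartW2

section PartW3
open MeasureTheory Filter Topology
open scoped InnerProductSpace
namespace HHCP

variable {H : Type*} [NormedAddCommGroup H] [InnerProductSpace ℂ H] [CompleteSpace H]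

/-- `L_z = √(2y) (X - z̄)⁻¹ S` -/
noncomputable def Lz (X S : H →L[ℂ] H) (x y : ℝ) : H →L[ℂ] H :=
  ((Real.sqrt (2 * y) : ℝ) : ℂ) • ((X - ((x : ℂ) + y * Complex.I) • 1) * Rq x y X * S)

theorem Lz_HS {ι : Type*} {e : HilbertBasis ι ℂ H} {S : H →L[ℂ] H} (hS : HS e S)
    (X : H →L[ℂ] H) (x y : ℝ) : HS e (Lz X S x y) := by
  have h := hS.left (((Real.sqrt (2 * y) : ℝ) : ℂ) • ((X - ((x : ℂ) + y * Complex.I) • 1) * Rq x y X))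
  rwa [smul_mul_assoc] at h

theorem sa_sub_star {A : H →L[ℂ] H} (hA : IsSelfAdjoint A) (x y : ℝ) :
    star (A - ((x : ℂ) + y * Complex.I) • (1 : H →L[ℂ] H)) = A - ((x : ℂ) - y * Complex.I) • 1 := by
  rw [star_sub, hA.star_eq, star_smul, star_one]
  congr 2
  simp [sub_eq_add_neg]

theorem Lz_star {X S : H →L[ℂ] H} (hX : IsSelfAdjoint X) (hSa : IsSelfAdjoint S) (x y : ℝ) :
    ContinuousLinearMap.adjoint (Lz X S x y) =
      ((Real.sqrt (2 * y) : ℝ) : ℂ) • (S * (Rq x y X * (X - ((x : ℂ) - y * Complex.I) • 1))) := by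
  rw [← ContinuousLinearMap.star_eq_adjoint, Lz, star_smul, star_mul, star_mul, hSa.star_eq,
    (Rq_sa x y X).star_eq, sa_sub_star hX]
  congr 1
  exact Complex.conj_ofReal _

theorem Lz_LL {X S : H →L[ℂ] H} (hX : IsSelfAdjoint X) (hSa : IsSelfAdjoint S) (x : ℝ) {y : ℝ}
    (hy : 0 < y) : Lz X S x y * ContinuousLinearMap.adjoint (Lz X S x y) =
    ((2 * y : ℝ) : ℂ) • (((X - ((x : ℂ) + y * Complex.I) • 1) * Rq x y X) * (S * S) *
      (Rq x y X * (X - ((x : ℂ) - y * Complex.I) • 1))) := by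
  rw [Lz_star hX hSa, Lz, smul_mul_smul_comm, ← Complex.ofReal_mul,
    Real.mul_self_sqrt (by positivity)]
  simp only [mul_assoc]

theorem Lz_norm {X S : H →L[ℂ] H} (hX : IsSelfAdjoint X) (x : ℝ) {y : ℝ}
    (hy : 0 < y) (v : H) :
    ((‖Lz X S x y v‖ ^ 2 : ℝ) : ℂ) = ⟪S v, (((2 * y : ℝ) : ℂ) • Rq x y X) (S v)⟫_ℂ := by
  set B := (X - ((x : ℂ) + y * Complex.I) • (1 : H →L[ℂ] H)) with hB
  set B' := (X - ((x : ℂ) - y * Complex.I) • (1 : H →L[ℂ] H)) with hB'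
  have hR : Rq x y X * (B * B') = 1 := Rq_mul x hy hX
  have hc := (Rq_comm x y hX ((x : ℂ) + y * Complex.I)).eq
  have hc' := (Rq_comm x y hX ((x : ℂ) - y * Complex.I)).eq
  rw [← hB] at hc
  rw [← hB'] at hc'
  have hBB : B * B' = B' * B := by
    simp only [hB, hB', sub_mul, mul_sub, smul_mul_assoc, mul_smul_comm, mul_one, one_mul, smul_smul,
      smul_sub]
    module
  have h1 : star (B * Rq x y X) * (B * Rq x y X) = Rq x y X := by
    rw [star_mul, (Rq_sa x y X).star_eq, hB, sa_sub_star hX, ← hB, ← hB']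
    calc Rq x y X * B' * (B * Rq x y X) = Rq x y X * (B * B') * Rq x y X := by
          rw [hBB]; simp only [mul_assoc]
      _ = _ := by rw [hR, one_mul]
  have h2 : Lz X S x y v = ((Real.sqrt (2 * y) : ℝ) : ℂ) • (B * Rq x y X) (S v) := rfl
  have h3 : ⟪(B * Rq x y X) (S v), (B * Rq x y X) (S v)⟫_ℂ = ⟪S v, Rq x y X (S v)⟫_ℂ := by
    rw [← ContinuousLinearMap.adjoint_inner_right, ← ContinuousLinearMap.star_eq_adjoint]
    conv_rhs => rw [← h1]
    rfl
  have h4 : ((‖Lz X S x y v‖ ^ 2 : ℝ) : ℂ) = ⟪Lz X S x y v, Lz X S x y v⟫_ℂ := by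
    rw [inner_self_eq_norm_sq_to_K]; norm_cast
  rw [h4, h2, inner_smul_left, inner_smul_right, h3, ContinuousLinearMap.smul_apply,
    inner_smul_right, Complex.conj_ofReal, ← mul_assoc, ← Complex.ofReal_mul,
    Real.mul_self_sqrt (by positivity)]

theorem trace_conj {ι : Type*} {e : HilbertBasis ι ℂ H} {X Y S : H →L[ℂ] H} (hS : HS e S)
    (hX : IsSelfAdjoint X)
    (hSa : IsSelfAdjoint S) (h : Y * X - X * Y = Complex.I • (S * S)) (m : ℕ) (x : ℝ) {y : ℝ}
    (hy : 0 < y) :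
    HasSum (fun i => ⟪e i, (Ys Y (Lz X S x y) 1 ^ (m + 1) - Y ^ (m + 1)) (e i)⟫_ℂ)
      (((2 * y : ℝ) : ℂ) * Wm e S hS Y m (Rq x y X)) := by
  have hL := Lz_LL (X := X) (S := S) hX hSa x hy
  set B := (X - ((x : ℂ) + y * Complex.I) • (1 : H →L[ℂ] H)) with hB
  set B' := (X - ((x : ℂ) - y * Complex.I) • (1 : H →L[ℂ] H)) with hB'
  have hR : Rq x y X * (B * B') = 1 := Rq_mul x hy hX
  have hc := (Rq_comm x y hX ((x : ℂ) + y * Complex.I)).eq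
  have hc' := (Rq_comm x y hX ((x : ℂ) - y * Complex.I)).eq
  rw [← hB] at hc
  rw [← hB'] at hc'
  have hBB : B * B' = B' * B := by
    simp only [hB, hB', sub_mul, mul_sub, smul_mul_assoc, mul_smul_comm, mul_one, one_mul, smul_smul,
      smul_sub]
    module
  set R := Rq x y X with hRdef
  obtain ⟨Bi', hBi'⟩ : ∃ T, T = B * R := ⟨_, rfl⟩
  obtain ⟨Bi, hBi⟩ : ∃ T, T = R * B' := ⟨_, rfl⟩
  set c : H →L[ℂ] H := (-(2 * y : ℝ) * Complex.I : ℂ) • 1 with hcd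
  have hcc : ∀ r : H →L[ℂ] H, c * r = r * c := by intro r; simp [hcd]
  have hBc : B = B' + c := by
    simp only [hB, hB', hcd]; push_cast; module
  have i1 : B * Bi = 1 := by rw [hBi, ← mul_assoc, ← hc, mul_assoc, hR]
  have i1' : Bi * B = 1 := by rw [hBi, mul_assoc, ← hBB, hR]
  have i2 : B' * Bi' = 1 := by rw [hBi', ← hc, ← mul_assoc, ← hc', mul_assoc, ← hBB, hR]
  have i2' : Bi' * B' = 1 := by rw [hBi', ← hc, mul_assoc, hR]
  have conj : ∀ m : ℕ, B * Bi' * Y ^ (m + 1) * (B' * Bi) = Y ^ (m + 1) +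
      ((2 * y : ℝ) : ℂ) • ∑ j ∈ Finset.range (m + 1), (Bi' * Y ^ j) * (S * S) * (Y ^ (m - j) * Bi) := by
    intro m
    rw [U_alg (Z := Y ^ (m + 1)) i1 i2 i2' hBc hcc]
    have e1 : Y ^ (m + 1) * B' - B' * Y ^ (m + 1) =
        Complex.I • ∑ j ∈ Finset.range (m + 1), Y ^ j * (S * S) * Y ^ (m - j) := by
      rw [← comm_pow h, hB', mul_sub, sub_mul, smul_mul_assoc, mul_smul_comm, mul_one, one_mul]
      try abel
    rw [e1, hcd, mul_smul_comm, smul_mul_assoc, smul_mul_assoc, one_mul, smul_smul]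
    congr 1
    have e2 : (-(2 * y : ℝ) * Complex.I * Complex.I : ℂ) = ((2 * y : ℝ) : ℂ) := by
      rw [mul_assoc, Complex.I_mul_I]; ring
    rw [e2, Finset.mul_sum, Finset.sum_mul]
    refine congrArg _ (Finset.sum_congr rfl fun j _ => ?_)
    simp only [mul_assoc]
  have hU : (B' * Bi) * (B * Bi') = 1 := by
    calc _ = B' * (Bi * B) * Bi' := by simp only [mul_assoc]
      _ = 1 := by rw [i1', mul_one, i2]
  have hU' : (B * Bi') * (B' * Bi) = 1 := by
    calc _ = B * (Bi' * B') * Bi := by simp only [mul_assoc]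
      _ = 1 := by rw [i2', mul_one, i1]
  have hY1 : Ys Y (Lz X S x y) 1 = B * Bi' * Y * (B' * Bi) := by
    have := conj 0
    simp only [zero_add, pow_one, Finset.range_one, Finset.sum_singleton, pow_zero, mul_one,
      Nat.sub_zero, one_mul] at this
    rw [this, Ys, hL, hBi', hBi]
    simp
  have hpow : ∀ n : ℕ, Ys Y (Lz X S x y) 1 ^ n = B * Bi' * Y ^ n * (B' * Bi) := by
    intro n
    induction n with
    | zero => rw [pow_zero, pow_zero, mul_one, hU']
    | succ n ih =>
      rw [pow_succ, ih, hY1]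
      calc _ = B * Bi' * Y ^ n * ((B' * Bi) * (B * Bi')) * Y * (B' * Bi) := by
            simp only [mul_assoc]
        _ = _ := by rw [hU, mul_one, pow_succ]; simp only [mul_assoc]
  rw [hpow, conj, add_sub_cancel_left, Wm_apply]
  refine hasSum_op_smul _ _ _ (hasSum_op _ _ _ fun j _ => ?_)
  have hBB' : Bi * Bi' = R := by
    rw [hBi, hBi']
    calc R * B' * (B * R) = R * (B' * B) * R := by simp only [mul_assoc]
      _ = R := by rw [← hBB, hR, one_mul]
  have := trace_tau hS hSa (Bi' * Y ^ j) (Y ^ (m - j) * Bi)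
  have e3 : Y ^ (m - j) * Bi * (Bi' * Y ^ j) = Y ^ (m - j) * R * Y ^ j := by
    rw [← hBB']; simp only [mul_assoc]
  rwa [e3] at this

/-- The main operator identity. -/
theorem main_identity {ι : Type*} {e : HilbertBasis ι ℂ H} {X Y S : H →L[ℂ] H} (hS : HS e S)
    (hX : IsSelfAdjoint X) (hY : IsSelfAdjoint Y)
    (hSa : IsSelfAdjoint S) (h : Y * X - X * Y = Complex.I • (S * S)) {a b : ℝ}
    (hsX : spectrum ℝ X ⊆ Set.Icc a b)
    (M : Measure (ℝ × ℝ)) [IsFiniteMeasure M] (hM1 : ∀ᵐ q ∂M, q.1 ∈ Set.Icc a b)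
    (hM2 : ∀ᵐ q ∂M, q.2 ∈ Set.Icc a b)
    (hM : ∀ m n : ℕ, HasSum (fun i => ⟪e i, ((-Complex.I) •
      (Y ^ (m + 1) * X ^ (n + 1) - X ^ (n + 1) * Y ^ (m + 1))) (e i)⟫_ℂ)
      (((m + 1) * (n + 1) * ∫ q, q.1 ^ n * q.2 ^ m ∂M : ℝ) : ℂ))
    (x : ℝ) {y : ℝ} (hy : 0 < y) (f : ℝ → ℝ) (hf : Continuous f) :
    ((∫ q, f q.2 * (2 * y * (1 / ((q.1 - x) ^ 2 + y ^ 2))) ∂M : ℝ) : ℂ) =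
      ∫ s in (0:ℝ)..1, tau e (Lz X S x y) (Lz_HS hS X x y) (cfc f (Ys Y (Lz X S x y) s)) := by
  have h_integ : ∀ (p : ℝ × ℝ → ℝ), Measurable p → (∀ᵐ q ∂M, p q ∈ Set.Icc a b) →
      ∀ g : ℝ → ℝ, Continuous g → Integrable (fun q => g (p q)) M := by
    intro p hp hpM g hg
    obtain ⟨C, hC⟩ := (isCompact_Icc (a := a) (b := b)).exists_bound_of_continuousOn hg.continuousOn
    refine Integrable.of_bound (hg.measurable.comp hp).aestronglyMeasurable C ?_
    filter_upwards [hpM] with q hq using hC _ hq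
  -- step 1
  have s1 : ∀ (m n : ℕ), ((∫ q, q.1 ^ n * ((m + 1) * q.2 ^ m) ∂M : ℝ) : ℂ) =
      Wm e S hS Y m (X ^ n) := by
    intro m n
    have h1 := (hM m n).unique (trace_XY hS hSa h m n)
    have h2 : (∫ q, q.1 ^ n * ((m + 1) * q.2 ^ m) ∂M : ℝ) =
        (m + 1) * ∫ q, q.1 ^ n * q.2 ^ m ∂M := by
      rw [← integral_const_mul]
      congr 1; funext q; ring
    rw [h2]
    have hn : ((n : ℂ) + 1) ≠ 0 := by exact_mod_cast Nat.succ_ne_zero n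
    refine mul_left_cancel₀ hn ?_
    rw [← h1]; push_cast; ring
  have s2 : ∀ (m : ℕ) (g : ℝ → ℝ), Continuous g →
      ((∫ q, g q.1 * ((m + 1) * q.2 ^ m) ∂M : ℝ) : ℂ) = Wm e S hS Y m (cfc g X) := by
    intro m g hg
    refine CF.eq (CF.meas M (fun q : ℝ × ℝ => q.1) measurable_fst hM1 (fun q => (m + 1) * q.2 ^ m)
      (h_integ (fun q => q.2) measurable_snd hM2 (fun t => (m + 1) * t ^ m) (by fun_prop)))
      (CF.op (Wm e S hS Y m) hX hsX) (fun n => ?_) g hg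
    rw [cfc_pow_id (R := ℝ) X n, s1]
  -- step 3
  set L := Lz X S x y with hLdef
  set ρ : ℝ := |a| + |b| + ‖Y‖ + ‖L * ContinuousLinearMap.adjoint L‖ with hρ
  have hM2' : ∀ᵐ q ∂M, q.2 ∈ Set.Icc (-ρ) ρ := by
    filter_upwards [hM2] with q hq
    have h1 := neg_abs_le a
    have h2 := le_abs_self b
    have := abs_nonneg a
    have := abs_nonneg b
    have := norm_nonneg Y
    have := norm_nonneg (L * ContinuousLinearMap.adjoint L)
    constructor <;> linarith [hq.1, hq.2]
  have hn : ∀ s ∈ Set.Icc (0:ℝ) 1, ‖Ys Y L s‖ ≤ ρ := by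
    intro s hs
    refine (norm_add_le _ _).trans ?_
    rw [norm_smul, Complex.norm_real, Real.norm_eq_abs, abs_of_nonneg hs.1]
    have := abs_nonneg a
    have := abs_nonneg b
    have := norm_nonneg (L * ContinuousLinearMap.adjoint L)
    nlinarith [hs.2]
  refine CF.eq (CF.meas M (fun q : ℝ × ℝ => q.2) measurable_snd hM2'
    (fun q => (2 * y * (1 / ((q.1 - x) ^ 2 + y ^ 2))))
    (h_integ (fun q => q.1) measurable_fst hM1 _ ((q_cont x hy).const_mul (2 * y))))
    (CF.int (tau e L (Lz_HS hS X x y)) (Ys Y L) (Ys_cont Y L) (Ys_sa hY L) hn) (fun m => ?_) f hf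
  have t1 := (Ys_int (Y := Y) (Lz_HS hS X x y) m).unique (trace_conj hS hX hSa h m x hy)
  have t2 := s2 m _ (q_cont x hy)
  have t3 : ∀ s, cfc (fun t : ℝ => t ^ m) (Ys Y L s) = Ys Y L s ^ m := fun s =>
    cfc_pow_id (R := ℝ) (Ys Y L s) m (ha := Ys_sa hY L s)
  simp only [t3]
  have hm : ((m : ℂ) + 1) ≠ 0 := by exact_mod_cast Nat.succ_ne_zero m
  refine mul_left_cancel₀ hm ?_
  refine Eq.trans ?_ t1.symm
  rw [Rq, ← t2, ← Complex.ofReal_mul, ← integral_const_mul]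
  have : ((m : ℂ) + 1) = (((m + 1 : ℝ)) : ℂ) := by push_cast; ring
  rw [this, ← Complex.ofReal_mul, ← integral_const_mul]
  congr 2
  funext q
  ring

end HHCP

end PartW3

section PartR
open MeasureTheory Filter Topology
open scoped InnerProductSpace
namespace HHCP

variable {H : Type*} [NormedAddCommGroup H] [InnerProductSpace ℂ H] [CompleteSpace H]

/-- the bump `2y²/((t-c)²+y²)` -/
noncomputable def bump (y c t : ℝ) : ℝ := 2 * y ^ 2 * (1 / ((t - c) ^ 2 + y ^ 2))

theorem bump_cont {y : ℝ} (hy : 0 < y) (c : ℝ) : Continuous (bump y c) :=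
  (q_cont c hy).const_mul _

theorem bump_nonneg (y c t : ℝ) : 0 ≤ bump y c t := by unfold bump; positivity

theorem bump_one {y : ℝ} (hy : 0 < y) {c t : ℝ} (h : |t - c| ≤ y) : 1 ≤ bump y c t := by
  unfold bump
  rw [mul_one_div, le_div_iff₀ (by positivity)]
  have := sq_le_sq' (by linarith [abs_le.1 h |>.1]) (abs_le.1 h).2
  linarith

theorem Rq_inv (u : ℝ) {η : ℝ} (hη : 0 < η) {A : H →L[ℂ] H} (hA : IsSelfAdjoint A) :
    Ring.inverse (A - ((u : ℂ) + η * Complex.I) • 1) =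
      Rq u η A * (A - ((u : ℂ) - η * Complex.I) • 1) ∧
    ∀ v, ((‖Ring.inverse (A - ((u : ℂ) + η * Complex.I) • 1) v‖ ^ 2 : ℝ) : ℂ) =
      ⟪v, Rq u η A v⟫_ℂ := by
  set B := (A - ((u : ℂ) + η * Complex.I) • (1 : H →L[ℂ] H)) with hB
  set B' := (A - ((u : ℂ) - η * Complex.I) • (1 : H →L[ℂ] H)) with hB'
  have hR : Rq u η A * (B * B') = 1 := Rq_mul u hη hA
  have hc := (Rq_comm u η hA ((u : ℂ) + η * Complex.I)).eq
  have hc' := (Rq_comm u η hA ((u : ℂ) - η * Complex.I)).eq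
  rw [← hB] at hc
  rw [← hB'] at hc'
  have hBB : B * B' = B' * B := by
    simp only [hB, hB', sub_mul, mul_sub, smul_mul_assoc, mul_smul_comm, mul_one, one_mul, smul_smul,
      smul_sub]
    module
  have i1 : B * (Rq u η A * B') = 1 := by rw [← mul_assoc, ← hc, mul_assoc, hR]
  have i2 : (Rq u η A * B') * B = 1 := by rw [mul_assoc, ← hBB, hR]
  have h0 : Ring.inverse B = Rq u η A * B' := by
    have : B = ((⟨B, Rq u η A * B', i1, i2⟩ : (H →L[ℂ] H)ˣ) : H →L[ℂ] H) := rfl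
    rw [this, Ring.inverse_unit]
    rfl
  refine ⟨h0, fun v => ?_⟩
  have hsB : star B' = B := by
    rw [hB, ← star_star (A - ((u : ℂ) + η * Complex.I) • (1 : H →L[ℂ] H)), sa_sub_star hA]
  have h1 : star (Rq u η A * B') * (Rq u η A * B') = Rq u η A := by
    rw [star_mul, (Rq_sa u η A).star_eq, hsB, hc']
    calc B * Rq u η A * (B' * Rq u η A) = Rq u η A * (B * B') * Rq u η A := by
          rw [← hc]; simp only [mul_assoc]
      _ = _ := by rw [hR, one_mul]
  rw [h0]
  have h4 : ((‖(Rq u η A * B') v‖ ^ 2 : ℝ) : ℂ) = ⟪(Rq u η A * B') v, (Rq u η A * B') v⟫_ℂ := by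
    rw [inner_self_eq_norm_sq_to_K]; norm_cast
  rw [h4, ← ContinuousLinearMap.adjoint_inner_right, ← ContinuousLinearMap.star_eq_adjoint]
  conv_rhs => rw [← h1]
  rfl

theorem cfc_bump_sum {κ : Type*} (A : Finset κ) (u : κ → ℝ) {y : ℝ} (hy : 0 < y)
    {Z : H →L[ℂ] H} (hZ : IsSelfAdjoint Z) :
    cfc (fun l => ∑ k ∈ A, bump y (u k) l) Z = ∑ k ∈ A, ((2 * y ^ 2 : ℝ) : ℂ) • Rq (u k) y Z := by
  have e1 : (fun l => ∑ k ∈ A, bump y (u k) l) = ∑ k ∈ A, bump y (u k) := by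
    funext l; simp
  rw [e1, cfc_sum (f := fun k => bump y (u k)) (a := Z) (s := A)
    (fun k _ => (bump_cont hy (u k)).continuousOn)]
  refine Finset.sum_congr rfl fun k _ => ?_
  unfold bump
  rw [cfc_const_mul (2 * y ^ 2) _ Z (q_cont (u k) hy).continuousOn]
  rfl

theorem row {ι : Type*} {e : HilbertBasis ι ℂ H} {X Y S : H →L[ℂ] H} (hS : HS e S)
    (hX : IsSelfAdjoint X) (hY : IsSelfAdjoint Y)
    (hSa : IsSelfAdjoint S) (h : Y * X - X * Y = Complex.I • (S * S)) {a b : ℝ}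
    (hsX : spectrum ℝ X ⊆ Set.Icc a b)
    (M : Measure (ℝ × ℝ)) [IsFiniteMeasure M] (hM1 : ∀ᵐ q ∂M, q.1 ∈ Set.Icc a b)
    (hM2 : ∀ᵐ q ∂M, q.2 ∈ Set.Icc a b)
    (hM : ∀ m n : ℕ, HasSum (fun i => ⟪e i, ((-Complex.I) •
      (Y ^ (m + 1) * X ^ (n + 1) - X ^ (n + 1) * Y ^ (m + 1))) (e i)⟫_ℂ)
      (((m + 1) * (n + 1) * ∫ q, q.1 ^ n * q.2 ^ m ∂M : ℝ) : ℂ))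
    (x : ℝ) {y : ℝ} (hy : 0 < y) {κ : Type*} (A : Finset κ) (u : κ → ℝ) (C : ℝ)
    (hC : ∀ l, ∑ k ∈ A, bump y (u k) l ≤ C) (F : Finset ι) :
    (∫ q, (∑ k ∈ A, bump y (u k) q.2) * (2 * y * (1 / ((q.1 - x) ^ 2 + y ^ 2))) ∂M : ℝ) ≤
      56 * y * F.card * A.card + C * ∑' i : ↥((F : Set ι)ᶜ), ‖Lz X S x y (e i)‖ ^ 2 := by
  set g : ℝ → ℝ := fun l => ∑ k ∈ A, bump y (u k) l with hg
  have hgc : Continuous g := by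
    refine continuous_finsetSum _ fun k _ => bump_cont hy (u k)
  have hgn : ∀ l, 0 ≤ g l := fun l => Finset.sum_nonneg fun k _ => bump_nonneg _ _ _
  have hC0 : 0 ≤ C := (hgn 0).trans (hC 0)
  have key := main_identity hS hX hY hSa h hsX M hM1 hM2 hM x hy g hgc
  set L := Lz X S x y with hL
  have hLS : HS e L := Lz_HS hS X x y
  set t := ∑' i : ↥((F : Set ι)ᶜ), ‖L (e i)‖ ^ 2 with ht
  have hcont : ContinuousOn (fun s => cfc g (Ys Y L s)) (Set.Icc (0:ℝ) 1) := by
    refine ContinuousOn.cfc' (isCompact_Icc (a := -(‖Y‖ + ‖L * ContinuousLinearMap.adjoint L‖))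
      (b := ‖Y‖ + ‖L * ContinuousLinearMap.adjoint L‖)) g (Ys_cont Y L).continuousOn
        (fun s hs => spec_norm ?_) (fun s _ => Ys_sa hY L s) hgc.continuousOn
    refine (norm_add_le _ _).trans ?_
    rw [norm_smul, Complex.norm_real, Real.norm_eq_abs, abs_of_nonneg hs.1]
    nlinarith [hs.2, norm_nonneg (L * ContinuousLinearMap.adjoint L)]
  have hii : IntervalIntegrable (fun s => tau e L hLS (cfc g (Ys Y L s))) volume 0 1 := by
    refine ContinuousOn.intervalIntegrable ?_
    rw [Set.uIcc_of_le (by norm_num)]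
    exact (tau e L hLS).continuous.comp_continuousOn hcont
  have key2 : (∫ q, g q.2 * (2 * y * (1 / ((q.1 - x) ^ 2 + y ^ 2))) ∂M : ℝ) =
      ∫ s in (0:ℝ)..1, (tau e L hLS (cfc g (Ys Y L s))).re := by
    have h1 := Complex.reCLM.intervalIntegral_comp_comm hii
    have h2 := congrArg Complex.re key
    rw [Complex.ofReal_re] at h2
    rw [h2]
    simpa using h1.symm
  have hinv : ∀ (s : ℝ) (k : κ) (v : H), (⟪v, Rq (u k) y (Ys Y L s) v⟫_ℂ).re =
      ‖Ring.inverse (Qop Y L ((u k : ℂ) + y * Complex.I) s) v‖ ^ 2 := by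
    intro s k v
    rw [← (Rq_inv (u k) hy (Ys_sa hY L s)).2 v, Complex.ofReal_re]
    rfl
  have hpt : ∀ s : ℝ, (tau e L hLS (cfc g (Ys Y L s))).re ≤
      ∑ i ∈ F, ∑ k ∈ A, 2 * y * (y * ‖Ring.inverse (Qop Y L ((u k : ℂ) + y * Complex.I) s) (L (e i))‖ ^ 2)
        + C * t := by
    intro s
    have hsum := (tau_summable hLS (cfc g (Ys Y L s))).of_norm
    have hsum' : Summable fun i => (⟪L (e i), cfc g (Ys Y L s) (L (e i))⟫_ℂ).re :=
      (Complex.hasSum_re hsum.hasSum).summable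
    rw [tau_apply, Complex.re_tsum hsum, ← hsum'.sum_add_tsum_compl (s := F)]
    refine add_le_add (le_of_eq (Finset.sum_congr rfl fun i _ => ?_)) ?_
    · rw [hg, cfc_bump_sum A u hy (Ys_sa hY L s)]
      simp only [ContinuousLinearMap.sum_apply, inner_sum, Complex.re_sum,
        ContinuousLinearMap.smul_apply, inner_smul_right, Complex.re_ofReal_mul, hinv]
      refine Finset.sum_congr rfl fun k _ => ?_
      ring
    · rw [ht, ← tsum_mul_left]
      refine Summable.tsum_le_tsum (fun i => ?_) (hsum'.subtype _) ((Summable.subtype hLS _).mul_left C)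
      have hnorm : ‖cfc g (Ys Y L s)‖ ≤ C := norm_cfc_le hC0 fun l _ => by
        rw [Real.norm_eq_abs, abs_of_nonneg (hgn l)]; exact hC l
      refine (Complex.re_le_norm _).trans ((norm_inner_le_norm _ _).trans ?_)
      have h1 := (cfc g (Ys Y L s)).le_opNorm (L (e i))
      have h2 := mul_le_mul_of_nonneg_right hnorm (norm_nonneg (L (e i)))
      nlinarith [norm_nonneg (L (e i))]
  have hw : ∀ k, ((u k : ℂ) + y * Complex.I).im = y := by intro k; simp
  have hcc : ∀ k (v : H), Continuous fun s : ℝ =>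
      (y * ‖Ring.inverse (Qop Y L ((u k : ℂ) + y * Complex.I) s) v‖ ^ 2) := by
    intro k v
    have e1 : (fun s : ℝ => (y * ‖Ring.inverse (Qop Y L ((u k : ℂ) + y * Complex.I) s) v‖ ^ 2)) =
      fun s : ℝ => (⟪v, Ring.inverse (Qop Y L ((u k : ℂ) + y * Complex.I) s) v⟫_ℂ).im := by
      funext s; rw [Q_real hY L (by rw [hw]; exact hy), hw]
    rw [e1]
    refine Complex.continuous_im.comp (continuous_iff_continuousAt.2 fun s => ?_)
    exact (Q_diff hY L (w := (u k : ℂ) + y * Complex.I) (by rw [hw]; exact hy) (s := s)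
      (by simp) v).continuousAt.comp Complex.continuous_ofReal.continuousAt
  have hic : Continuous fun s : ℝ => ∑ i ∈ F, ∑ k ∈ A, 2 * y *
      (y * ‖Ring.inverse (Qop Y L ((u k : ℂ) + y * Complex.I) s) (L (e i))‖ ^ 2) :=
    continuous_finsetSum _ fun i _ => continuous_finsetSum _ fun k _ => (hcc k _).const_mul _
  rw [key2]
  have m1 : (∫ s in (0:ℝ)..1, (tau e L hLS (cfc g (Ys Y L s))).re) ≤ ∫ s in (0:ℝ)..1,
      ((∑ i ∈ F, ∑ k ∈ A, 2 * y * (y * ‖Ring.inverse (Qop Y L ((u k : ℂ) + y * Complex.I) s) (L (e i))‖ ^ 2))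
        + C * t) := by
    refine intervalIntegral.integral_mono_on (by norm_num) ?_ ?_ fun s _ => hpt s
    · refine ContinuousOn.intervalIntegrable ?_
      rw [Set.uIcc_of_le (by norm_num)]
      exact Complex.continuous_re.comp_continuousOn ((tau e L hLS).continuous.comp_continuousOn hcont)
    · exact (hic.add continuous_const).intervalIntegrable _ _
  refine m1.trans ?_
  rw [intervalIntegral.integral_add (hic.intervalIntegrable _ _) (by simp)]
  refine add_le_add ?_ (by simp)
  rw [intervalIntegral.integral_finsetSum fun i _ =>
    (continuous_finsetSum _ fun k _ => (hcc k (L (e i))).const_mul (2 * y)).intervalIntegrable _ _]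
  have m2 : ∀ i ∈ F, (∫ s in (0:ℝ)..1, ∑ k ∈ A, 2 * y *
      (y * ‖Ring.inverse (Qop Y L ((u k : ℂ) + y * Complex.I) s) (L (e i))‖ ^ 2)) ≤ 56 * y * A.card := by
    intro i _
    rw [intervalIntegral.integral_finsetSum fun k _ =>
      ((hcc k (L (e i))).const_mul (2 * y)).intervalIntegrable _ _]
    have m3 : ∀ k ∈ A, (∫ s in (0:ℝ)..1, 2 * y *
      (y * ‖Ring.inverse (Qop Y L ((u k : ℂ) + y * Complex.I) s) (L (e i))‖ ^ 2)) ≤ 56 * y := by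
      intro k _
      rw [intervalIntegral.integral_const_mul]
      have := contour hY L (w := (u k : ℂ) + y * Complex.I) (by rw [hw]; exact hy) (e i)
      rw [hw, e.orthonormal.1 i] at this
      nlinarith
    refine (Finset.sum_le_sum m3).trans (le_of_eq ?_)
    rw [Finset.sum_const, nsmul_eq_mul]; ring
  refine (Finset.sum_le_sum m2).trans (le_of_eq ?_)
  rw [Finset.sum_const, nsmul_eq_mul]; ring

end HHCP

end PartR

section PartR2
open MeasureTheory Filter Topology
open scoped InnerProductSpace
namespace HHCP

variable {H : Type*} [NormedAddCommGroup H] [InnerProductSpace ℂ H] [CompleteSpace H]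

theorem summable_int_q : Summable (fun k : ℤ => 2 / ((k : ℝ) ^ 2 + 1)) := by
  have h1 : Summable (fun k : ℤ => 1 / (k : ℝ) ^ 2) := Real.summable_one_div_int_pow.2 (by norm_num)
  have h2 : Summable (fun k : ℤ => if k = 0 then (1:ℝ) else 0) :=
    summable_of_finite_support ((Set.finite_singleton (0:ℤ)).subset (by intro k hk; by_contra hne; simp_all))
  refine Summable.of_nonneg_of_le (fun k => by positivity) (fun k => ?_) ((h1.add h2).mul_left 2)
  by_cases hk : k = 0
  · subst hk; simp
  · simp only [hk, if_false, add_zero]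
    have : (0:ℝ) < (k:ℝ) ^ 2 := by positivity
    rw [mul_one_div]
    gcongr
    linarith

theorem bump_sum_bound : ∃ C : ℝ, 0 ≤ C ∧ ∀ (y : ℝ), 0 < y → ∀ (J : Finset ℤ) (t : ℝ),
    ∑ j ∈ J, bump y (2 * y * j) t ≤ C := by
  refine ⟨∑' k : ℤ, 2 / ((k : ℝ) ^ 2 + 1), tsum_nonneg fun k => by positivity, fun y hy J t => ?_⟩
  obtain ⟨n, hr⟩ : ∃ n : ℤ, |t / (2 * y) - n| ≤ 1 / 2 := ⟨_, abs_sub_round _⟩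
  have hs : Summable fun j : ℤ => 2 / (((n - j : ℤ) : ℝ) ^ 2 + 1) :=
    (Equiv.subLeft n).summable_iff.2 summable_int_q
  have he : ∑' j : ℤ, 2 / (((n - j : ℤ) : ℝ) ^ 2 + 1) = ∑' k : ℤ, 2 / ((k : ℝ) ^ 2 + 1) :=
    (Equiv.subLeft n).tsum_eq (fun k : ℤ => 2 / ((k : ℝ) ^ 2 + 1))
  rw [← he]
  refine le_trans (Finset.sum_le_sum fun j _ => ?_) (hs.sum_le_tsum J fun j _ => by positivity)
  unfold bump
  have e1 : t - 2 * y * j = y * (2 * (t / (2 * y) - j)) := by field_simp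
  have e2 : 2 * y ^ 2 * (1 / ((t - 2 * y * j) ^ 2 + y ^ 2)) = 2 / ((2 * (t / (2 * y) - j)) ^ 2 + 1) := by
    rw [e1]; field_simp
  rw [e2]
  have e3 : (((n - j : ℤ) : ℝ)) ^ 2 ≤ (2 * (t / (2 * y) - j)) ^ 2 := by
    rw [sq_le_sq]
    by_cases hnj : n = j
    · rw [hnj, sub_self, Int.cast_zero, abs_zero]; exact abs_nonneg _
    · have h1 : (1:ℝ) ≤ |((n - j : ℤ) : ℝ)| := by
        rw [← Int.cast_abs]
        have h0 : (1:ℤ) ≤ |n - j| := Int.one_le_abs (sub_ne_zero.2 hnj)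
        exact_mod_cast h0
      have h2 : |((n - j : ℤ) : ℝ)| ≤ |t / (2 * y) - n| + |t / (2 * y) - j| := by
        push_cast
        have := abs_sub_le (n:ℝ) (t / (2 * y)) j
        rwa [abs_sub_comm (n:ℝ) (t / (2 * y))] at this
      rw [abs_mul, abs_of_pos (by norm_num : (0:ℝ) < 2)]
      linarith
  exact div_le_div_of_nonneg_left (by norm_num) (by positivity) (by linarith)

theorem total {ι : Type*} {e : HilbertBasis ι ℂ H} {X Y S : H →L[ℂ] H} (hS : HS e S)
    (hX : IsSelfAdjoint X) (hY : IsSelfAdjoint Y)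
    (hSa : IsSelfAdjoint S) (h : Y * X - X * Y = Complex.I • (S * S)) {a b : ℝ}
    (hsX : spectrum ℝ X ⊆ Set.Icc a b)
    (M : Measure (ℝ × ℝ)) [IsFiniteMeasure M] (hM1 : ∀ᵐ q ∂M, q.1 ∈ Set.Icc a b)
    (hM2 : ∀ᵐ q ∂M, q.2 ∈ Set.Icc a b)
    (hM : ∀ m n : ℕ, HasSum (fun i => ⟪e i, ((-Complex.I) •
      (Y ^ (m + 1) * X ^ (n + 1) - X ^ (n + 1) * Y ^ (m + 1))) (e i)⟫_ℂ)
      (((m + 1) * (n + 1) * ∫ q, q.1 ^ n * q.2 ^ m ∂M : ℝ) : ℂ))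
    {C : ℝ} (hC0 : 0 ≤ C) (hC : ∀ (y : ℝ), 0 < y → ∀ (J : Finset ℤ) (t : ℝ),
    ∑ j ∈ J, bump y (2 * y * j) t ≤ C)
    {y : ℝ} (hy : 0 < y) (P : Finset (ℤ × ℤ)) (F : Finset ι) :
    (∫ q, ∑ p ∈ P, bump y (2 * y * p.1) q.1 * bump y (2 * y * p.2) q.2 ∂M : ℝ) ≤
      56 * y ^ 2 * F.card * P.card + C ^ 2 * ∑' i : ↥((F : Set ι)ᶜ), ‖S (e i)‖ ^ 2 := by
  classical
  set J := P.image Prod.fst with hJ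
  set A : ℤ → Finset ℤ := fun j => (P.filter fun p => p.1 = j).image Prod.snd with hA
  have hP : ∀ p : ℤ × ℤ, p ∈ P ↔ p.1 ∈ J ∧ p.2 ∈ A p.1 := by
    rintro ⟨j, k⟩
    simp only [hJ, hA, Finset.mem_image, Finset.mem_filter, Prod.exists]
    constructor
    · intro hp
      exact ⟨⟨j, k, hp, rfl⟩, ⟨j, k, ⟨hp, rfl⟩, rfl⟩⟩
    · rintro ⟨-, j', k', ⟨hp, rfl⟩, rfl⟩
      exact hp
  have hcard : (P.card : ℝ) = ∑ j ∈ J, ((A j).card : ℝ) := by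
    have := Finset.sum_finset_product P J A hP (f := fun _ => (1:ℝ))
    simpa using this
  have h_integ : ∀ (j : ℤ), Integrable (fun q : ℝ × ℝ => y * ((∑ k ∈ A j, bump y (2 * y * k) q.2) *
      (2 * y * (1 / ((q.1 - 2 * y * j) ^ 2 + y ^ 2))))) M := by
    intro j
    have hc : Continuous fun q : ℝ × ℝ => y * ((∑ k ∈ A j, bump y (2 * y * k) q.2) *
      (2 * y * (1 / ((q.1 - 2 * y * j) ^ 2 + y ^ 2)))) := by
      refine (Continuous.mul ?_ ?_).const_mul y
      · exact continuous_finsetSum _ fun k _ => (bump_cont hy _).comp continuous_snd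
      · exact ((q_cont (2 * y * j) hy).comp continuous_fst).const_mul _
    obtain ⟨K, hK⟩ := ((isCompact_Icc (a := a) (b := b)).prod
      (isCompact_Icc (a := a) (b := b))).exists_bound_of_continuousOn hc.continuousOn
    refine Integrable.of_bound hc.aestronglyMeasurable K ?_
    filter_upwards [hM1, hM2] with q h1 h2 using hK q ⟨h1, h2⟩
  have e1 : (∫ q, ∑ p ∈ P, bump y (2 * y * p.1) q.1 * bump y (2 * y * p.2) q.2 ∂M : ℝ) =
      ∑ j ∈ J, y * ∫ q, (∑ k ∈ A j, bump y (2 * y * k) q.2) *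
        (2 * y * (1 / ((q.1 - 2 * y * j) ^ 2 + y ^ 2))) ∂M := by
    simp_rw [← integral_const_mul]
    rw [← integral_finset_sum _ fun j _ => h_integ j]
    refine integral_congr_ae (Eventually.of_forall fun q => ?_)
    simp only
    rw [Finset.sum_finset_product P J A hP]
    refine Finset.sum_congr rfl fun j _ => ?_
    show ∑ k ∈ A j, bump y (2 * y * j) q.1 * bump y (2 * y * k) q.2 = _
    rw [← Finset.mul_sum]
    have hb : bump y (2 * y * j) q.1 = 2 * y ^ 2 * (1 / ((q.1 - 2 * y * j) ^ 2 + y ^ 2)) := rfl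
    rw [hb]
    ring
  rw [e1]
  have e2 : ∀ j ∈ J, y * ∫ q, (∑ k ∈ A j, bump y (2 * y * k) q.2) *
        (2 * y * (1 / ((q.1 - 2 * y * j) ^ 2 + y ^ 2))) ∂M ≤
      56 * y ^ 2 * F.card * (A j).card +
        C * ∑' i : ↥((F : Set ι)ᶜ), y * ‖Lz X S (2 * y * j) y (e i)‖ ^ 2 := by
    intro j _
    have := row hS hX hY hSa h hsX M hM1 hM2 hM (2 * y * j) hy (A j) (fun k => 2 * y * k) C
      (fun l => hC y hy (A j) l) F
    refine (mul_le_mul_of_nonneg_left this hy.le).trans (le_of_eq ?_)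
    rw [tsum_mul_left]; ring
  refine (Finset.sum_le_sum e2).trans ?_
  rw [Finset.sum_add_distrib, ← Finset.mul_sum, ← hcard]
  refine add_le_add le_rfl ?_
  have hLs : ∀ j : ℤ, Summable fun i : ↥((F : Set ι)ᶜ) => y * ‖Lz X S (2 * y * j) y (e i)‖ ^ 2 :=
    fun j => (Summable.subtype (Lz_HS hS X (2 * y * j) y) _).mul_left y
  rw [← Finset.mul_sum, ← Summable.tsum_finsetSum (fun j _ => hLs j), pow_two, mul_assoc]
  refine mul_le_mul_of_nonneg_left ?_ hC0
  rw [← tsum_mul_left]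
  refine Summable.tsum_le_tsum (fun i => ?_) (summable_sum fun j _ => hLs j)
    ((Summable.subtype hS _).mul_left C)
  set v := S (e i) with hv
  have e3 : ∑ j ∈ J, y * ‖Lz X S (2 * y * j) y (e i)‖ ^ 2 =
      (⟪v, cfc (fun l => ∑ j ∈ J, bump y (2 * y * j) l) X v⟫_ℂ).re := by
    rw [cfc_bump_sum J (fun j : ℤ => 2 * y * j) hy hX]
    simp only [ContinuousLinearMap.sum_apply, inner_sum, Complex.re_sum]
    refine Finset.sum_congr rfl fun j _ => ?_
    have h1 := congrArg Complex.re (Lz_norm (S := S) hX (2 * y * j) hy (e i))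
    rw [Complex.ofReal_re, ContinuousLinearMap.smul_apply, inner_smul_right,
      Complex.re_ofReal_mul] at h1
    rw [h1, ContinuousLinearMap.smul_apply, inner_smul_right, Complex.re_ofReal_mul]
    ring
  rw [e3]
  have hnorm : ‖cfc (fun l => ∑ j ∈ J, bump y (2 * y * j) l) X‖ ≤ C := norm_cfc_le hC0 fun l _ => by
    rw [Real.norm_eq_abs, abs_of_nonneg (Finset.sum_nonneg fun k _ => bump_nonneg _ _ _)]
    exact hC y hy J l
  refine (Complex.re_le_norm _).trans ((norm_inner_le_norm _ _).trans ?_)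
  have h1 := (cfc (fun l => ∑ j ∈ J, bump y (2 * y * j) l) X).le_opNorm v
  have h2 := mul_le_mul_of_nonneg_right hnorm (norm_nonneg v)
  nlinarith [norm_nonneg v]

/-- grid cells -/
def cell (y : ℝ) (p : ℤ × ℤ) : Set (ℝ × ℝ) :=
  Set.Ico (2 * y * p.1 - y) (2 * y * p.1 + y) ×ˢ Set.Ico (2 * y * p.2 - y) (2 * y * p.2 + y)

theorem cell_vol {y : ℝ} (hy : 0 < y) (p : ℤ × ℤ) : volume (cell y p) = ENNReal.ofReal (4 * y ^ 2) := by
  rw [cell, Measure.volume_eq_prod, Measure.prod_prod, Real.volume_Ico, Real.volume_Ico,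
    ← ENNReal.ofReal_mul (by linarith)]
  congr 1; ring

theorem cell_idx {y : ℝ} (hy : 0 < y) {t : ℝ} {j : ℤ} (h : t ∈ Set.Ico (2 * y * j - y) (2 * y * j + y)) :
    j = ⌊t / (2 * y) + 1 / 2⌋ := by
  symm
  rw [Int.floor_eq_iff]
  have e : t / (2 * y) + 1 / 2 = (t + y) / (2 * y) := by field_simp
  rw [e, le_div_iff₀ (by positivity), div_lt_iff₀ (by positivity)]
  constructor <;> nlinarith [h.1, h.2]

theorem cell_mem {y : ℝ} (hy : 0 < y) (t : ℝ) : t ∈ Set.Ico (2 * y * ⌊t / (2 * y) + 1 / 2⌋ - y)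
    (2 * y * ⌊t / (2 * y) + 1 / 2⌋ + y) := by
  have h1 := Int.floor_le (t / (2 * y) + 1 / 2)
  have h2 := Int.lt_floor_add_one (t / (2 * y) + 1 / 2)
  have e : t / (2 * y) + 1 / 2 = (t + y) / (2 * y) := by field_simp
  rw [e, le_div_iff₀ (by positivity)] at h1
  rw [e, div_lt_iff₀ (by positivity)] at h2
  rw [e]
  constructor <;> nlinarith

theorem cell_disj {y : ℝ} (hy : 0 < y) {p p' : ℤ × ℤ} (h : p ≠ p') : Disjoint (cell y p) (cell y p') := by
  rw [Set.disjoint_left]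
  intro q hq hq'
  apply h
  exact Prod.ext ((cell_idx hy hq.1).trans (cell_idx hy hq'.1).symm)
    ((cell_idx hy hq.2).trans (cell_idx hy hq'.2).symm)

theorem ac_of_grid (M : Measure (ℝ × ℝ)) [IsFiniteMeasure M]
    (hg : ∀ ε : ℝ, 0 < ε → ∃ K : ℝ, 0 ≤ K ∧ ∀ y : ℝ, 0 < y → ∀ P : Finset (ℤ × ℤ),
      (M (⋃ p ∈ P, cell y p)).toReal ≤ K * (4 * y ^ 2 * P.card) + ε) : M ≪ volume := by
  classical
  refine Measure.AbsolutelyContinuous.mk fun N _ hN => ?_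
  refine le_antisymm (ENNReal.le_of_forall_pos_le_add fun ε hε _ => ?_) bot_le
  obtain ⟨K, hK0, hK⟩ := hg (ε / 2) (by positivity)
  set δ : ℝ := ε / (2 * (K + 1)) with hδ
  have hδ0 : 0 < δ := by positivity
  obtain ⟨U, hNU, hU, hUv⟩ := Set.exists_isOpen_lt_of_lt N (ENNReal.ofReal δ) (by
    rw [hN]; exact ENNReal.ofReal_pos.2 hδ0)
  set yy : ℕ → ℝ := fun n => (1 / 2) ^ n with hyy
  have hyp : ∀ n, 0 < yy n := fun n => by positivity
  set P : ℕ → Finset (ℤ × ℤ) := fun n =>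
    ((Finset.Icc (-(4:ℤ) ^ n) (4 ^ n)) ×ˢ (Finset.Icc (-(4:ℤ) ^ n) (4 ^ n))).filter
      fun p => cell (yy n) p ⊆ U with hP
  set G : ℕ → Set (ℝ × ℝ) := fun n => ⋃ p ∈ P n, cell (yy n) p with hG
  have hGb : ∀ n, M (G n) ≤ ε := by
    intro n
    have h1 := hK (yy n) (hyp n) (P n)
    have h2 : volume (G n) = ENNReal.ofReal (4 * yy n ^ 2 * (P n).card) := by
      rw [hG, measure_biUnion_finset (fun p _ p' _ hpp => cell_disj (hyp n) hpp)
        (fun p _ => measurableSet_Ico.prod measurableSet_Ico)]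
      simp only [cell_vol (hyp n)]
      rw [Finset.sum_const, nsmul_eq_mul, mul_comm (4 * yy n ^ 2), ENNReal.ofReal_mul (by positivity)]
      simp
    have h3 : volume (G n) ≤ volume U := measure_mono (Set.iUnion₂_subset fun p hp =>
      (Finset.mem_filter.1 hp).2)
    have h4 : 4 * yy n ^ 2 * (P n).card ≤ δ := by
      rw [← ENNReal.ofReal_le_ofReal_iff hδ0.le, ← h2]
      exact h3.trans hUv.le
    have h5 : K * (4 * yy n ^ 2 * (P n).card) ≤ ε / 2 := by
      refine (mul_le_mul_of_nonneg_left h4 hK0).trans ?_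
      rw [hδ, mul_div_assoc', div_le_div_iff₀ (by positivity) (by norm_num)]
      have : (0:ℝ) < ε := by exact_mod_cast hε
      nlinarith
    have h6 : (M (G n)).toReal ≤ ε := by linarith
    rw [← ENNReal.ofReal_toReal (measure_ne_top M (G n))]
    rw [← ENNReal.ofReal_coe_nnreal]
    exact ENNReal.ofReal_le_ofReal h6
  have hcov : U ⊆ ⋃ m, ⋂ n ≥ m, G n := by
    intro q hq
    obtain ⟨r, hr, hrU⟩ := Metric.isOpen_iff.1 hU q hq
    have t1 : ∀ᶠ n in atTop, 2 * yy n < r := by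
      have : Tendsto (fun n => 2 * yy n) atTop (𝓝 (2 * 0)) :=
        (tendsto_pow_atTop_nhds_zero_of_lt_one (by norm_num) (by norm_num)).const_mul 2
      rw [mul_zero] at this
      exact this.eventually (gt_mem_nhds hr)
    have t2 : ∀ᶠ n : ℕ in atTop, |q.1| + |q.2| + 1 < (2:ℝ) ^ n :=
      (tendsto_pow_atTop_atTop_of_one_lt (by norm_num : (1:ℝ) < 2)).eventually_gt_atTop _
    obtain ⟨m, hm⟩ := eventually_atTop.1 (t1.and t2)
    refine Set.mem_iUnion.2 ⟨m, Set.mem_iInter₂.2 fun n hn => ?_⟩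
    obtain ⟨h1, h2⟩ := hm n hn
    have hb : ∀ t : ℝ, |t| ≤ |q.1| + |q.2| → ⌊t / (2 * yy n) + 1 / 2⌋ ∈ Finset.Icc (-(4:ℤ) ^ n) (4 ^ n) := by
      intro t ht
      have e1 : t / (2 * yy n) = t * 2 ^ n / 2 := by
        simp only [hyy]; rw [one_div, inv_pow]; field_simp
      have e4 : (4:ℝ) ^ n = 2 ^ n * 2 ^ n := by rw [← mul_pow]; norm_num
      have e2 : (1:ℝ) ≤ 2 ^ n := one_le_pow₀ (by norm_num)
      have e3 := abs_le.1 ht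
      rw [Finset.mem_Icc]
      constructor
      · rw [Int.le_floor]
        push_cast
        rw [e1, e4]
        nlinarith [abs_nonneg q.1, abs_nonneg q.2]
      · have := Int.floor_le (t / (2 * yy n) + 1 / 2)
        have h7 : (⌊t / (2 * yy n) + 1 / 2⌋ : ℝ) ≤ ((4 ^ n : ℤ) : ℝ) := by
          refine this.trans ?_
          push_cast
          rw [e1, e4]
          nlinarith [abs_nonneg q.1, abs_nonneg q.2]
        exact_mod_cast h7
    set p : ℤ × ℤ := (⌊q.1 / (2 * yy n) + 1 / 2⌋, ⌊q.2 / (2 * yy n) + 1 / 2⌋) with hp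
    have hqp : q ∈ cell (yy n) p := ⟨cell_mem (hyp n) q.1, cell_mem (hyp n) q.2⟩
    refine Set.mem_iUnion₂.2 ⟨p, ?_, hqp⟩
    refine Finset.mem_filter.2 ⟨Finset.mem_product.2 ⟨hb _ (by linarith [abs_nonneg q.2]),
      hb _ (by linarith [abs_nonneg q.1])⟩, fun q' hq' => hrU ?_⟩
    rw [Metric.mem_ball, Prod.dist_eq, max_lt_iff, Real.dist_eq, Real.dist_eq, abs_lt, abs_lt]
    have a1 := hqp.1; have a2 := hqp.2; have a3 := hq'.1; have a4 := hq'.2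
    refine ⟨⟨?_, ?_⟩, ⟨?_, ?_⟩⟩ <;> linarith [a1.1, a1.2, a2.1, a2.2, a3.1, a3.2, a4.1, a4.2]
  rw [zero_add]
  refine (measure_mono (hNU.trans hcov)).trans ?_
  have hmono : Monotone fun m => ⋂ n ≥ m, G n := by
    intro m m' hmm
    exact Set.iInter₂_mono' fun n hn => ⟨n, hmm.trans hn, le_rfl⟩
  rw [hmono.measure_iUnion]
  refine iSup_le fun m => (measure_mono ?_).trans (hGb m)
  exact Set.iInter₂_subset m le_rfl

theorem M_ac {ι : Type*} {e : HilbertBasis ι ℂ H} {X Y S : H →L[ℂ] H} (hS : HS e S)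
    (hX : IsSelfAdjoint X) (hY : IsSelfAdjoint Y)
    (hSa : IsSelfAdjoint S) (h : Y * X - X * Y = Complex.I • (S * S)) {a b : ℝ}
    (hsX : spectrum ℝ X ⊆ Set.Icc a b)
    (M : Measure (ℝ × ℝ)) [IsFiniteMeasure M] (hM1 : ∀ᵐ q ∂M, q.1 ∈ Set.Icc a b)
    (hM2 : ∀ᵐ q ∂M, q.2 ∈ Set.Icc a b)
    (hM : ∀ m n : ℕ, HasSum (fun i => ⟪e i, ((-Complex.I) •
      (Y ^ (m + 1) * X ^ (n + 1) - X ^ (n + 1) * Y ^ (m + 1))) (e i)⟫_ℂ)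
      (((m + 1) * (n + 1) * ∫ q, q.1 ^ n * q.2 ^ m ∂M : ℝ) : ℂ)) : M ≪ volume := by
  classical
  obtain ⟨C, hC0, hC⟩ := bump_sum_bound
  refine ac_of_grid M fun ε hε => ?_
  have htail := tendsto_tsum_compl_atTop_zero (fun i => ‖S (e i)‖ ^ 2)
  obtain ⟨F, hF⟩ := (htail.eventually (gt_mem_nhds (show 0 < ε / (C ^ 2 + 1) by positivity))).exists
  refine ⟨14 * F.card, by positivity, fun y hy P => ?_⟩
  have ht := total hS hX hY hSa h hsX M hM1 hM2 hM hC0 hC hy P F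
  have hF' : C ^ 2 * ∑' i : ↥((F : Set ι)ᶜ), ‖S (e i)‖ ^ 2 ≤ ε := by
    have h1 : ∑' i : ↥((F : Set ι)ᶜ), ‖S (e i)‖ ^ 2 < ε / (C ^ 2 + 1) := hF
    rw [lt_div_iff₀ (by positivity)] at h1
    have h2 : 0 ≤ ∑' i : ↥((F : Set ι)ᶜ), ‖S (e i)‖ ^ 2 := tsum_nonneg fun _ => by positivity
    nlinarith
  have hmG : MeasurableSet (⋃ p ∈ P, cell y p) :=
    Finset.measurableSet_biUnion _ fun p _ => measurableSet_Ico.prod measurableSet_Ico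
  have hle : (M (⋃ p ∈ P, cell y p)).toReal ≤
      ∫ q, ∑ p ∈ P, bump y (2 * y * p.1) q.1 * bump y (2 * y * p.2) q.2 ∂M := by
    have e1 : (M (⋃ p ∈ P, cell y p)).toReal =
        ∫ q, Set.indicator (⋃ p ∈ P, cell y p) (fun _ => (1:ℝ)) q ∂M := by
      rw [integral_indicator hmG]; simp [Measure.real]
    rw [e1]
    have hc : Continuous fun q : ℝ × ℝ => ∑ p ∈ P, bump y (2 * y * p.1) q.1 * bump y (2 * y * p.2) q.2 :=
      continuous_finsetSum _ fun p _ => ((bump_cont hy _).comp continuous_fst).mul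
        ((bump_cont hy _).comp continuous_snd)
    obtain ⟨K, hK⟩ := ((isCompact_Icc (a := a) (b := b)).prod
      (isCompact_Icc (a := a) (b := b))).exists_bound_of_continuousOn hc.continuousOn
    refine integral_mono_ae ((integrable_const (1:ℝ)).indicator hmG) ?_ ?_
    · refine Integrable.of_bound hc.aestronglyMeasurable K ?_
      filter_upwards [hM1, hM2] with q h1 h2 using hK q ⟨h1, h2⟩
    · refine Eventually.of_forall fun q => ?_
      have hn : ∀ p : ℤ × ℤ, 0 ≤ bump y (2 * y * p.1) q.1 * bump y (2 * y * p.2) q.2 :=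
        fun p => mul_nonneg (bump_nonneg _ _ _) (bump_nonneg _ _ _)
      by_cases hq : q ∈ ⋃ p ∈ P, cell y p
      · simp only [Set.indicator_of_mem hq]
        obtain ⟨p, hp, hqp⟩ := Set.mem_iUnion₂.1 hq
        refine le_trans ?_ (Finset.single_le_sum (fun p _ => hn p) hp)
        have b1 := bump_one hy (c := 2 * y * p.1) (t := q.1)
          (abs_le.2 ⟨by linarith [hqp.1.1], by linarith [hqp.1.2]⟩)
        have b2 := bump_one hy (c := 2 * y * p.2) (t := q.2)
          (abs_le.2 ⟨by linarith [hqp.2.1], by linarith [hqp.2.2]⟩)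
        nlinarith
      · simp only [Set.indicator_of_notMem hq]
        exact Finset.sum_nonneg fun p _ => hn p
  refine (hle.trans ht).trans ?_
  refine add_le_add (le_of_eq ?_) hF'
  ring

end HHCP

end PartR2

section PartA
open MeasureTheory Filter Topology
namespace HHCP

theorem muT_exists (a b : ℝ) (ξ : Set ℝ → ℝ) (hpos : ∀ Δ : Set ℝ, 0 ≤ ξ Δ)
    (hmeas : ∀ Δ : ℕ → Set ℝ, (∀ n, MeasurableSet (Δ n)) →
      Pairwise (Function.onFun Disjoint Δ) → HasSum (fun n => ξ (Δ n)) (ξ (⋃ n, Δ n))) :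
    ∃ μ : Measure ℝ, IsFiniteMeasure μ ∧ ∀ Δ, MeasurableSet Δ →
      μ Δ = ENNReal.ofReal (ξ (Δ ∩ Set.Icc a b)) := by
  have h0 : ξ ∅ = 0 := by
    have := (hmeas (fun _ => ∅) (fun _ => MeasurableSet.empty)
      (fun i j _ => disjoint_bot_left)).summable
    exact (summable_const_iff _).1 this
  let μ : Measure ℝ := Measure.ofMeasurable
    (fun Δ _ => ENNReal.ofReal (ξ (Δ ∩ Set.Icc a b))) (by simp [h0]) (by
      intro f hf hd
      have := hmeas (fun n => f n ∩ Set.Icc a b) (fun n => (hf n).inter measurableSet_Icc)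
        (fun i j hij => (hd hij).mono Set.inter_subset_left Set.inter_subset_left)
      rw [← Set.iUnion_inter] at this
      rw [← this.tsum_eq, ENNReal.ofReal_tsum_of_nonneg (fun n => hpos _) this.summable])
  have hμ : ∀ Δ, MeasurableSet Δ → μ Δ = ENNReal.ofReal (ξ (Δ ∩ Set.Icc a b)) := fun Δ hΔ =>
    Measure.ofMeasurable_apply Δ hΔ
  refine ⟨μ, ⟨?_⟩, hμ⟩
  rw [hμ _ MeasurableSet.univ]
  exact ENNReal.ofReal_lt_top

theorem exists_M (a b : ℝ) (ξ : ℝ → Set ℝ → ℝ)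
    (hξpos : ∀ (t : ℝ) (Δ : Set ℝ), 0 ≤ ξ t Δ)
    (hξint : ∀ Δ : Set ℝ, MeasurableSet Δ →
      IntegrableOn (fun t => ξ t Δ) (Set.Icc a b))
    (hξmeas : ∀ t : ℝ, ∀ Δ : ℕ → Set ℝ, (∀ n, MeasurableSet (Δ n)) →
      Pairwise (Function.onFun Disjoint Δ) →
      HasSum (fun n => ξ t (Δ n)) (ξ t (⋃ n, Δ n))) :
    ∃ M : Measure (ℝ × ℝ), IsFiniteMeasure M ∧ ∀ Ω Δ, MeasurableSet Ω → MeasurableSet Δ →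
      M (Ω ×ˢ Δ) = ENNReal.ofReal (∫ t in Ω ∩ Set.Icc a b, ξ t (Δ ∩ Set.Icc a b)) := by
  choose μ hμf hμ using fun t => muT_exists a b (ξ t) (hξpos t) (hξmeas t)
  set m : Measure ℝ := volume.restrict (Set.Icc a b) with hm
  have hG : ∀ Δ, MeasurableSet Δ → AEMeasurable (fun t => μ t Δ) m := by
    intro Δ hΔ
    simp_rw [fun t => hμ t Δ hΔ]
    exact (hξint _ (hΔ.inter measurableSet_Icc)).aestronglyMeasurable.aemeasurable.ennreal_ofReal
  -- good set
  have hae : ∀ᵐ t ∂m, (∀ c : ℚ, μ t (Set.Iio (c:ℝ)) = (hG (Set.Iio (c:ℝ)) measurableSet_Iio).mk _ t)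
      ∧ μ t Set.univ = (hG Set.univ MeasurableSet.univ).mk _ t := by
    refine Eventually.and ?_ (hG Set.univ MeasurableSet.univ).ae_eq_mk
    exact ae_all_iff.2 fun c => (hG (Set.Iio (c:ℝ)) measurableSet_Iio).ae_eq_mk
  obtain ⟨G, hGae, hGm, hGood⟩ := hae.exists_measurable_mem
  classical
  let g : ℝ → Measure ℝ := fun t => if t ∈ G then μ t else 0
  have hgf : ∀ t, IsFiniteMeasure (g t) := by
    intro t
    by_cases h : t ∈ G
    · simp only [g, h, if_true]; exact hμf t
    · simp only [g, h, if_false]; infer_instance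
  have hgm : Measurable g := by
    refine Measurable.measure_of_isPiSystem (Real.borel_eq_generateFrom_Iio_rat ▸ BorelSpace.measurable_eq)
      Real.isPiSystem_Iio_rat ?_ ?_
    · intro s hs
      simp only [Set.mem_iUnion, Set.mem_singleton_iff] at hs
      obtain ⟨c, rfl⟩ := hs
      have : (fun t => g t (Set.Iio (c:ℝ))) = G.indicator ((hG (Set.Iio (c:ℝ)) measurableSet_Iio).mk _) := by
        ext t
        by_cases h : t ∈ G
        · simp only [g, h, if_true, Set.indicator_of_mem, (hGood t h).1 c]
        · simp [g, h]
      rw [this]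
      exact (hG (Set.Iio (c:ℝ)) measurableSet_Iio).measurable_mk.indicator hGm
    · have : (fun t => g t Set.univ) = G.indicator ((hG Set.univ MeasurableSet.univ).mk _) := by
        ext t
        by_cases h : t ∈ G
        · simp only [g, h, if_true, Set.indicator_of_mem, (hGood t h).2]
        · simp [g, h]
      rw [this]
      exact (hG Set.univ MeasurableSet.univ).measurable_mk.indicator hGm
  let f : ℝ → Measure (ℝ × ℝ) := fun t => (g t).map (Prod.mk t)
  have hff : ∀ t, IsFiniteMeasure (f t) := fun t => by
    have := hgf t
    exact Measure.isFiniteMeasure_map _ _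
  have hfr : ∀ t Ω Δ, MeasurableSet Ω → MeasurableSet Δ →
      f t (Ω ×ˢ Δ) = Ω.indicator (fun t => g t Δ) t := by
    intro t Ω Δ hΩ hΔ
    simp only [f]
    rw [Measure.map_apply measurable_prodMk_left (hΩ.prod hΔ)]
    by_cases h : t ∈ Ω
    · simp [h]
    · simp [h]
  have hfm : Measurable f := by
    refine Measurable.measure_of_isPiSystem generateFrom_prod.symm isPiSystem_prod ?_ ?_
    · rintro s ⟨Ω, hΩ, Δ, hΔ, rfl⟩
      replace hΔ : MeasurableSet Δ := hΔ
      replace hΩ : MeasurableSet Ω := hΩ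
      simp_rw [hfr _ Ω Δ hΩ hΔ]
      exact ((Measure.measurable_coe hΔ).comp hgm).indicator hΩ
    · simp_rw [← Set.univ_prod_univ, hfr _ _ _ MeasurableSet.univ MeasurableSet.univ]
      exact ((Measure.measurable_coe MeasurableSet.univ).comp hgm).indicator MeasurableSet.univ
  have key : ∀ Ω Δ, MeasurableSet Ω → MeasurableSet Δ →
      m.bind f (Ω ×ˢ Δ) = ENNReal.ofReal (∫ t in Ω ∩ Set.Icc a b, ξ t (Δ ∩ Set.Icc a b)) := by
    intro Ω Δ hΩ hΔ
    rw [Measure.bind_apply (hΩ.prod hΔ) hfm.aemeasurable]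
    simp_rw [hfr _ Ω Δ hΩ hΔ]
    rw [lintegral_indicator hΩ, hm, Measure.restrict_restrict hΩ,
      ofReal_integral_eq_lintegral_ofReal]
    · refine lintegral_congr_ae ?_
      have : ∀ᵐ t ∂(volume.restrict (Ω ∩ Set.Icc a b)), t ∈ G :=
        ae_mono (Measure.restrict_mono Set.inter_subset_right le_rfl) hGae
      filter_upwards [this] with t ht
      simp only [g, ht, if_true, hμ t Δ hΔ]
    · exact (hξint _ (hΔ.inter measurableSet_Icc)).mono_set Set.inter_subset_right
    · exact Eventually.of_forall fun t => hξpos _ _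
  refine ⟨m.bind f, ⟨?_⟩, key⟩
  rw [← Set.univ_prod_univ, key _ _ MeasurableSet.univ MeasurableSet.univ]
  exact ENNReal.ofReal_lt_top

/-- identification of the fibres -/
theorem fibre (a b : ℝ) (ξ : ℝ → Set ℝ → ℝ)
    (hξpos : ∀ (t : ℝ) (Δ : Set ℝ), 0 ≤ ξ t Δ)
    (hξint : ∀ Δ : Set ℝ, MeasurableSet Δ →
      IntegrableOn (fun t => ξ t Δ) (Set.Icc a b))
    (hξmeas : ∀ t : ℝ, ∀ Δ : ℕ → Set ℝ, (∀ n, MeasurableSet (Δ n)) →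
      Pairwise (Function.onFun Disjoint Δ) →
      HasSum (fun n => ξ t (Δ n)) (ξ t (⋃ n, Δ n)))
    (M : Measure (ℝ × ℝ)) (hMf : IsFiniteMeasure M)
    (r : ℝ × ℝ → ℝ) (hr0 : ∀ q, 0 ≤ r q) (hrm : Measurable r)
    (hMr : M = volume.withDensity (fun q => ENNReal.ofReal (r q)))
    (hM : ∀ Ω Δ, MeasurableSet Ω → MeasurableSet Δ →
      M (Ω ×ˢ Δ) = ENNReal.ofReal (∫ t in Ω ∩ Set.Icc a b, ξ t (Δ ∩ Set.Icc a b))) :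
    ∀ᵐ t ∂(volume : Measure ℝ), t ∈ Set.Icc a b →
        ∀ Δ : Set ℝ, MeasurableSet Δ → Δ ⊆ Set.Icc a b →
          (volume Δ = 0 → ξ t Δ = 0) ∧ ξ t Δ = ∫ l in Δ, r (t, l) := by
  choose μ hμf hμ using fun t => muT_exists a b (ξ t) (hξpos t) (hξmeas t)
  rw [← ae_restrict_iff' measurableSet_Icc]
  set m : Measure ℝ := volume.restrict (Set.Icc a b) with hm
  have hrm' : Measurable fun q => ENNReal.ofReal (r q) := hrm.ennreal_ofReal
  have hG : ∀ Δ, MeasurableSet Δ → AEMeasurable (fun t => μ t Δ) m := by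
    intro Δ hΔ
    simp_rw [fun t => hμ t Δ hΔ]
    exact (hξint _ (hΔ.inter measurableSet_Icc)).aestronglyMeasurable.aemeasurable.ennreal_ofReal
  have hrect : ∀ Ω Δ, MeasurableSet Ω → MeasurableSet Δ →
      M (Ω ×ˢ Δ) = ∫⁻ t in Ω, ∫⁻ l in Δ, ENNReal.ofReal (r (t, l)) := by
    intro Ω Δ hΩ hΔ
    rw [hMr, withDensity_apply _ (hΩ.prod hΔ), Measure.volume_eq_prod,
      ← Measure.prod_restrict, lintegral_prod _ hrm'.aemeasurable]
  have h1 : ∀ Δ, MeasurableSet Δ → ∀ᵐ t ∂m, μ t Δ = ∫⁻ l in Δ, ENNReal.ofReal (r (t, l)) := by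
    intro Δ hΔ
    have hfin : ∫⁻ t, μ t Δ ∂m ≠ ⊤ := by
      simp_rw [fun t => hμ t Δ hΔ]
      rw [hm, ← ofReal_integral_eq_lintegral_ofReal (hξint _ (hΔ.inter measurableSet_Icc))
        (Eventually.of_forall fun t => hξpos _ _)]
      exact ENNReal.ofReal_ne_top
    refine ae_eq_of_forall_setLIntegral_eq_of_sigmaFinite₀ (hG Δ hΔ)
      (Measurable.lintegral_prod_right' (f := fun q : ℝ × ℝ => ENNReal.ofReal (r q)) hrm').aemeasurable ?_
    intro Ω hΩ _
    rw [hm, Measure.restrict_restrict hΩ, ← hrect _ _ (hΩ.inter measurableSet_Icc) hΔ,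
      hM _ _ (hΩ.inter measurableSet_Icc) hΔ, Set.inter_assoc, Set.inter_self,
      ofReal_integral_eq_lintegral_ofReal]
    · exact lintegral_congr fun t => hμ t Δ hΔ
    · exact (hξint _ (hΔ.inter measurableSet_Icc)).mono_set Set.inter_subset_right
    · exact Eventually.of_forall fun t => hξpos _ _
  have h2 : ∀ᵐ t ∂m, μ t = volume.withDensity (fun l => ENNReal.ofReal (r (t, l))) := by
    have ha := ae_all_iff.2 fun c : ℚ => h1 (Set.Iio (c:ℝ)) measurableSet_Iio
    filter_upwards [ha, h1 Set.univ MeasurableSet.univ] with t hc hu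
    haveI := hμf t
    refine ext_of_generate_finite _ (Real.borel_eq_generateFrom_Iio_rat ▸ BorelSpace.measurable_eq)
      Real.isPiSystem_Iio_rat ?_ ?_
    · intro s hs
      simp only [Set.mem_iUnion, Set.mem_singleton_iff] at hs
      obtain ⟨c, rfl⟩ := hs
      rw [withDensity_apply _ measurableSet_Iio, hc c]
    · rw [withDensity_apply _ MeasurableSet.univ, hu]
  filter_upwards [h2] with t ht Δ hΔ hΔI
  have e1 : ENNReal.ofReal (ξ t Δ) = ∫⁻ l in Δ, ENNReal.ofReal (r (t, l)) := by
    rw [← withDensity_apply _ hΔ, ← ht, hμ t Δ hΔ, Set.inter_eq_left.2 hΔI]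
  have e2 : ξ t Δ = ∫ l in Δ, r (t, l) := by
    rw [integral_eq_lintegral_of_nonneg_ae (Eventually.of_forall fun l => hr0 _)
      (hrm.comp measurable_prodMk_left).aestronglyMeasurable, ← e1,
      ENNReal.toReal_ofReal (hξpos _ _)]
  refine ⟨fun h0 => ?_, e2⟩
  rw [e2, Measure.restrict_eq_zero.2 h0, integral_zero_measure]

end HHCP

end PartA

section PartC
open MeasureTheory Filter Topology
open scoped InnerProductSpace
namespace HHCP

variable {H : Type*} [NormedAddCommGroup H] [InnerProductSpace ℂ H] [CompleteSpace H]

/-- `(∫_a f)(A)` -/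
noncomputable def PJ (a : ℝ) (f : ℝ → ℝ) (A : H →L[ℂ] H) : H →L[ℂ] H :=
  cfc (fun t : ℝ => ∫ s in a..t, f s) A

theorem prim_cont {a b : ℝ} (hab : a ≤ b) {f : ℝ → ℝ}
    (hf : Integrable f (volume.restrict (Set.Icc a b))) :
    ContinuousOn (fun t : ℝ => ∫ s in a..t, f s) (Set.Icc a b) := by
  have := intervalIntegral.continuousOn_primitive_interval (a := a) (b := b) (f := f) (μ := volume)
    (by rw [Set.uIcc_of_le hab]; exact hf)
  rwa [Set.uIcc_of_le hab] at this

theorem prim_int {a b : ℝ} {f : ℝ → ℝ}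
    (hf : Integrable f (volume.restrict (Set.Icc a b))) {t : ℝ} (ht : t ∈ Set.Icc a b) :
    IntervalIntegrable f volume a t := by
  rw [intervalIntegrable_iff_integrableOn_Icc_of_le ht.1]
  exact IntegrableOn.mono_set hf (Set.Icc_subset_Icc_right ht.2)

theorem PJ_congr {a b : ℝ} {f g : ℝ → ℝ} {A : H →L[ℂ] H} (hs : spectrum ℝ A ⊆ Set.Icc a b)
    (h : ∀ t ∈ Set.Icc a b, f t = g t) : PJ a f A = PJ a g A := by
  refine cfc_congr fun t ht => ?_
  refine intervalIntegral.integral_congr fun s hs' => ?_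
  have ht' := hs ht
  rw [Set.uIcc_of_le ht'.1] at hs'
  exact h s ⟨hs'.1, hs'.2.trans ht'.2⟩

theorem PJ_add {a b : ℝ} (hab : a ≤ b) {f g : ℝ → ℝ} {A : H →L[ℂ] H}
    (hs : spectrum ℝ A ⊆ Set.Icc a b)
    (hf : Integrable f (volume.restrict (Set.Icc a b)))
    (hg : Integrable g (volume.restrict (Set.Icc a b))) :
    PJ a (fun x => f x + g x) A = PJ a f A + PJ a g A := by
  unfold PJ
  rw [← cfc_add _ _ _ ((prim_cont hab hf).mono hs) ((prim_cont hab hg).mono hs)]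
  refine cfc_congr fun t ht => ?_
  exact intervalIntegral.integral_add (prim_int hf (hs ht)) (prim_int hg (hs ht))

theorem PJ_smul {a b : ℝ} (hab : a ≤ b) (c : ℝ) {f : ℝ → ℝ} {A : H →L[ℂ] H}
    (hs : spectrum ℝ A ⊆ Set.Icc a b)
    (hf : Integrable f (volume.restrict (Set.Icc a b))) :
    PJ a (fun x => c * f x) A = (c : ℂ) • PJ a f A := by
  unfold PJ
  rw [Complex.coe_smul, ← cfc_smul _ _ _ ((prim_cont hab hf).mono hs)]
  refine cfc_congr fun t ht => ?_
  simp

theorem PJ_norm {a b : ℝ} {f : ℝ → ℝ} {A : H →L[ℂ] H}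
    (hs : spectrum ℝ A ⊆ Set.Icc a b)
    (hf : Integrable f (volume.restrict (Set.Icc a b))) :
    ‖PJ a f A‖ ≤ ∫ x, |f x| ∂(volume.restrict (Set.Icc a b)) := by
  unfold PJ
  refine norm_cfc_le (integral_nonneg fun _ => abs_nonneg _) fun t ht => ?_
  have ht' := hs ht
  refine (intervalIntegral.norm_integral_le_integral_norm ht'.1).trans ?_
  rw [intervalIntegral.integral_of_le ht'.1]
  refine setIntegral_mono_set hf.norm (Eventually.of_forall fun _ => norm_nonneg _) ?_
  refine HasSubset.Subset.eventuallyLE fun s hs' => ⟨hs'.1.le, hs'.2.trans ht'.2⟩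

theorem PJ_pow {a b : ℝ} {A : H →L[ℂ] H} (hA : IsSelfAdjoint A) (n : ℕ) :
    PJ a (fun t => ((n : ℝ) + 1) * t ^ n) A = A ^ (n + 1) - ((a ^ (n + 1) : ℝ) : ℂ) • 1 := by
  unfold PJ
  have e1 : (fun t : ℝ => ∫ s in a..t, ((n : ℝ) + 1) * s ^ n) =
      fun t => t ^ (n + 1) - a ^ (n + 1) := by
    ext t
    rw [intervalIntegral.integral_const_mul, integral_pow]
    have : (n : ℝ) + 1 ≠ 0 := by positivity
    field_simp
  rw [e1, cfc_sub (fun t : ℝ => t ^ (n + 1)) (fun _ => a ^ (n + 1)) A, cfc_pow_id A (n + 1),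
    cfc_const (a ^ (n + 1)) A, Algebra.algebraMap_eq_smul_one, Complex.coe_smul]

theorem L1F_PJ {a b : ℝ} (hab : a ≤ b) {A : H →L[ℂ] H} (hs : spectrum ℝ A ⊆ Set.Icc a b)
    (φ : (H →L[ℂ] H) →ₗ[ℂ] ℂ) {c : ℝ} (hc0 : 0 ≤ c) (hc : ∀ T, ‖φ T‖ ≤ c * ‖T‖) :
    L1F (volume.restrict (Set.Icc a b)) (fun f => φ (PJ a f A)) where
  add f g hf hg := by rw [PJ_add hab hs hf hg, map_add]
  smul r f hf := by rw [PJ_smul hab r hs hf, map_smul, smul_eq_mul]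
  bound := ⟨c, hc0, fun f hf => (hc _).trans (mul_le_mul_of_nonneg_left (PJ_norm hs hf) hc0)⟩

/-- diagonal entries of `-i[P,Q]` -/
noncomputable def cm (v : H) (P Q : H →L[ℂ] H) : ℂ := ⟪v, ((-Complex.I) • (P * Q - Q * P)) v⟫_ℂ

theorem cm_add_left (v : H) (P P' Q : H →L[ℂ] H) : cm v (P + P') Q = cm v P Q + cm v P' Q := by
  unfold cm
  rw [← inner_add_right, ← ContinuousLinearMap.add_apply, ← smul_add]
  congr 4; noncomm_ring
theorem cm_add_right (v : H) (P Q Q' : H →L[ℂ] H) : cm v P (Q + Q') = cm v P Q + cm v P Q' := by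
  unfold cm
  rw [← inner_add_right, ← ContinuousLinearMap.add_apply, ← smul_add]
  congr 4; noncomm_ring
theorem cm_smul_left (v : H) (c : ℂ) (P Q : H →L[ℂ] H) : cm v (c • P) Q = c * cm v P Q := by
  have h : (-Complex.I) • ((c • P) * Q - Q * (c • P)) = c • ((-Complex.I) • (P * Q - Q * P)) := by
    rw [smul_mul_assoc, mul_smul_comm, ← smul_sub, smul_comm]
  unfold cm
  rw [h, ContinuousLinearMap.smul_apply, inner_smul_right]
theorem cm_smul_right (v : H) (c : ℂ) (P Q : H →L[ℂ] H) : cm v P (c • Q) = c * cm v P Q := by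
  have h : (-Complex.I) • (P * (c • Q) - (c • Q) * P) = c • ((-Complex.I) • (P * Q - Q * P)) := by
    rw [smul_mul_assoc, mul_smul_comm, ← smul_sub, smul_comm]
  unfold cm
  rw [h, ContinuousLinearMap.smul_apply, inner_smul_right]

theorem cm_bound (v : H) (P Q : H →L[ℂ] H) : ‖cm v P Q‖ ≤ 2 * ‖v‖ ^ 2 * ‖P‖ * ‖Q‖ := by
  unfold cm
  refine (norm_inner_le_norm _ _).trans ?_
  have h1 := ((-Complex.I) • (P * Q - Q * P)).le_opNorm v
  have h2 : ‖(-Complex.I) • (P * Q - Q * P)‖ ≤ 2 * (‖P‖ * ‖Q‖) := by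
    rw [norm_smul, norm_neg, Complex.norm_I, one_mul]
    refine (norm_sub_le _ _).trans ?_
    have := norm_mul_le P Q
    have := norm_mul_le Q P
    nlinarith
  calc ‖v‖ * ‖((-Complex.I) • (P * Q - Q * P)) v‖ ≤ ‖v‖ * (2 * (‖P‖ * ‖Q‖) * ‖v‖) := by
        gcongr
        exact h1.trans (mul_le_mul_of_nonneg_right h2 (norm_nonneg _))
    _ = _ := by ring

theorem L1F_right {a b : ℝ} (hab : a ≤ b) {A : H →L[ℂ] H} (hs : spectrum ℝ A ⊆ Set.Icc a b)
    (v : H) (P : H →L[ℂ] H) :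
    L1F (volume.restrict (Set.Icc a b)) (fun f => cm v P (PJ a f A)) :=
  L1F_PJ hab hs
    { toFun := cm v P, map_add' := cm_add_right v P, map_smul' := fun c Q => cm_smul_right v c P Q }
    (c := 2 * ‖v‖ ^ 2 * ‖P‖) (by positivity) (fun T => cm_bound v P T)

theorem L1F_left {a b : ℝ} (hab : a ≤ b) {A : H →L[ℂ] H} (hs : spectrum ℝ A ⊆ Set.Icc a b)
    (v : H) (Q : H →L[ℂ] H) :
    L1F (volume.restrict (Set.Icc a b)) (fun f => cm v (PJ a f A) Q) :=
  L1F_PJ hab hs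
    { toFun := fun P => cm v P Q, map_add' := fun P P' => cm_add_left v P P' Q,
      map_smul' := fun c P => cm_smul_left v c P Q }
    (c := 2 * ‖v‖ ^ 2 * ‖Q‖) (by positivity) (fun T => (cm_bound v T Q).trans (le_of_eq (by ring)))

theorem sum_help {ι : Type*} {x y z : ι → ℂ} (h : ∀ i, x i + y i = z i) (hz : Summable z)
    (hx : Summable x) : Summable y := by
  refine (hz.sub hx).congr fun i => ?_
  rw [← h i]; ring

theorem sum_help' {ι : Type*} {x : ι → ℂ} (h : ∑' i, x i ≠ 0) : Summable x := by
  by_contra hcon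
  exact h (tsum_eq_zero_of_not_summable hcon)

/-- summability of all the sums -/
theorem grid_summable {ι : Type*} (s : Set ℝ → Set ℝ → ι → ℂ) (M : Measure (ℝ × ℝ))
    [IsFiniteMeasure M] (hM0 : M ≠ 0)
    (h1 : ∀ Δ Ω, MeasurableSet Δ → MeasurableSet Ω → ∀ i, s Δ Ω i + s Δ Ωᶜ i = s Δ Set.univ i)
    (h2 : ∀ Δ Ω, MeasurableSet Δ → MeasurableSet Ω → ∀ i, s Δ Ω i + s Δᶜ Ω i = s Set.univ Ω i)
    (h3 : ∀ Δ Ω, MeasurableSet Δ → MeasurableSet Ω → ∑' i, s Δ Ω i = ((M.real (Ω ×ˢ Δ) : ℝ) : ℂ))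
    {Δ Ω : Set ℝ} (hΔ : MeasurableSet Δ) (hΩ : MeasurableSet Ω) : Summable (s Δ Ω) := by
  have key : ∀ Δ Ω, MeasurableSet Δ → MeasurableSet Ω → M (Ω ×ˢ Δ) ≠ 0 → Summable (s Δ Ω) := by
    intro Δ Ω hΔ hΩ h
    refine sum_help' ?_
    rw [h3 Δ Ω hΔ hΩ]
    rw [Ne, Complex.ofReal_eq_zero, measureReal_eq_zero_iff]
    exact h
  have hu : M Set.univ ≠ 0 := by rwa [Ne, Measure.measure_univ_eq_zero]
  have huu : Summable (s Set.univ Set.univ) := by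
    refine key _ _ MeasurableSet.univ MeasurableSet.univ ?_
    rwa [Set.univ_prod_univ]
  have split : ∀ {A B : Set (ℝ × ℝ)}, A ∪ B = Set.univ → M A ≠ 0 ∨ M B ≠ 0 := by
    intro A B hAB
    by_contra! hc
    refine hu (le_antisymm ?_ bot_le)
    rw [← hAB]
    refine (measure_union_le A B).trans ?_
    rw [hc.1, hc.2, add_zero]
  have hr : ∀ Ω, MeasurableSet Ω → Summable (s Set.univ Ω) := by
    intro Ω hΩ
    rcases split (A := Ω ×ˢ Set.univ) (B := Ωᶜ ×ˢ Set.univ)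
      (by ext q; simp [em]) with h | h
    · exact key _ _ MeasurableSet.univ hΩ h
    · have := key _ _ MeasurableSet.univ hΩ.compl h
      exact sum_help (fun i => by rw [add_comm]; exact h1 _ _ MeasurableSet.univ hΩ i) huu this
  have hc : ∀ Δ, MeasurableSet Δ → Summable (s Δ Set.univ) := by
    intro Δ hΔ
    rcases split (A := Set.univ ×ˢ Δ) (B := Set.univ ×ˢ Δᶜ)
      (by ext q; simp [em]) with h | h
    · exact key _ _ hΔ MeasurableSet.univ h
    · have := key _ _ hΔ.compl MeasurableSet.univ h
      exact sum_help (fun i => by rw [add_comm]; exact h2 _ _ hΔ MeasurableSet.univ i) huu this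
  have f1 : Summable (s Δ Ωᶜ) → Summable (s Δ Ω) := fun h =>
    sum_help (fun i => by rw [add_comm]; exact h1 _ _ hΔ hΩ i) (hc Δ hΔ) h
  have f2 : Summable (s Δᶜ Ω) → Summable (s Δ Ω) := fun h =>
    sum_help (fun i => by rw [add_comm]; exact h2 _ _ hΔ hΩ i) (hr Ω hΩ) h
  have f3 : Summable (s Δᶜ Ωᶜ) → Summable (s Δᶜ Ω) := fun h =>
    sum_help (fun i => by rw [add_comm]; exact h1 _ _ hΔ.compl hΩ i) (hc _ hΔ.compl) h
  rcases split (A := Ω ×ˢ Δ ∪ Ω ×ˢ Δᶜ) (B := Ωᶜ ×ˢ Δ ∪ Ωᶜ ×ˢ Δᶜ)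
    (by ext q; simp; tauto) with h | h <;>
  rw [Ne, measure_union_null_iff, not_and_or] at h <;> rcases h with h | h
  · exact key _ _ hΔ hΩ h
  · exact f2 (key _ _ hΔ.compl hΩ h)
  · exact f1 (key _ _ hΔ hΩ.compl h)
  · exact f2 (f3 (key _ _ hΔ.compl hΩ.compl h))

set_option maxHeartbeats 1000000 in
theorem moments {ι : Type*} {e : HilbertBasis ι ℂ H} {X Y : H →L[ℂ] H}
    (hX : IsSelfAdjoint X) (hY : IsSelfAdjoint Y) {a b : ℝ} (hab : a ≤ b)
    (hsX : spectrum ℝ X ⊆ Set.Icc a b) (hsY : spectrum ℝ Y ⊆ Set.Icc a b)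
    (M : Measure (ℝ × ℝ)) [IsFiniteMeasure M] (hM1 : ∀ᵐ q ∂M, q.1 ∈ Set.Icc a b)
    (hM2 : ∀ᵐ q ∂M, q.2 ∈ Set.Icc a b) (hM0 : M ≠ 0)
    (h3 : ∀ Δ Ω, MeasurableSet Δ → MeasurableSet Ω →
      ∑' i, cm (e i) (PJ a (Set.indicator Δ (fun _ => (1:ℝ))) Y)
        (PJ a (Set.indicator Ω (fun _ => (1:ℝ))) X) = ((M.real (Ω ×ˢ Δ) : ℝ) : ℂ)) (m n : ℕ) :
    HasSum (fun i => ⟪e i, ((-Complex.I) •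
      (Y ^ (m + 1) * X ^ (n + 1) - X ^ (n + 1) * Y ^ (m + 1))) (e i)⟫_ℂ)
      (((m + 1) * (n + 1) * ∫ q, q.1 ^ n * q.2 ^ m ∂M : ℝ) : ℂ) := by
  have hi : ∀ Δ : Set ℝ, MeasurableSet Δ → Integrable (Set.indicator Δ (fun _ => (1:ℝ)))
      (volume.restrict (Set.Icc a b)) := fun Δ hΔ => (integrable_const _).indicator hΔ
  have hcompl : ∀ (A : H →L[ℂ] H), spectrum ℝ A ⊆ Set.Icc a b → ∀ Δ, MeasurableSet Δ →
      PJ a (Set.indicator Δ (fun _ => (1:ℝ))) A + PJ a (Set.indicator Δᶜ (fun _ => (1:ℝ))) A =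
        PJ a (Set.indicator Set.univ (fun _ => (1:ℝ))) A := by
    intro A hs Δ hΔ
    rw [← PJ_add hab hs (hi _ hΔ) (hi _ hΔ.compl)]
    congr 1
    funext x
    by_cases hx : x ∈ Δ <;> simp [hx]
  have hsum : ∀ Δ Ω, MeasurableSet Δ → MeasurableSet Ω →
      HasSum (fun i => cm (e i) (PJ a (Set.indicator Δ (fun _ => (1:ℝ))) Y)
        (PJ a (Set.indicator Ω (fun _ => (1:ℝ))) X)) ((M.real (Ω ×ˢ Δ) : ℝ) : ℂ) := by
    intro Δ Ω hΔ hΩ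
    rw [← h3 Δ Ω hΔ hΩ]
    refine (grid_summable (fun Δ Ω i => cm (e i) (PJ a (Set.indicator Δ (fun _ => (1:ℝ))) Y)
        (PJ a (Set.indicator Ω (fun _ => (1:ℝ))) X)) M hM0 ?_ ?_ h3 hΔ hΩ).hasSum
    · intro Δ Ω hΔ hΩ i
      rw [← cm_add_right, hcompl X hsX Ω hΩ]
    · intro Δ Ω hΔ hΩ i
      rw [← cm_add_left, hcompl Y hsY Δ hΔ]
  have hfi : Integrable (fun q : ℝ × ℝ => ((n:ℝ) + 1) * q.1 ^ n) M := by
    have hc : Continuous fun t : ℝ => ((n:ℝ) + 1) * t ^ n := by fun_prop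
    obtain ⟨K, hK⟩ := (isCompact_Icc (a := a) (b := b)).exists_bound_of_continuousOn hc.continuousOn
    refine Integrable.of_bound (hc.comp continuous_fst).aestronglyMeasurable K ?_
    filter_upwards [hM1] with q h1 using hK q.1 h1
  have st1 : ∀ Δ, MeasurableSet Δ →
      HasSum (fun i => cm (e i) (PJ a (Set.indicator Δ (fun _ => (1:ℝ))) Y)
        (PJ a (fun t => ((n:ℝ) + 1) * t ^ n) X))
        ((∫ q, (((n:ℝ) + 1) * q.1 ^ n) * Set.indicator Δ (fun _ => (1:ℝ)) q.2 ∂M : ℝ) : ℂ) := by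
    intro Δ hΔ
    refine nik_ext' M a b Prod.fst measurable_fst hM1
      (fun q => Set.indicator Δ (fun _ => (1:ℝ)) q.2)
      ((integrable_const (1:ℝ)).indicator (measurable_snd hΔ))
      (fun i f => cm (e i) (PJ a (Set.indicator Δ (fun _ => (1:ℝ))) Y) (PJ a f X))
      (fun i => L1F_right hab hsX (e i) (PJ a (Set.indicator Δ (fun _ => (1:ℝ))) Y)) ?_ (fun t => ((n:ℝ) + 1) * t ^ n) (by fun_prop)
    intro Ω hΩ
    have e1 : (∫ q, Set.indicator Ω (fun _ => (1:ℝ)) q.1 * Set.indicator Δ (fun _ => (1:ℝ)) q.2 ∂M)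
        = M.real (Ω ×ˢ Δ) := by
      rw [← integral_indicator_one (hΩ.prod hΔ)]
      refine integral_congr_ae (Eventually.of_forall fun q => ?_)
      by_cases h1 : q.1 ∈ Ω <;> by_cases h2 : q.2 ∈ Δ <;> simp [h1, h2, Set.indicator]
    rw [e1]
    exact hsum Δ Ω hΔ hΩ
  have st2 : HasSum (fun i => cm (e i) (PJ a (fun t => ((m:ℝ) + 1) * t ^ m) Y)
        (PJ a (fun t => ((n:ℝ) + 1) * t ^ n) X))
        ((∫ q, (((m:ℝ) + 1) * q.2 ^ m) * (((n:ℝ) + 1) * q.1 ^ n) ∂M : ℝ) : ℂ) := by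
    refine nik_ext' M a b Prod.snd measurable_snd hM2
      (fun q => ((n:ℝ) + 1) * q.1 ^ n) hfi
      (fun i f => cm (e i) (PJ a f Y) (PJ a (fun t => ((n:ℝ) + 1) * t ^ n) X))
      (fun i => L1F_left hab hsY (e i) (PJ a (fun t => ((n:ℝ) + 1) * t ^ n) X)) ?_ (fun t => ((m:ℝ) + 1) * t ^ m) (by fun_prop)
    intro Δ hΔ
    have e1 : (∫ q, Set.indicator Δ (fun _ => (1:ℝ)) q.2 * (((n:ℝ) + 1) * q.1 ^ n) ∂M) =
        ∫ q, (((n:ℝ) + 1) * q.1 ^ n) * Set.indicator Δ (fun _ => (1:ℝ)) q.2 ∂M :=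
      integral_congr_ae (Eventually.of_forall fun q => mul_comm _ _)
    rw [e1]
    exact st1 Δ hΔ
  have e2 : (∫ q, ((m:ℝ) + 1) * q.2 ^ m * (((n:ℝ) + 1) * q.1 ^ n) ∂M) =
      (m + 1) * (n + 1) * ∫ q, q.1 ^ n * q.2 ^ m ∂M := by
    rw [← integral_const_mul]
    refine integral_congr_ae (Eventually.of_forall fun q => ?_)
    simp only; ring
  rw [e2] at st2
  refine st2.congr_fun fun i => ?_
  rw [PJ_pow (b := b) hX, PJ_pow (b := b) hY]
  unfold cm
  congr 3
  simp only [sub_mul, mul_sub, smul_mul_assoc, mul_smul_comm, one_mul, mul_one]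
  module

end HHCP

end PartC

section PartE
open MeasureTheory Filter Topology
open scoped InnerProductSpace
namespace HHCP

variable {H : Type*} [NormedAddCommGroup H] [InnerProductSpace ℂ H] [CompleteSpace H]

theorem PJ_univ {a : ℝ} {A : H →L[ℂ] H} (hA : IsSelfAdjoint A) :
    PJ a (Set.indicator Set.univ (fun _ => (1:ℝ))) A = A - (a : ℂ) • 1 := by
  have h := PJ_pow (a := a) (b := a) hA 0
  simp only [Nat.cast_zero, zero_add, pow_zero, mul_one, pow_one] at h
  rw [Set.indicator_univ]
  exact h

theorem HS_sqrt {ι : Type*} {e : HilbertBasis ι ℂ H} {D2 : H →L[ℂ] H} (hpos : D2.IsPositive)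
    (hs : Summable fun i => ⟪e i, D2 (e i)⟫_ℂ) :
    ∃ S : H →L[ℂ] H, HS e S ∧ IsSelfAdjoint S ∧ S * S = D2 := by
  have h0 : 0 ≤ D2 := (ContinuousLinearMap.nonneg_iff_isPositive D2).2 hpos
  have hSS : CFC.sqrt D2 * CFC.sqrt D2 = D2 := CFC.sqrt_mul_sqrt_self D2 h0
  have hSa : IsSelfAdjoint (CFC.sqrt D2) := (CFC.sqrt_nonneg D2).isSelfAdjoint
  refine ⟨CFC.sqrt D2, ?_, hSa, hSS⟩
  unfold HS
  refine (Complex.hasSum_re hs.hasSum).summable.congr fun i => ?_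
  have h1 : ContinuousLinearMap.adjoint (CFC.sqrt D2) = CFC.sqrt D2 := hSa.star_eq
  conv_lhs => rw [← hSS]
  rw [ContinuousLinearMap.mul_apply, ← ContinuousLinearMap.adjoint_inner_left, h1]
  exact inner_self_eq_norm_sq (𝕜 := ℂ) _

theorem core {ι : Type*} (e : HilbertBasis ι ℂ H) (X Y D2 : H →L[ℂ] H)
    (a b : ℝ) (hab : a ≤ b) (hX : IsSelfAdjoint X) (hY : IsSelfAdjoint Y)
    (hD2 : (2 : ℂ) • D2 = (-(2 : ℂ) * Complex.I) • (Y * X - X * Y))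
    (hpos : D2.IsPositive)
    (hsX : spectrum ℝ X ⊆ Set.Icc a b) (hsY : spectrum ℝ Y ⊆ Set.Icc a b)
    (ξ : ℝ → Set ℝ → ℝ) (η : Set ℝ → ℝ → ℝ)
    (hξpos : ∀ (t : ℝ) (Δ : Set ℝ), 0 ≤ ξ t Δ)
    (hηpos : ∀ (Ω : Set ℝ) (l : ℝ), 0 ≤ η Ω l)
    (hξint : ∀ Δ : Set ℝ, MeasurableSet Δ →
      IntegrableOn (fun t => ξ t Δ) (Set.Icc a b))
    (hηint : ∀ Ω : Set ℝ, MeasurableSet Ω →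
      IntegrableOn (fun l => η Ω l) (Set.Icc a b))
    (hξmeas : ∀ t : ℝ, ∀ Δ : ℕ → Set ℝ, (∀ n, MeasurableSet (Δ n)) →
      Pairwise (Function.onFun Disjoint Δ) →
      HasSum (fun n => ξ t (Δ n)) (ξ t (⋃ n, Δ n)))
    (hηmeas : ∀ l : ℝ, ∀ Ω : ℕ → Set ℝ, (∀ n, MeasurableSet (Ω n)) →
      Pairwise (Function.onFun Disjoint Ω) →
      HasSum (fun n => η (Ω n) l) (η (⋃ n, Ω n) l))
    (hconn : ∀ Δ Ω : Set ℝ, MeasurableSet Δ → MeasurableSet Ω →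
      Δ ⊆ Set.Icc a b → Ω ⊆ Set.Icc a b →
      (∑' i, cm (e i) (PJ a (Set.indicator Δ (fun _ => (1:ℝ))) Y)
        (PJ a (Set.indicator Ω (fun _ => (1:ℝ))) X)) = Complex.ofReal (∫ t in Ω, ξ t Δ) ∧
      (∫ t in Ω, ξ t Δ) = ∫ l in Δ, η Ω l) :
    ∃ r : ℝ → ℝ → ℝ,
      IntegrableOn (fun q : ℝ × ℝ => r q.1 q.2) (Set.Icc a b ×ˢ Set.Icc a b) ∧
      (∀ᵐ q : ℝ × ℝ ∂(volume : Measure (ℝ × ℝ)),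
        q ∈ Set.Icc a b ×ˢ Set.Icc a b → 0 ≤ r q.1 q.2) ∧
      (∀ᵐ t ∂(volume : Measure ℝ), t ∈ Set.Icc a b →
        ∀ Δ : Set ℝ, MeasurableSet Δ → Δ ⊆ Set.Icc a b →
          (volume Δ = 0 → ξ t Δ = 0) ∧ ξ t Δ = ∫ l in Δ, r t l) ∧
      (∀ᵐ l ∂(volume : Measure ℝ), l ∈ Set.Icc a b →
        ∀ Ω : Set ℝ, MeasurableSet Ω → Ω ⊆ Set.Icc a b →
          (volume Ω = 0 → η Ω l = 0) ∧ η Ω l = ∫ t in Ω, r t l) ∧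
      Complex.ofReal (∫ t in Set.Icc a b, ∫ l in Set.Icc a b, |r t l|) =
        ∑' i, ⟪e i, D2 (e i)⟫_ℂ := by
  obtain ⟨M, hMf, hM⟩ := exists_M a b ξ hξpos hξint hξmeas
  have hD2' : D2 = (-Complex.I) • (Y * X - X * Y) := by
    have h2 : (2:ℂ) • D2 = (2:ℂ) • ((-Complex.I) • (Y * X - X * Y)) := by
      rw [hD2, smul_smul]; congr 1; ring
    exact smul_right_injective _ (two_ne_zero) h2
  have hI : MeasurableSet (Set.Icc a b) := measurableSet_Icc
  -- restriction to the interval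
  have hPJI : ∀ (A : H →L[ℂ] H), spectrum ℝ A ⊆ Set.Icc a b → ∀ Δ : Set ℝ,
      PJ a (Set.indicator Δ (fun _ => (1:ℝ))) A =
        PJ a (Set.indicator (Δ ∩ Set.Icc a b) (fun _ => (1:ℝ))) A := by
    intro A hs Δ
    refine PJ_congr hs fun t ht => ?_
    by_cases h : t ∈ Δ <;> simp [h, ht.1, ht.2]
  have h3 : ∀ Δ Ω, MeasurableSet Δ → MeasurableSet Ω →
      ∑' i, cm (e i) (PJ a (Set.indicator Δ (fun _ => (1:ℝ))) Y)
        (PJ a (Set.indicator Ω (fun _ => (1:ℝ))) X) = ((M.real (Ω ×ˢ Δ) : ℝ) : ℂ) := by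
    intro Δ Ω hΔ hΩ
    rw [hPJI Y hsY Δ, hPJI X hsX Ω, (hconn _ _ (hΔ.inter hI) (hΩ.inter hI)
      Set.inter_subset_right Set.inter_subset_right).1, Measure.real, hM Ω Δ hΩ hΔ,
      ENNReal.toReal_ofReal]
    exact integral_nonneg fun t => hξpos _ _
  have hcmD : ∀ i, cm (e i) (PJ a (Set.indicator Set.univ (fun _ => (1:ℝ))) Y)
        (PJ a (Set.indicator Set.univ (fun _ => (1:ℝ))) X) = ⟪e i, D2 (e i)⟫_ℂ := by
    intro i
    rw [PJ_univ hX, PJ_univ hY, hD2']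
    unfold cm
    congr 3
    simp only [sub_mul, mul_sub, smul_mul_assoc, mul_smul_comm, one_mul, mul_one]
    module
  have hM1 : ∀ᵐ q ∂M, q.1 ∈ Set.Icc a b := by
    rw [ae_iff]
    have : {q : ℝ × ℝ | ¬ q.1 ∈ Set.Icc a b} = (Set.Icc a b)ᶜ ×ˢ Set.univ := by
      ext q; simp
    rw [this, hM _ _ hI.compl MeasurableSet.univ, Set.compl_inter_self]
    simp
  have hξ0 : ∀ t, ξ t ∅ = 0 := fun t => by
    have := (hξmeas t (fun _ => ∅) (fun _ => MeasurableSet.empty)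
      (fun i j _ => disjoint_bot_left)).summable
    exact (summable_const_iff _).1 this
  have hM2 : ∀ᵐ q ∂M, q.2 ∈ Set.Icc a b := by
    rw [ae_iff]
    have : {q : ℝ × ℝ | ¬ q.2 ∈ Set.Icc a b} = Set.univ ×ˢ (Set.Icc a b)ᶜ := by
      ext q; simp
    rw [this, hM _ _ MeasurableSet.univ hI.compl, Set.compl_inter_self]
    simp [hξ0]
  have hac : M ≪ (volume : Measure (ℝ × ℝ)) := by
    by_cases hM0 : M = 0
    · rw [hM0]; exact Measure.AbsolutelyContinuous.zero _
    · have hsum : Summable fun i => ⟪e i, D2 (e i)⟫_ℂ := by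
        refine sum_help' ?_
        rw [← tsum_congr hcmD, h3 _ _ MeasurableSet.univ MeasurableSet.univ, Set.univ_prod_univ,
          Ne, Complex.ofReal_eq_zero, measureReal_eq_zero_iff, Measure.measure_univ_eq_zero]
        exact hM0
      obtain ⟨S, hS, hSa, hSS⟩ := HS_sqrt hpos hsum
      refine M_ac hS hX hY hSa ?_ hsX M hM1 hM2
        (moments hX hY hab hsX hsY M hM1 hM2 hM0 h3)
      rw [hSS, hD2', smul_smul]
      simp
  set r : ℝ × ℝ → ℝ := fun q => (M.rnDeriv volume q).toReal with hr
  have hr0 : ∀ q, 0 ≤ r q := fun q => ENNReal.toReal_nonneg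
  have hrm : Measurable r := (Measure.measurable_rnDeriv M volume).ennreal_toReal
  have hri : Integrable r := Measure.integrable_toReal_rnDeriv
  have hMr : M = volume.withDensity (fun q => ENNReal.ofReal (r q)) := by
    conv_lhs => rw [← Measure.withDensity_rnDeriv_eq M volume hac]
    refine withDensity_congr_ae ?_
    filter_upwards [Measure.rnDeriv_lt_top M volume] with q hq
    simp only [hr]
    rw [ENNReal.ofReal_toReal hq.ne]
  have F1 := fibre a b ξ hξpos hξint hξmeas M hMf r hr0 hrm hMr hM
  have hMr' : M.map Prod.swap = volume.withDensity (fun q => ENNReal.ofReal (r q.swap)) := by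
    ext s hs
    rw [Measure.map_apply measurable_swap hs, withDensity_apply _ hs, hMr,
      withDensity_apply _ (measurable_swap hs)]
    have hmp : MeasurePreserving (Prod.swap : ℝ × ℝ → ℝ × ℝ) volume volume :=
      Measure.measurePreserving_swap
    have := hmp.setLIntegral_comp_preimage hs (f := fun q => ENNReal.ofReal (r q.swap))
      (hrm.comp measurable_swap).ennreal_ofReal
    rw [← this]
    simp
  have F2 := fibre a b (fun l Ω => η Ω l) (fun l Ω => hηpos Ω l) hηint hηmeas (M.map Prod.swap)
    (Measure.isFiniteMeasure_map _ _) (fun q => r q.swap) (fun q => hr0 _)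
    (hrm.comp measurable_swap) hMr' (by
      intro Δ Ω hΔ hΩ
      rw [Measure.map_apply measurable_swap (hΔ.prod hΩ), Set.preimage_swap_prod, hM Ω Δ hΩ hΔ,
        (hconn _ _ (hΔ.inter hI) (hΩ.inter hI) Set.inter_subset_right Set.inter_subset_right).2])
  refine ⟨fun t l => r (t, l), hri.integrableOn, Eventually.of_forall fun q _ => hr0 _, F1, F2, ?_⟩
  have e1 : (∫ t in Set.Icc a b, ∫ l in Set.Icc a b, |r (t, l)|) =
      ∫ t in Set.Icc a b, ξ t (Set.Icc a b) := by
    refine setIntegral_congr_ae hI ?_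
    filter_upwards [F1] with t ht htI
    rw [(ht htI _ hI subset_rfl).2]
    simp_rw [abs_of_nonneg (hr0 _)]
  rw [e1, ← (hconn _ _ hI hI subset_rfl subset_rfl).1, ← tsum_congr hcmD, hPJI X hsX Set.univ,
    hPJI Y hsY Set.univ, Set.univ_inter]

end HHCP

end PartE

namespace HHCP

variable {H : Type*} [NormedAddCommGroup H] [InnerProductSpace ℂ H] [CompleteSpace H]
  [TopologicalSpace.SeparableSpace H]

theorem statement14 {ι : Type*} (e : HilbertBasis ι ℂ H) (X Y D2 : H →L[ℂ] H)
    (a b : ℝ) (hA : AssumptionA e X Y D2 a b)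
    (EX EY : Set ℝ → H →L[ℂ] H)
    (hEX : IsSpectralMeasureOf X EX) (hEY : IsSpectralMeasureOf Y EY)
    (ξ : ℝ → Set ℝ → ℝ) (η : Set ℝ → ℝ → ℝ)
    (hξpos : ∀ (t : ℝ) (Δ : Set ℝ), 0 ≤ ξ t Δ)
    (hηpos : ∀ (Ω : Set ℝ) (l : ℝ), 0 ≤ η Ω l)
    (hξint : ∀ Δ : Set ℝ, MeasurableSet Δ →
      IntegrableOn (fun t => ξ t Δ) (Set.Icc a b))
    (hηint : ∀ Ω : Set ℝ, MeasurableSet Ω →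
      IntegrableOn (fun l => η Ω l) (Set.Icc a b))
    (hξmeas : ∀ t : ℝ, ∀ Δ : ℕ → Set ℝ, (∀ n, MeasurableSet (Δ n)) →
      Pairwise (Function.onFun Disjoint Δ) →
      HasSum (fun n => ξ t (Δ n)) (ξ t (⋃ n, Δ n)))
    (hηmeas : ∀ l : ℝ, ∀ Ω : ℕ → Set ℝ, (∀ n, MeasurableSet (Ω n)) →
      Pairwise (Function.onFun Disjoint Ω) →
      HasSum (fun n => η (Ω n) l) (η (⋃ n, Ω n) l))
    (hconn : ∀ Δ Ω : Set ℝ, MeasurableSet Δ → MeasurableSet Ω →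
      Δ ⊆ Set.Icc a b → Ω ⊆ Set.Icc a b →
      trace e ((-Complex.I) •
          (JindOp a Δ Y * JindOp a Ω X - JindOp a Ω X * JindOp a Δ Y)) =
        Complex.ofReal (∫ t in Ω, ξ t Δ) ∧
      (∫ t in Ω, ξ t Δ) = ∫ l in Δ, η Ω l)
    (hξD2 : ∀ Δ : Set ℝ, MeasurableSet Δ → Δ ⊆ Set.Icc a b →
      Complex.ofReal (∫ t in Set.Icc a b, ξ t Δ) = trace e (EY Δ * D2))
    (hηD2 : ∀ Ω : Set ℝ, MeasurableSet Ω → Ω ⊆ Set.Icc a b →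
      Complex.ofReal (∫ l in Set.Icc a b, η Ω l) = trace e (EX Ω * D2)) :
    ∃ r : ℝ → ℝ → ℝ,
      IntegrableOn (fun q : ℝ × ℝ => r q.1 q.2) (Set.Icc a b ×ˢ Set.Icc a b) ∧
      (∀ᵐ q : ℝ × ℝ ∂(volume : Measure (ℝ × ℝ)),
        q ∈ Set.Icc a b ×ˢ Set.Icc a b → 0 ≤ r q.1 q.2) ∧
      (∀ᵐ t ∂(volume : Measure ℝ), t ∈ Set.Icc a b →
        ∀ Δ : Set ℝ, MeasurableSet Δ → Δ ⊆ Set.Icc a b →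
          (volume Δ = 0 → ξ t Δ = 0) ∧ ξ t Δ = ∫ l in Δ, r t l) ∧
      (∀ᵐ l ∂(volume : Measure ℝ), l ∈ Set.Icc a b →
        ∀ Ω : Set ℝ, MeasurableSet Ω → Ω ⊆ Set.Icc a b →
          (volume Ω = 0 → η Ω l = 0) ∧ η Ω l = ∫ t in Ω, r t l) ∧
      Complex.ofReal (∫ t in Set.Icc a b, ∫ l in Set.Icc a b, |r t l|) = trace e D2 := by
  have hJ : ∀ (A : H →L[ℂ] H), IsSelfAdjoint A → ∀ Δ : Set ℝ,
      JindOp a Δ A = PJ a (Set.indicator Δ (fun _ => (1:ℝ))) A := by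
    intro A hA' Δ
    unfold JindOp fc PJ
    exact (cfc_real_eq_complex (fun t => Jind a Δ t) hA').symm
  refine core e X Y D2 a b hA.hab hA.hX hA.hY hA.hD2 hA.hpos hA.hspecX hA.hspecY ξ η hξpos hηpos
    hξint hηint hξmeas hηmeas ?_
  intro Δ Ω hΔ hΩ hΔI hΩI
  have h := hconn Δ Ω hΔ hΩ hΔI hΩI
  rw [hJ Y hA.hY, hJ X hA.hX] at h
  exact h

end HHCP
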